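/- arXiv:2112.04265 — 4 statements merged into one kernel-verified Lean document; each statement's English description precedes it below -/
import Mathlib

section
/- Let k ≥ 1, x ≥ 1, w ≥ 0 and s ≥ 1 be integers, and suppose that either (3) x ≡ 2 (mod 4) and (2k−12w−2)/4 ≤ s ≤ (6k−12w−9)/4, or (4) x ≡ 3 (mod 4) and (2k−12w−3)/4 ≤ s ≤ (6k−12w−10)/4. Suppose there exists a near graceful labelling of C_3^{4w+x} C_4^{s} which, in case (3), contains a triangle whose three vertices receive the labels 0, 4s+12w+5 and 4s+12w+7, and which, in case (4), contains one triangle whose vertices receive the labels 0, 4s+12w+7, 4s+12w+8 and another triangle whose vertices receive the labels 0, 4s+12w+6, 4s+12w+10. Then a near graceful labelling of C_3^{4w+x} C_4^{s+4k−1} exists. -/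
/-- The vertex type of a windmill whose vanes are cycles of lengths given by the list `L`:
`none` is the central vertex, and `some ⟨i, j⟩` is the `j`-th non-central vertex of the
`i`-th vane (a cycle of length `L.get i`, contributing `L.get i - 1` non-central vertices). -/
abbrev WindmillVertex (L : List ℕ) : Type :=
  Option (Σ i : Fin L.length, Fin (L.get i - 1))

/-- Base relation for the windmill graph: the central vertex is joined to the two ends of
each vane's path, and consecutive vertices along each vane's path are joined. -/
def windmillRel (L : List ℕ) : WindmillVertex L → WindmillVertex L → Prop
  | none, some ⟨i, j⟩ => j.val = 0 ∨ j.val + 2 = L.get i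
  | some ⟨i, j⟩, some ⟨i', j'⟩ => i.val = i'.val ∧ j'.val = j.val + 1
  | _, _ => False

/-- The windmill graph with vanes of cycle lengths given by `L`, all sharing one central
vertex.  `Windmill (List.replicate t n)` is `Cₙᵗ`. -/
def Windmill (L : List ℕ) : SimpleGraph (WindmillVertex L) :=
  SimpleGraph.fromRel (windmillRel L)

/-- The edge label induced by a vertex labelling `f`: the absolute difference of the labels
of the two endpoints. -/
def edgeLabel {V : Type*} (f : V → ℕ) : Sym2 V → ℕ :=
  Sym2.lift ⟨fun u v => ((f u : ℤ) - (f v : ℤ)).natAbs,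
    fun u v => by dsimp only; omega⟩

/-- `f` is a graceful labelling of the graph `G` with `m` edges: `f` is an injective map
into `{0, …, m}` and the induced edge labelling is a bijection onto `{1, …, m}`. -/
def IsGracefulLabelling {V : Type*} (G : SimpleGraph V) (m : ℕ) (f : V → ℕ) : Prop :=
  Function.Injective f ∧ (∀ v, f v ≤ m) ∧
    Set.BijOn (edgeLabel f) G.edgeSet (Set.Icc 1 m)

/-- The graph `G`, with `m` edges, is graceful. -/
def IsGraceful {V : Type*} (G : SimpleGraph V) (m : ℕ) : Prop :=
  ∃ f, IsGracefulLabelling G m f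

/-- `f` is a near graceful labelling of the graph `G` with `m` edges: `f` is an injective
map into `{0, …, m+1}` and the induced edge labelling is a bijection onto either
`{1, …, m}` or `{1, …, m-1, m+1}`. -/
def IsNearGracefulLabelling {V : Type*} (G : SimpleGraph V) (m : ℕ) (f : V → ℕ) : Prop :=
  Function.Injective f ∧ (∀ v, f v ≤ m + 1) ∧
    (Set.BijOn (edgeLabel f) G.edgeSet (Set.Icc 1 m) ∨
      Set.BijOn (edgeLabel f) G.edgeSet (Set.Icc 1 (m - 1) ∪ {m + 1}))

/-- The graph `G`, with `m` edges, is near graceful. -/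
def IsNearGraceful {V : Type*} (G : SimpleGraph V) (m : ℕ) : Prop :=
  ∃ f, IsNearGracefulLabelling G m f


/-- The labelling `f` gives a triangle of `G` whose three vertices receive the labels
`l1`, `l2`, `l3`. -/
def HasTriangleLabelled {V : Type*} (G : SimpleGraph V) (f : V → ℕ)
    (l1 l2 l3 : ℕ) : Prop :=
  ∃ u v w, G.Adj u v ∧ G.Adj v w ∧ G.Adj u w ∧ f u = l1 ∧ f v = l2 ∧ f w = l3


/-- A system of `N` four-cycles through the centre `0` with edge labels `T+1, …, T+4N`. -/
def QuadSys (T N : ℕ) : Prop :=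
  ∃ p q c : ℕ → ℕ,
    (∀ i < N, T + 1 ≤ p i ∧ T + 1 ≤ q i ∧ p i + c i ≤ T + 4 * N ∧ q i + c i ≤ T + 4 * N ∧
      1 ≤ c i) ∧
    (∀ v < T + 4 * N + 1, T + 1 ≤ v →
      ∃ i < N, v = p i ∨ v = q i ∨ v = p i + c i ∨ v = q i + c i) ∧
    (∀ i < N, ∀ j < N, c i = c j → i = j) ∧
    (∀ i < N, ∀ j < N, c i ≠ p j + c j ∧ c i ≠ q j + c j)

theorem quadSys_base (T N : ℕ) (h : N ≤ T + 1) : QuadSys T N := by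
  refine ⟨fun i => T + 1 + i, fun i => T + 2 * N + 1 + i, fun i => 2 * N - 1 - 2 * i,
    ?_, ?_, ?_, ?_⟩
  · intro i hi; dsimp only; omega
  · intro v h1 h2
    dsimp only
    by_cases a1 : v ≤ T + N
    · exact ⟨v - T - 1, by omega, by omega⟩
    by_cases a2 : v ≤ T + 2 * N
    · exact ⟨T + 2 * N - v, by omega, by omega⟩
    by_cases a3 : v ≤ T + 3 * N
    · exact ⟨v - T - 2 * N - 1, by omega, by omega⟩
    · exact ⟨T + 4 * N - v, by omega, by omega⟩
  · intro i hi j hj; dsimp only; omega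
  · intro i hi j hj; dsimp only; omega

theorem quadSys_step (T N a : ℕ) (hQ : QuadSys T N) (h1 : a ≤ T + 4 * N)
    (h2 : T + 4 * N ≤ 3 * a + 1) : QuadSys T (N + (2 * a + 1)) := by
  obtain ⟨p, q, c, hb, hs, hc, hd⟩ := hQ
  -- the new quadruples
  obtain ⟨M, hM⟩ : ∃ M, M = T + 4 * N := ⟨_, rfl⟩
  obtain ⟨c', hc'⟩ : ∃ c' : ℕ → ℕ, ∀ i, (i < a → c' i + 2 * i = 5 * a + 1) ∧
      (a ≤ i → i < 2 * a + 1 → c' i + 2 * i = 7 * a + 2) :=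
    ⟨fun i => if i < a then 5 * a + 1 - 2 * i else 7 * a + 2 - 2 * i, by
      intro i; dsimp only; split_ifs <;> omega⟩
  refine ⟨fun i => if i < N then p i else M + 1 + (i - N),
    fun i => if i < N then q i else M + 2 * a + 2 + (i - N),
    fun i => if i < N then c i else c' (i - N), ?_, ?_, ?_, ?_⟩
  · intro i hi
    dsimp only
    by_cases h : i < N
    · have := hb i h
      simp only [h, if_true]; omega
    · have := hc' (i - N)
      simp only [h, if_false]; omega
  · intro v hv1 hv2
    by_cases a0 : v ≤ M
    · obtain ⟨i, hi, h⟩ := hs v (by omega) hv2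
      refine ⟨i, by omega, ?_⟩
      simpa only [hi, if_true] using h
    have key : ∃ i < 2 * a + 1, v = M + 1 + i ∨ v = M + 2 * a + 2 + i ∨
        v = M + 1 + i + c' i ∨ v = M + 2 * a + 2 + i + c' i := by
      by_cases a1 : v ≤ M + (2 * a + 1)
      · exact ⟨v - M - 1, by omega, by omega⟩
      by_cases a2 : v ≤ M + 2 * (2 * a + 1)
      · exact ⟨v - M - 2 * a - 2, by omega, by omega⟩
      by_cases a3 : v ≤ M + 5 * a + 2
      · refine ⟨M + 5 * a + 2 - v, by omega, ?_⟩
        have := hc' (M + 5 * a + 2 - v)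
        omega
      by_cases a4 : v ≤ M + 6 * a + 3
      · refine ⟨M + 7 * a + 3 - v, by omega, ?_⟩
        have := hc' (M + 7 * a + 3 - v)
        omega
      by_cases a5 : v ≤ M + 7 * a + 3
      · refine ⟨M + 7 * a + 3 - v, by omega, ?_⟩
        have := hc' (M + 7 * a + 3 - v)
        omega
      · refine ⟨M + 9 * a + 4 - v, by omega, ?_⟩
        have := hc' (M + 9 * a + 4 - v)
        omega
    obtain ⟨i, hi, h⟩ := key
    refine ⟨N + i, by omega, ?_⟩
    have e1 : ¬ (N + i < N) := by omega
    have e2 : N + i - N = i := by omega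
    simpa only [e1, if_false, e2] using h
  · intro i hi j hj
    dsimp only
    by_cases h : i < N <;> by_cases h' : j < N <;> simp only [h, h', if_true, if_false]
    · exact hc i h j h'
    · have := hb i h
      have := hc' (j - N)
      omega
    · have := hb j h'
      have := hc' (i - N)
      omega
    · have := hc' (j - N)
      have := hc' (i - N)
      omega
  · intro i hi j hj
    dsimp only
    by_cases h : i < N <;> by_cases h' : j < N <;> simp only [h, h', if_true, if_false]
    · exact hd i h j h'
    · have := hb i h
      have := hc' (j - N)
      omega
    · have := hb j h'
      have := hc' (i - N)
      omega
    · have := hc' (j - N)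
      have := hc' (i - N)
      omega

theorem quadSys_2_4 : QuadSys 2 4 := by
  refine ⟨fun i => [15, 11, 3, 4].getD i 0, fun i => [17, 12, 7, 5].getD i 0,
    fun i => [1, 2, 3, 4].getD i 0, ?_, ?_, ?_, ?_⟩ <;> decide

set_option maxRecDepth 10000 in
theorem quadSys_2_7 : QuadSys 2 7 := by
  refine ⟨fun i => [27, 23, 18, 13, 6, 4, 3].getD i 0,
    fun i => [29, 24, 19, 16, 9, 7, 5].getD i 0,
    fun i => [1, 2, 3, 4, 6, 7, 5].getD i 0, ?_, ?_, ?_, ?_⟩ <;> decide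

set_option maxRecDepth 10000 in
theorem quadSys_3_9 : QuadSys 3 9 := by
  refine ⟨fun i => [36, 32, 27, 22, 18, 9, 8, 5, 4].getD i 0,
    fun i => [38, 33, 28, 25, 19, 14, 11, 7, 6].getD i 0,
    fun i => [1, 2, 3, 4, 5, 7, 9, 8, 6].getD i 0, ?_, ?_, ?_, ?_⟩ <;> decide

set_option maxRecDepth 10000 in
set_option synthInstance.maxSize 2000 in
set_option synthInstance.maxHeartbeats 400000 in
theorem small_choice : ∀ N < 20, ∀ T < N, 2 ≤ T → (T % 4 = 2 ∨ T % 4 = 3) → T + 2 ≤ N →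
    ((T = 2 ∧ N = 4) ∨ (T = 2 ∧ N = 7) ∨ (T = 3 ∧ N = 9)) ∨
    ∃ a < 10, 2 * a + 1 ≤ N ∧ 9 * a + 4 ≤ T + 4 * N ∧ T + 4 * N ≤ 11 * a + 5 := by
  decide

theorem quadSys_all (T : ℕ) (hT : T % 4 = 2 ∨ T % 4 = 3) (N : ℕ) : QuadSys T N := by
  induction N using Nat.strong_induction_on with
  | _ N ih =>
    by_cases h0 : N ≤ T + 1
    · exact quadSys_base T N h0
    have fin : ∀ a, 2 * a + 1 ≤ N → 9 * a + 4 ≤ T + 4 * N → T + 4 * N ≤ 11 * a + 5 →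
        QuadSys T N := by
      intro a h1 h2 h3
      have := quadSys_step T (N - (2 * a + 1)) a (ih _ (by omega)) (by omega) (by omega)
      rwa [Nat.sub_add_cancel h1] at this
    by_cases h1 : N < 20
    · rcases small_choice N h1 T (by omega) (by omega) hT (by omega) with
        (⟨rfl, rfl⟩ | ⟨rfl, rfl⟩ | ⟨rfl, rfl⟩) | ⟨a, -, ha⟩
      · exact quadSys_2_4
      · exact quadSys_2_7
      · exact quadSys_3_9
      · exact fin a ha.1 ha.2.1 ha.2.2
    · exact fin ((T + 4 * N + 5) / 11) (by omega) (by omega) (by omega)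

/-- Hooked Skolem sequences: `a d` and `a d + d` are the two positions of the symbol `d`. -/
def HookedSkolem (t : ℕ) : Prop :=
  ∃ a : ℕ → ℕ,
    (∀ d, 1 ≤ d → d ≤ t → 1 ≤ a d ∧ a d + d ≤ 2 * t + 1 ∧ a d ≠ 2 * t ∧ a d + d ≠ 2 * t) ∧
    (∀ v, 1 ≤ v → v ≤ 2 * t + 1 → v ≠ 2 * t → ∃ d, 1 ≤ d ∧ d ≤ t ∧ (v = a d ∨ v = a d + d))

theorem hookedSkolem_two (s : ℕ) (hs : 1 ≤ s) : HookedSkolem (4 * s + 2) := by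
  obtain ⟨a, hA, hB, hC, hD, hE, hF, hG⟩ : ∃ a : ℕ → ℕ,
      a (4 * s + 2) = 4 * s + 3 ∧ a (4 * s + 1) = 2 * s + 1 ∧
      a (2 * s + 1) = 4 * s + 2 ∧ a 1 = 7 * s + 3 ∧
      (∀ r, 1 ≤ r → r ≤ 2 * s → a (2 * r) + r = 2 * s + 1) ∧
      (∀ r, s + 1 ≤ r → r ≤ 2 * s - 1 → a (2 * r + 1) + r = 6 * s + 3) ∧
      (∀ r, 1 ≤ r → r ≤ s - 1 → a (2 * r + 1) + r = 6 * s + 2) := by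
    refine ⟨fun d => if d = 4 * s + 2 then 4 * s + 3 else if d = 4 * s + 1 then 2 * s + 1 else
      if d = 2 * s + 1 then 4 * s + 2 else if d = 1 then 7 * s + 3 else
      if d % 2 = 0 then 2 * s + 1 - d / 2 else
      if 2 * s + 3 ≤ d then 6 * s + 3 - d / 2 else 6 * s + 2 - d / 2, ?_, ?_, ?_, ?_, ?_, ?_, ?_⟩
    iterate 4 (dsimp only; split_ifs <;> omega)
    iterate 3 (intro r h1 h2; dsimp only; split_ifs <;> omega)
  refine ⟨a, ?_, ?_⟩
  · intro d h1 h2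
    by_cases d1 : d = 4 * s + 2
    · subst d1; omega
    by_cases d2 : d = 4 * s + 1
    · subst d2; omega
    by_cases d3 : d = 2 * s + 1
    · subst d3; omega
    by_cases d4 : d = 1
    · subst d4; omega
    rcases Nat.even_or_odd' d with ⟨r, rfl | rfl⟩
    · have := hE r (by omega) (by omega)
      omega
    by_cases d5 : s + 1 ≤ r
    · have := hF r (by omega) (by omega)
      omega
    · have := hG r (by omega) (by omega)
      omega
  · intro v h1 h2 h3
    have use : ∀ d, 1 ≤ d → d ≤ 4 * s + 2 → (v = a d ∨ v = a d + d) →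
      ∃ d, 1 ≤ d ∧ d ≤ 4 * s + 2 ∧ (v = a d ∨ v = a d + d) :=
      fun d h h' h'' => ⟨d, h, h', h''⟩
    by_cases c1 : v ≤ 2 * s
    · have := hE (2 * s + 1 - v) (by omega) (by omega)
      exact use (2 * (2 * s + 1 - v)) (by omega) (by omega) (by omega)
    by_cases c2 : v = 2 * s + 1 ∨ v = 6 * s + 2
    · exact use (4 * s + 1) (by omega) (by omega) (by omega)
    by_cases c3 : v ≤ 4 * s + 1
    · have := hE (v - 2 * s - 1) (by omega) (by omega)
      exact use (2 * (v - 2 * s - 1)) (by omega) (by omega) (by omega)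
    by_cases c4 : v = 4 * s + 2 ∨ v = 6 * s + 3
    · exact use (2 * s + 1) (by omega) (by omega) (by omega)
    by_cases c5 : v = 4 * s + 3 ∨ v = 8 * s + 5
    · exact use (4 * s + 2) (by omega) (by omega) (by omega)
    by_cases c6 : v = 7 * s + 3 ∨ v = 7 * s + 4
    · exact use (1) (by omega) (by omega) (by omega)
    by_cases c7 : v ≤ 5 * s + 2
    · have := hF (6 * s + 3 - v) (by omega) (by omega)
      exact use (2 * (6 * s + 3 - v) + 1) (by omega) (by omega) (by omega)
    by_cases c8 : v ≤ 6 * s + 1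
    · have := hG (6 * s + 2 - v) (by omega) (by omega)
      exact use (2 * (6 * s + 2 - v) + 1) (by omega) (by omega) (by omega)
    by_cases c9 : v ≤ 7 * s + 2
    · have := hG (v - 6 * s - 3) (by omega) (by omega)
      exact use (2 * (v - 6 * s - 3) + 1) (by omega) (by omega) (by omega)
    · have := hF (v - 6 * s - 4) (by omega) (by omega)
      exact use (2 * (v - 6 * s - 4) + 1) (by omega) (by omega) (by omega)

theorem hookedSkolem_three (s : ℕ) (hs : 2 ≤ s) : HookedSkolem (4 * s - 1) := by
  obtain ⟨a, hA, hB, hC, hD, hH, hE, hF, hG⟩ : ∃ a : ℕ → ℕ,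
      a (4 * s - 1) = 4 * s ∧ a (4 * s - 2) = 2 * s + 1 ∧
      a (2 * s - 1) = 2 * s ∧ a (2 * s + 1) = s - 1 ∧ a 1 = s ∧
      (∀ r, 1 ≤ r → r ≤ 2 * s - 2 → a (2 * r) + r = 6 * s - 1) ∧
      (∀ r, s + 1 ≤ r → r ≤ 2 * s - 2 → a (2 * r + 1) + r = 2 * s - 1) ∧
      (∀ r, 1 ≤ r → r ≤ s - 2 → a (2 * r + 1) + r = 2 * s) := by
    refine ⟨fun d => if d = 4 * s - 1 then 4 * s else if d = 4 * s - 2 then 2 * s + 1 else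
      if d = 2 * s - 1 then 2 * s else if d = 2 * s + 1 then s - 1 else if d = 1 then s else
      if d % 2 = 0 then 6 * s - 1 - d / 2 else
      if 2 * s + 3 ≤ d then 2 * s - 1 - d / 2 else 2 * s - d / 2,
      ?_, ?_, ?_, ?_, ?_, ?_, ?_, ?_⟩
    iterate 5 (dsimp only; split_ifs <;> omega)
    iterate 3 (intro r h1 h2; dsimp only; split_ifs <;> omega)
  refine ⟨a, ?_, ?_⟩
  · intro d h1 h2
    by_cases d1 : d = 4 * s - 1
    · subst d1; omega
    by_cases d2 : d = 4 * s - 2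
    · subst d2; omega
    by_cases d3 : d = 2 * s - 1
    · subst d3; omega
    by_cases d6 : d = 2 * s + 1
    · subst d6; omega
    by_cases d4 : d = 1
    · subst d4; omega
    rcases Nat.even_or_odd' d with ⟨r, rfl | rfl⟩
    · have := hE r (by omega) (by omega)
      omega
    by_cases d5 : s + 1 ≤ r
    · have := hF r (by omega) (by omega)
      omega
    · have := hG r (by omega) (by omega)
      omega
  · intro v h1 h2 h3
    have use : ∀ d, 1 ≤ d → d ≤ 4 * s - 1 → (v = a d ∨ v = a d + d) →
      ∃ d, 1 ≤ d ∧ d ≤ 4 * s - 1 ∧ (v = a d ∨ v = a d + d) :=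
      fun d h h' h'' => ⟨d, h, h', h''⟩
    by_cases c1 : v = s - 1 ∨ v = 3 * s
    · exact use (2 * s + 1) (by omega) (by omega) (by omega)
    by_cases c2 : v = s ∨ v = s + 1
    · exact use (1) (by omega) (by omega) (by omega)
    by_cases c3 : v = 2 * s ∨ v = 4 * s - 1
    · exact use (2 * s - 1) (by omega) (by omega) (by omega)
    by_cases c4 : v = 2 * s + 1 ∨ v = 6 * s - 1
    · exact use (4 * s - 2) (by omega) (by omega) (by omega)
    by_cases c5 : v = 4 * s ∨ v = 8 * s - 1
    · exact use (4 * s - 1) (by omega) (by omega) (by omega)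
    by_cases c6 : v ≤ s - 2
    · have := hF (2 * s - 1 - v) (by omega) (by omega)
      exact use (2 * (2 * s - 1 - v) + 1) (by omega) (by omega) (by omega)
    by_cases c7 : v ≤ 2 * s - 1
    · have := hG (2 * s - v) (by omega) (by omega)
      exact use (2 * (2 * s - v) + 1) (by omega) (by omega) (by omega)
    by_cases c8 : v ≤ 3 * s - 1
    · have := hG (v - 2 * s - 1) (by omega) (by omega)
      exact use (2 * (v - 2 * s - 1) + 1) (by omega) (by omega) (by omega)
    by_cases c9 : v ≤ 4 * s - 2
    · have := hF (v - 2 * s) (by omega) (by omega)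
      exact use (2 * (v - 2 * s) + 1) (by omega) (by omega) (by omega)
    by_cases c10 : v ≤ 6 * s - 2
    · have := hE (6 * s - 1 - v) (by omega) (by omega)
      exact use (2 * (6 * s - 1 - v)) (by omega) (by omega) (by omega)
    · have := hE (v - (6 * s - 1)) (by omega) (by omega)
      exact use (2 * (v - (6 * s - 1))) (by omega) (by omega) (by omega)

theorem hookedSkolem_all (t : ℕ) (ht : t % 4 = 2 ∨ t % 4 = 3) : HookedSkolem t := by
  by_cases h2 : t = 2
  · subst h2
    refine ⟨fun d => if d = 1 then 1 else 3, ?_, ?_⟩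
    · intro d h1 h2; interval_cases d <;> simp
    · intro v h1 h2 h3
      by_cases h : v ≤ 2
      · exact ⟨1, by omega, by omega, by simp; omega⟩
      · exact ⟨2, by omega, by omega, by simp; omega⟩
  by_cases h3 : t = 3
  · subst h3
    refine ⟨fun d => if d = 1 then 1 else if d = 2 then 3 else 4, ?_, ?_⟩
    · intro d h1 h2; interval_cases d <;> simp
    · intro v h1 h2 h3
      by_cases h : v ≤ 2
      · exact ⟨1, by omega, by omega, by simp; omega⟩
      by_cases h : v = 3 ∨ v = 5
      · exact ⟨2, by omega, by omega, by simp; omega⟩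
      · exact ⟨3, by omega, by omega, by simp; omega⟩
  rcases ht with ht | ht
  · have := hookedSkolem_two (t / 4) (by omega)
    rwa [show 4 * (t / 4) + 2 = t by omega] at this
  · have := hookedSkolem_three (t / 4 + 1) (by omega)
    rwa [show 4 * (t / 4 + 1) - 1 = t by omega] at this


/-- The list of cycle lengths. -/
abbrev vaneList (t N : ℕ) : List ℕ := List.replicate t 3 ++ List.replicate N 4

theorem vaneList_length (t N : ℕ) : (vaneList t N).length = t + N := by simp

theorem vaneList_get_lt (t N : ℕ) (i : Fin (vaneList t N).length) (h : i.val < t) :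
    (vaneList t N).get i = 3 := by
  simp [List.getElem_append, h]

theorem vaneList_get_ge (t N : ℕ) (i : Fin (vaneList t N).length) (h : t ≤ i.val) :
    (vaneList t N).get i = 4 := by
  simp [List.getElem_append, Nat.not_lt.mpr h]

/-- Vertex `j` of vane `i`. -/
def mkV (L : List ℕ) (i j : ℕ) (hi : i < L.length) (hj : j < L.get ⟨i, hi⟩ - 1) :
    WindmillVertex L := some ⟨⟨i, hi⟩, ⟨j, hj⟩⟩

theorem some_ext (L : List ℕ) (i i' : Fin L.length) (j : Fin (L.get i - 1))
    (j' : Fin (L.get i' - 1)) (h : i.val = i'.val) (h' : j.val = j'.val) :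
    (some ⟨i, j⟩ : WindmillVertex L) = some ⟨i', j'⟩ := by
  obtain rfl := Fin.ext h
  obtain rfl := Fin.ext h'
  rfl

/-- The labelling. -/
def labF (t N : ℕ) (α β X Y C : ℕ → ℕ) : WindmillVertex (vaneList t N) → ℕ
  | none => 0
  | some ⟨i, j⟩ =>
    if i.val < t then (if j.val = 0 then α i.val else β i.val)
    else if j.val = 0 then X (i.val - t) else if j.val = 1 then C (i.val - t) else Y (i.val - t)

def triV (t N : ℕ) (i : Fin t) (j : Fin 2) : WindmillVertex (vaneList t N) :=
  mkV _ i.val j.val (by rw [vaneList_length]; omega)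
    (by rw [vaneList_get_lt _ _ _ i.isLt]; omega)

def quadV (t N : ℕ) (i : Fin N) (j : Fin 3) : WindmillVertex (vaneList t N) :=
  mkV _ (t + i.val) j.val (by rw [vaneList_length]; omega)
    (by rw [vaneList_get_ge _ _ _ (Nat.le_add_right t i.val)]; omega)

theorem vertex_cases (t N : ℕ) (v : WindmillVertex (vaneList t N)) :
    v = none ∨ (∃ i j, v = triV t N i j) ∨ (∃ i j, v = quadV t N i j) := by
  rcases v with _ | ⟨i, j⟩
  · exact Or.inl rfl
  · right
    have hi := i.isLt
    have hj := j.isLt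
    have hi : i.val < t + N := lt_of_lt_of_eq hi (vaneList_length t N)
    by_cases h : i.val < t
    · left
      have hj : j.val < 2 := lt_of_lt_of_eq hj (by rw [vaneList_get_lt _ _ _ h])
      exact ⟨⟨i, h⟩, ⟨j, hj⟩, some_ext _ _ _ _ _ rfl rfl⟩
    · right
      have hj : j.val < 3 := lt_of_lt_of_eq hj (by rw [vaneList_get_ge _ _ _ (by omega)])
      exact ⟨⟨i.val - t, by omega⟩, ⟨j, hj⟩, some_ext _ _ _ _ _ (by simp; omega) rfl⟩

theorem labF_none (t N : ℕ) (α β X Y C : ℕ → ℕ) : labF t N α β X Y C none = 0 := rfl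

theorem labF_tri (t N : ℕ) (α β X Y C : ℕ → ℕ) (i : Fin t) (j : Fin 2) :
    labF t N α β X Y C (triV t N i j) = if j.val = 0 then α i else β i := by
  simp [labF, triV, mkV]

theorem labF_quad (t N : ℕ) (α β X Y C : ℕ → ℕ) (i : Fin N) (j : Fin 3) :
    labF t N α β X Y C (quadV t N i j) =
      if j.val = 0 then X i else if j.val = 1 then C i else Y i := by
  simp [labF, quadV, mkV]

/-- Parametrisation of the edges. -/
def edgeOf (t N : ℕ) : (Fin t × Fin 3) ⊕ (Fin N × Fin 4) → Sym2 (WindmillVertex (vaneList t N))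
  | .inl (i, 0) => s(none, triV t N i 0)
  | .inl (i, 1) => s(triV t N i 0, triV t N i 1)
  | .inl (i, 2) => s(none, triV t N i 1)
  | .inr (i, 0) => s(none, quadV t N i 0)
  | .inr (i, 1) => s(quadV t N i 0, quadV t N i 1)
  | .inr (i, 2) => s(quadV t N i 1, quadV t N i 2)
  | .inr (i, 3) => s(none, quadV t N i 2)

/-- Labels of the edges. -/
def edgeVal (t N : ℕ) (α β X Y C : ℕ → ℕ) : (Fin t × Fin 3) ⊕ (Fin N × Fin 4) → ℕ
  | .inl (i, 0) => α i
  | .inl (i, 1) => β i - α i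
  | .inl (i, 2) => β i
  | .inr (i, 0) => X i
  | .inr (i, 1) => X i - C i
  | .inr (i, 2) => Y i - C i
  | .inr (i, 3) => Y i

theorem rel_none_tri (t N : ℕ) (i : Fin t) (j : Fin 2) :
    windmillRel (vaneList t N) none (triV t N i j) := by
  have h := vaneList_get_lt t N ⟨i.val, by rw [vaneList_length]; omega⟩ i.isLt
  simp only [triV, mkV, windmillRel, h]
  omega

theorem rel_none_quad (t N : ℕ) (i : Fin N) (j : Fin 3) :
    windmillRel (vaneList t N) none (quadV t N i j) ↔ j ≠ 1 := by
  have h := vaneList_get_ge t N ⟨t + i.val, by rw [vaneList_length]; omega⟩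
    (Nat.le_add_right t i.val)
  simp only [quadV, mkV, windmillRel, h]
  omega

theorem rel_tri_tri (t N : ℕ) (i i' : Fin t) (j j' : Fin 2) :
    windmillRel (vaneList t N) (triV t N i j) (triV t N i' j') ↔
      i = i' ∧ j = 0 ∧ j' = 1 := by
  simp only [triV, mkV, windmillRel]
  omega

theorem rel_quad_quad (t N : ℕ) (i i' : Fin N) (j j' : Fin 3) :
    windmillRel (vaneList t N) (quadV t N i j) (quadV t N i' j') ↔
      i = i' ∧ ((j = 0 ∧ j' = 1) ∨ (j = 1 ∧ j' = 2)) := by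
  simp only [quadV, mkV, windmillRel]
  omega

theorem rel_tri_quad (t N : ℕ) (i : Fin t) (i' : Fin N) (j : Fin 2) (j' : Fin 3) :
    ¬ windmillRel (vaneList t N) (triV t N i j) (quadV t N i' j') := by
  simp only [triV, quadV, mkV, windmillRel]
  omega

theorem rel_quad_tri (t N : ℕ) (i : Fin t) (i' : Fin N) (j : Fin 2) (j' : Fin 3) :
    ¬ windmillRel (vaneList t N) (quadV t N i' j') (triV t N i j) := by
  simp only [triV, quadV, mkV, windmillRel]
  omega

theorem rel_none_none (L : List ℕ) : ¬ windmillRel L none none := fun h => h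

theorem rel_some_none (L : List ℕ) (y) : ¬ windmillRel L (some y) none := fun h => h

theorem rel_edge (t N : ℕ) (u v : WindmillVertex (vaneList t N))
    (h : windmillRel (vaneList t N) u v) : ∃ e, edgeOf t N e = s(u, v) := by
  rcases vertex_cases t N u with rfl | ⟨i, j, rfl⟩ | ⟨i, j, rfl⟩ <;>
    rcases vertex_cases t N v with rfl | ⟨i', j', rfl⟩ | ⟨i', j', rfl⟩
  · exact absurd h (rel_none_none _)
  · fin_cases j'
    · exact ⟨.inl (i', 0), rfl⟩
    · exact ⟨.inl (i', 2), rfl⟩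
  · rw [rel_none_quad] at h
    fin_cases j'
    · exact ⟨.inr (i', 0), rfl⟩
    · exact absurd rfl h
    · exact ⟨.inr (i', 3), rfl⟩
  · exact absurd h (rel_some_none _ _)
  · rw [rel_tri_tri] at h
    obtain ⟨rfl, rfl, rfl⟩ := h
    exact ⟨.inl (i, 1), rfl⟩
  · exact absurd h (rel_tri_quad _ _ _ _ _ _)
  · exact absurd h (rel_some_none _ _)
  · exact absurd h (rel_quad_tri _ _ _ _ _ _)
  · rw [rel_quad_quad] at h
    obtain ⟨rfl, ⟨rfl, rfl⟩ | ⟨rfl, rfl⟩⟩ := h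
    · exact ⟨.inr (i, 1), rfl⟩
    · exact ⟨.inr (i, 2), rfl⟩

theorem rel_ne (L : List ℕ) (u v : WindmillVertex L) (h : windmillRel L u v) : u ≠ v := by
  rintro rfl
  rcases u with _ | ⟨i, j⟩
  · exact h
  · simp [windmillRel] at h

theorem edgeOf_mem (t N : ℕ) (e) : edgeOf t N e ∈ (Windmill (vaneList t N)).edgeSet := by
  have key : ∀ u v, windmillRel (vaneList t N) u v →
      s(u, v) ∈ (Windmill (vaneList t N)).edgeSet := by
    intro u v h
    rw [SimpleGraph.mem_edgeSet, Windmill, SimpleGraph.fromRel_adj]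
    exact ⟨rel_ne _ _ _ h, Or.inl h⟩
  rcases e with ⟨i, j⟩ | ⟨i, j⟩ <;> fin_cases j <;> apply key
  · exact rel_none_tri _ _ _ _
  · rw [rel_tri_tri]; exact ⟨rfl, rfl, rfl⟩
  · exact rel_none_tri _ _ _ _
  · rw [rel_none_quad]; decide
  · rw [rel_quad_quad]; exact ⟨rfl, by decide⟩
  · rw [rel_quad_quad]; exact ⟨rfl, by decide⟩
  · rw [rel_none_quad]; decide

theorem edgeOf_surj (t N : ℕ) (e) (he : e ∈ (Windmill (vaneList t N)).edgeSet) :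
    ∃ x, edgeOf t N x = e := by
  induction e using Sym2.ind with
  | _ u v =>
    rw [SimpleGraph.mem_edgeSet, Windmill, SimpleGraph.fromRel_adj] at he
    rcases he.2 with h | h
    · exact rel_edge t N u v h
    · rw [Sym2.eq_swap]; exact rel_edge t N v u h

theorem edgeLabel_mk {V : Type*} (f : V → ℕ) (u v : V) :
    edgeLabel f s(u, v) = ((f u : ℤ) - (f v : ℤ)).natAbs := rfl

theorem edgeLabel_edgeOf (t N : ℕ) (α β X Y C : ℕ → ℕ)
    (h1 : ∀ i < t, α i < β i) (h2 : ∀ i < N, C i < X i ∧ C i < Y i) (e) :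
    edgeLabel (labF t N α β X Y C) (edgeOf t N e) = edgeVal t N α β X Y C e := by
  rcases e with ⟨i, j⟩ | ⟨i, j⟩
  · have := h1 i i.isLt
    fin_cases j <;>
      simp [edgeOf, edgeVal, edgeLabel_mk, labF_none, labF_tri] <;> omega
  · have := h2 i i.isLt
    fin_cases j <;>
      simp [edgeOf, edgeVal, edgeLabel_mk, labF_none, labF_quad] <;> omega

theorem build (t N : ℕ) (ht : 1 ≤ t) (α β X Y C : ℕ → ℕ)
    (h1 : ∀ i < t, α i < β i) (h2 : ∀ i < N, C i < X i ∧ C i < Y i)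
    (hC : ∀ i < N, ∀ j < N, C i = C j → i = j)
    (hCX : ∀ i < N, ∀ j < N, C i ≠ X j ∧ C i ≠ Y j)
    (hCα : ∀ i < N, ∀ j < t, C i ≠ α j ∧ C i ≠ β j)
    (hC0 : ∀ i < N, 1 ≤ C i)
    (hmaps : ∀ e, edgeVal t N α β X Y C e ∈
      (Finset.Icc 1 (3 * t + 4 * N - 1) ∪ {3 * t + 4 * N + 1} : Finset ℕ))
    (hsurj : ∀ v ∈ (Finset.Icc 1 (3 * t + 4 * N - 1) ∪ {3 * t + 4 * N + 1} : Finset ℕ),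
      ∃ e, edgeVal t N α β X Y C e = v) :
    IsNearGraceful (Windmill (vaneList t N)) (3 * t + 4 * N) := by
  have hinj : Function.Injective (edgeVal t N α β X Y C) := by
    have himg : Finset.univ.image (edgeVal t N α β X Y C) =
        (Finset.Icc 1 (3 * t + 4 * N - 1) ∪ {3 * t + 4 * N + 1} : Finset ℕ) := by
      ext v
      simp only [Finset.mem_image, Finset.mem_univ, true_and]
      exact ⟨fun ⟨e, he⟩ => he ▸ hmaps e, hsurj v⟩
    have hcard : (Finset.univ.image (edgeVal t N α β X Y C)).card =
        (Finset.univ : Finset ((Fin t × Fin 3) ⊕ (Fin N × Fin 4))).card := by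
      rw [himg, Finset.card_union_of_disjoint]
      · simp; omega
      · simp
    have := Finset.card_image_iff.mp hcard
    exact fun a b h => this (by simp) (by simp) h
  have hbd : ∀ e, 1 ≤ edgeVal t N α β X Y C e ∧
      edgeVal t N α β X Y C e ≤ 3 * t + 4 * N + 1 := by
    intro e
    have := hmaps e
    simp only [Finset.mem_union, Finset.mem_Icc, Finset.mem_singleton] at this
    omega
  have bα : ∀ i : Fin t, 1 ≤ α i ∧ α i ≤ _ := fun i => hbd (.inl (i, 0))
  have bβ : ∀ i : Fin t, 1 ≤ β i ∧ β i ≤ _ := fun i => hbd (.inl (i, 2))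
  have bX : ∀ i : Fin N, 1 ≤ X i ∧ X i ≤ _ := fun i => hbd (.inr (i, 0))
  have bY : ∀ i : Fin N, 1 ≤ Y i ∧ Y i ≤ _ := fun i => hbd (.inr (i, 3))
  refine ⟨labF t N α β X Y C, ?_, ?_, Or.inr ⟨?_, ?_, ?_⟩⟩
  · -- injectivity on vertices
    have tt : ∀ i i' j j', labF t N α β X Y C (triV t N i j) =
        labF t N α β X Y C (triV t N i' j') → triV t N i j = triV t N i' j' := by
      intro i i' j j' h
      rw [labF_tri, labF_tri] at h
      fin_cases j <;> fin_cases j'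
      · have := @hinj (.inl (i, 0)) (.inl (i', 0)) h
        simp at this; rw [this]
      · have := @hinj (.inl (i, 0)) (.inl (i', 2)) h
        simp at this
      · have := @hinj (.inl (i, 2)) (.inl (i', 0)) h
        simp at this
      · have := @hinj (.inl (i, 2)) (.inl (i', 2)) h
        simp at this; rw [this]
    have qq : ∀ i i' j j', labF t N α β X Y C (quadV t N i j) =
        labF t N α β X Y C (quadV t N i' j') → quadV t N i j = quadV t N i' j' := by
      intro i i' j j' h
      rw [labF_quad, labF_quad] at h
      fin_cases j <;> fin_cases j'
      · have := @hinj (.inr (i, 0)) (.inr (i', 0)) h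
        simp at this; rw [this]
      · exact absurd h.symm (hCX i' i'.isLt i i.isLt).1
      · have := @hinj (.inr (i, 0)) (.inr (i', 3)) h
        simp at this
      · exact absurd h (hCX i i.isLt i' i'.isLt).1
      · have := Fin.ext (hC i i.isLt i' i'.isLt h)
        rw [this]
      · exact absurd h (hCX i i.isLt i' i'.isLt).2
      · have := @hinj (.inr (i, 3)) (.inr (i', 0)) h
        simp at this
      · exact absurd h.symm (hCX i' i'.isLt i i.isLt).2
      · have := @hinj (.inr (i, 3)) (.inr (i', 3)) h
        simp at this; rw [this]
    have tq : ∀ i i' j j', labF t N α β X Y C (triV t N i j) ≠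
        labF t N α β X Y C (quadV t N i' j') := by
      intro i i' j j' h
      rw [labF_tri, labF_quad] at h
      fin_cases j <;> fin_cases j'
      · have := @hinj (.inl (i, 0)) (.inr (i', 0)) h
        simp at this
      · exact (hCα i' i'.isLt i i.isLt).1 h.symm
      · have := @hinj (.inl (i, 0)) (.inr (i', 3)) h
        simp at this
      · have := @hinj (.inl (i, 2)) (.inr (i', 0)) h
        simp at this
      · exact (hCα i' i'.isLt i i.isLt).2 h.symm
      · have := @hinj (.inl (i, 2)) (.inr (i', 3)) h
        simp at this
    have t0 : ∀ i j, labF t N α β X Y C (triV t N i j) ≠ 0 := by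
      intro i j
      have := bα i
      have := bβ i
      rw [labF_tri]
      split_ifs <;> omega
    have q0 : ∀ i j, labF t N α β X Y C (quadV t N i j) ≠ 0 := by
      intro i j
      have := bX i
      have := bY i
      have := hC0 i i.isLt
      rw [labF_quad]
      split_ifs <;> omega
    intro u v h
    rcases vertex_cases t N u with rfl | ⟨i, j, rfl⟩ | ⟨i, j, rfl⟩ <;>
      rcases vertex_cases t N v with rfl | ⟨i', j', rfl⟩ | ⟨i', j', rfl⟩
    · rfl
    · exact absurd h.symm (t0 _ _)
    · exact absurd h.symm (q0 _ _)
    · exact absurd h (t0 _ _)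
    · exact tt _ _ _ _ h
    · exact absurd h (tq _ _ _ _)
    · exact absurd h (q0 _ _)
    · exact absurd h.symm (tq _ _ _ _)
    · exact qq _ _ _ _ h
  · intro v
    rcases vertex_cases t N v with rfl | ⟨i, j, rfl⟩ | ⟨i, j, rfl⟩
    · rw [labF_none]; omega
    · have := bα i
      have := bβ i
      rw [labF_tri]
      split_ifs <;> omega
    · have := bX i
      have := bY i
      have := h2 i i.isLt
      rw [labF_quad]
      split_ifs <;> omega
  · intro e he
    obtain ⟨x, rfl⟩ := edgeOf_surj t N e he
    rw [edgeLabel_edgeOf t N α β X Y C h1 h2]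
    have := hmaps x
    simpa using this
  · intro e he e' he' h
    obtain ⟨x, rfl⟩ := edgeOf_surj t N e he
    obtain ⟨x', rfl⟩ := edgeOf_surj t N e' he'
    rw [edgeLabel_edgeOf t N α β X Y C h1 h2, edgeLabel_edgeOf t N α β X Y C h1 h2] at h
    rw [hinj h]
  · intro v hv
    obtain ⟨x, hx⟩ := hsurj v (by simpa using hv)
    exact ⟨edgeOf t N x, edgeOf_mem t N x, by rw [edgeLabel_edgeOf t N α β X Y C h1 h2, hx]⟩

/-- Every `C₃ᵗC₄ᴺ` with `t ≡ 2, 3 (mod 4)` is near graceful. -/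
theorem near_graceful_all (t N : ℕ) (ht : t % 4 = 2 ∨ t % 4 = 3) :
    IsNearGraceful (Windmill (vaneList t N)) (3 * t + 4 * N) := by
  obtain ⟨p, q, c, hb, hs, hc, hd⟩ := quadSys_all t ht N
  obtain ⟨a, ha1, ha2⟩ := hookedSkolem_all t ht
  refine build t N (by omega) (fun i => t + 4 * N + a (i + 1))
    (fun i => t + 4 * N + a (i + 1) + (i + 1)) (fun i => p i + c i) (fun i => q i + c i) c
    ?_ ?_ hc hd ?_ ?_ ?_ ?_
  · intro i hi; omega
  · intro i hi; have := hb i hi; omega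
  · intro i hi j hj; have := hb i hi; have := ha1 (j + 1) (by omega) (by omega)
    omega
  · intro i hi; exact (hb i hi).2.2.2.2
  · intro e
    simp only [Finset.mem_union, Finset.mem_Icc, Finset.mem_singleton]
    rcases e with ⟨i, j⟩ | ⟨i, j⟩
    · have := ha1 (i.val + 1) (by omega) (by omega)
      have := i.isLt
      fin_cases j <;> simp only [edgeVal] <;> omega
    · have := hb i i.isLt
      fin_cases j <;> simp only [edgeVal] <;> omega
  · intro v hv
    simp only [Finset.mem_union, Finset.mem_Icc, Finset.mem_singleton] at hv
    by_cases v1 : v ≤ t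
    · refine ⟨.inl (⟨v - 1, by omega⟩, 1), ?_⟩
      simp only [edgeVal]; omega
    by_cases v2 : v ≤ t + 4 * N
    · obtain ⟨i, hi, h⟩ := hs v (by omega) (by omega)
      rcases h with h | h | h | h
      · refine ⟨.inr (⟨i, hi⟩, 1), ?_⟩
        simp only [edgeVal]; omega
      · refine ⟨.inr (⟨i, hi⟩, 2), ?_⟩
        simp only [edgeVal]; omega
      · exact ⟨.inr (⟨i, hi⟩, 0), h.symm⟩
      · exact ⟨.inr (⟨i, hi⟩, 3), h.symm⟩
    · obtain ⟨d, hd1, hd2, h⟩ := ha2 (v - (t + 4 * N)) (by omega) (by omega) (by omega)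
      obtain ⟨d', rfl⟩ : ∃ d', d = d' + 1 := ⟨d - 1, by omega⟩
      rcases h with h | h
      · refine ⟨.inl (⟨d', by omega⟩, 0), ?_⟩
        simp only [edgeVal]; omega
      · refine ⟨.inl (⟨d', by omega⟩, 2), ?_⟩
        simp only [edgeVal]; omega

/-- Let `k ≥ 1`, `x ≥ 1`, `w ≥ 0` and `s ≥ 1` be integers.  Suppose that either
(3) `x ≡ 2 (mod 4)`, `(2k − 12w − 2)/4 ≤ s ≤ (6k − 12w − 9)/4`, and there is a near
graceful labelling of `C₃^{4w+x}C₄^{s}` containing a triangle whose vertices receive the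
labels `0`, `4s + 12w + 5`, `4s + 12w + 7`; or
(4) `x ≡ 3 (mod 4)`, `(2k − 12w − 3)/4 ≤ s ≤ (6k − 12w − 10)/4`, and there is a near
graceful labelling of `C₃^{4w+x}C₄^{s}` containing one triangle whose vertices receive
the labels `0`, `4s + 12w + 7`, `4s + 12w + 8` and another triangle whose vertices
receive the labels `0`, `4s + 12w + 6`, `4s + 12w + 10`.
Then a near graceful labelling of `C₃^{4w+x}C₄^{s+4k−1}` exists. -/
theorem near_graceful_extension (k x w s : ℕ) (hk : 1 ≤ k) (hx : 1 ≤ x) (hs : 1 ≤ s)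
    (hcase :
      (x % 4 = 2 ∧
        2 * (k : ℤ) - 12 * (w : ℤ) - 2 ≤ 4 * (s : ℤ) ∧
        4 * (s : ℤ) ≤ 6 * (k : ℤ) - 12 * (w : ℤ) - 9 ∧
        ∃ f, IsNearGracefulLabelling
            (Windmill (List.replicate (4 * w + x) 3 ++ List.replicate s 4))
            (3 * (4 * w + x) + 4 * s) f ∧
          HasTriangleLabelled
            (Windmill (List.replicate (4 * w + x) 3 ++ List.replicate s 4)) f
            0 (4 * s + 12 * w + 5) (4 * s + 12 * w + 7)) ∨
      (x % 4 = 3 ∧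
        2 * (k : ℤ) - 12 * (w : ℤ) - 3 ≤ 4 * (s : ℤ) ∧
        4 * (s : ℤ) ≤ 6 * (k : ℤ) - 12 * (w : ℤ) - 10 ∧
        ∃ f, IsNearGracefulLabelling
            (Windmill (List.replicate (4 * w + x) 3 ++ List.replicate s 4))
            (3 * (4 * w + x) + 4 * s) f ∧
          HasTriangleLabelled
            (Windmill (List.replicate (4 * w + x) 3 ++ List.replicate s 4)) f
            0 (4 * s + 12 * w + 7) (4 * s + 12 * w + 8) ∧
          HasTriangleLabelled
            (Windmill (List.replicate (4 * w + x) 3 ++ List.replicate s 4)) f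
            0 (4 * s + 12 * w + 6) (4 * s + 12 * w + 10))) :
    IsNearGraceful
      (Windmill (List.replicate (4 * w + x) 3 ++ List.replicate (s + 4 * k - 1) 4))
      (3 * (4 * w + x) + 4 * (s + 4 * k - 1)) := by
  have ht : (4 * w + x) % 4 = 2 ∨ (4 * w + x) % 4 = 3 := by
    rcases hcase with h | h
    · left; omega
    · right; omega
  exact near_graceful_all (4 * w + x) (s + 4 * k - 1) ht
end

section
/- Let p ≥ 1 and t ≥ 2p+1 be integers. Then the variable windmill C_3^t C_5^p is: (1) graceful when p ≡ 0 (mod 4) and t ≡ 0 or 1 (mod 4); (2) graceful when p ≡ 3 (mod 4) and t ≡ 0 or 3 (mod 4); (3) near graceful when p ≡ 1 (mod 4) and t ≡ 0 or 3 (mod 4); (4) near graceful when p ≡ 2 (mod 4) and t ≡ 0 or 1 (mod 4). -/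
namespace WM

abbrev LL (t p : ℕ) : List ℕ := List.replicate t 3 ++ List.replicate p 5

lemma LL_length (t p : ℕ) : (LL t p).length = t + p := by simp [LL]

lemma LL_get (t p : ℕ) (i : Fin (LL t p).length) :
    (LL t p).get i = if i.val < t then 3 else 5 := by
  simp only [LL, List.get_eq_getElem, List.getElem_append, List.length_replicate]
  split_ifs <;> simp

/-- The `j`-th noncentral vertex of the `i`-th vane (junk: the centre). -/
def vtx (t p i j : ℕ) : WindmillVertex (LL t p) :=
  if h : i < t + p then
    if h2 : j < (LL t p).get ⟨i, by rw [LL_length]; exact h⟩ - 1 then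
      some ⟨⟨i, by rw [LL_length]; exact h⟩, ⟨j, h2⟩⟩ else none
  else none

lemma vtx_eq (t p : ℕ) (i : Fin (LL t p).length) (j : Fin ((LL t p).get i - 1)) :
    vtx t p i.val j.val = some ⟨i, j⟩ := by
  have h : i.val < t + p := lt_of_lt_of_eq i.2 (LL_length t p)
  unfold vtx
  rw [dif_pos h, dif_pos j.2]

/-- The labelling of the windmill. -/
def lab (t p : ℕ) (x y a b c d : ℕ → ℕ) : WindmillVertex (LL t p) → ℕ
  | none => 0
  | some ⟨i, j⟩ =>
    if i.val < t then (if j.val = 0 then x i.val else y i.val)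
    else if j.val = 0 then a (i.val - t)
    else if j.val = 1 then b (i.val - t)
    else if j.val = 2 then c (i.val - t)
    else d (i.val - t)

lemma vtx_tri (t p i j : ℕ) (hi : i < t) (hj : j < 2) :
    ∃ (i' : Fin (LL t p).length) (j' : Fin ((LL t p).get i' - 1)),
      i'.val = i ∧ j'.val = j ∧ vtx t p i j = some ⟨i', j'⟩ := by
  have h : i < (LL t p).length := by rw [LL_length]; omega
  have h2 : j < (LL t p).get ⟨i, h⟩ - 1 := by rw [LL_get]; simp [hi]; omega
  exact ⟨⟨i, h⟩, ⟨j, h2⟩, rfl, rfl, vtx_eq t p ⟨i, h⟩ ⟨j, h2⟩⟩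

lemma vtx_pent (t p i j : ℕ) (hi : i < p) (hj : j < 4) :
    ∃ (i' : Fin (LL t p).length) (j' : Fin ((LL t p).get i' - 1)),
      i'.val = t + i ∧ j'.val = j ∧ vtx t p (t + i) j = some ⟨i', j'⟩ := by
  have h : t + i < (LL t p).length := by rw [LL_length]; omega
  have h2 : j < (LL t p).get ⟨t + i, h⟩ - 1 := by rw [LL_get]; simp; omega
  exact ⟨⟨t + i, h⟩, ⟨j, h2⟩, rfl, rfl, vtx_eq t p ⟨t + i, h⟩ ⟨j, h2⟩⟩

section
variable (t p : ℕ) (x y a b c d : ℕ → ℕ)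

lemma lab_x (i : ℕ) (hi : i < t) : lab t p x y a b c d (vtx t p i 0) = x i := by
  obtain ⟨i', j', h1, h2, h3⟩ := vtx_tri t p i 0 hi (by omega)
  rw [h3]; simp [lab, h1, h2, hi]

lemma lab_y (i : ℕ) (hi : i < t) : lab t p x y a b c d (vtx t p i 1) = y i := by
  obtain ⟨i', j', h1, h2, h3⟩ := vtx_tri t p i 1 hi (by omega)
  rw [h3]; simp [lab, h1, h2, hi]

lemma lab_a (i : ℕ) (hi : i < p) : lab t p x y a b c d (vtx t p (t + i) 0) = a i := by
  obtain ⟨i', j', h1, h2, h3⟩ := vtx_pent t p i 0 hi (by omega)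
  rw [h3]; simp [lab, h1, h2]

lemma lab_b (i : ℕ) (hi : i < p) : lab t p x y a b c d (vtx t p (t + i) 1) = b i := by
  obtain ⟨i', j', h1, h2, h3⟩ := vtx_pent t p i 1 hi (by omega)
  rw [h3]; simp [lab, h1, h2]

lemma lab_c (i : ℕ) (hi : i < p) : lab t p x y a b c d (vtx t p (t + i) 2) = c i := by
  obtain ⟨i', j', h1, h2, h3⟩ := vtx_pent t p i 2 hi (by omega)
  rw [h3]; simp [lab, h1, h2]

lemma lab_d (i : ℕ) (hi : i < p) : lab t p x y a b c d (vtx t p (t + i) 3) = d i := by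
  obtain ⟨i', j', h1, h2, h3⟩ := vtx_pent t p i 3 hi (by omega)
  rw [h3]; simp [lab, h1, h2]

end

/-- The explicit set of edges. -/
noncomputable def edges (t p : ℕ) : Finset (Sym2 (WindmillVertex (LL t p))) :=
  open Classical in
  ((Finset.range t).biUnion fun i =>
    {s(none, vtx t p i 0), s(none, vtx t p i 1), s(vtx t p i 0, vtx t p i 1)}) ∪
  ((Finset.range p).biUnion fun i =>
    {s(none, vtx t p (t + i) 0), s(none, vtx t p (t + i) 3),
      s(vtx t p (t + i) 0, vtx t p (t + i) 1), s(vtx t p (t + i) 1, vtx t p (t + i) 2),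
      s(vtx t p (t + i) 2, vtx t p (t + i) 3)})

lemma edges_card (t p : ℕ) : (edges t p).card ≤ 3 * t + 5 * p := by
  classical
  unfold edges
  refine (Finset.card_union_le _ _).trans (Nat.add_le_add ?_ ?_)
  · refine (Finset.card_biUnion_le_card_mul _ _ 3 fun i _ => Finset.card_le_three).trans ?_
    simp [mul_comm]
  · refine (Finset.card_biUnion_le_card_mul _ _ 5 fun i _ => Finset.card_le_five).trans ?_
    simp [mul_comm]

lemma rel_mem_edges (t p : ℕ) (u v : WindmillVertex (LL t p)) (h : windmillRel (LL t p) u v) :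
    s(u, v) ∈ edges t p := by
  classical
  unfold edges
  simp only [Finset.mem_union, Finset.mem_biUnion, Finset.mem_range, Finset.mem_insert,
    Finset.mem_singleton]
  rcases u with _ | ⟨i, j⟩ <;> rcases v with _ | ⟨i', j'⟩
  · exact h.elim
  · have hh : j'.val = 0 ∨ j'.val + 2 = (LL t p).get i' := h
    have hi : i'.val < t + p := lt_of_lt_of_eq i'.2 (LL_length t p)
    have hv := vtx_eq t p i' j'
    have hg := LL_get t p i'
    by_cases ht : i'.val < t
    · left
      refine ⟨i'.val, ht, ?_⟩
      rw [if_pos ht] at hg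
      rcases hh with hh | hh
      · left; rw [← hv, hh]
      · right; left; rw [← hv, show j'.val = 1 by omega]
    · right
      refine ⟨i'.val - t, by omega, ?_⟩
      rw [show t + (i'.val - t) = i'.val by omega]
      rw [if_neg ht] at hg
      rcases hh with hh | hh
      · left; rw [← hv, hh]
      · right; left; rw [← hv, show j'.val = 3 by omega]
  · exact h.elim
  · have hh : i.val = i'.val ∧ j'.val = j.val + 1 := h
    have hi : i'.val < t + p := lt_of_lt_of_eq i'.2 (LL_length t p)
    have hv := vtx_eq t p i' j'
    have hv0 := vtx_eq t p i j
    rw [hh.1, show j.val = j'.val - 1 by omega] at hv0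
    have hj : j'.val < (if i'.val < t then 3 else 5) - 1 := lt_of_lt_of_eq j'.2 (by rw [LL_get])
    by_cases ht : i'.val < t
    · left
      refine ⟨i'.val, ht, ?_⟩
      rw [if_pos ht] at hj
      right; right; rw [← hv, ← hv0, show j'.val = 1 by omega]
    · right
      refine ⟨i'.val - t, by omega, ?_⟩
      rw [show t + (i'.val - t) = i'.val by omega]
      rw [if_neg ht] at hj
      have h3 : j'.val = 1 ∨ j'.val = 2 ∨ j'.val = 3 := by omega
      rw [← hv, ← hv0]
      rcases h3 with h3 | h3 | h3 <;> rw [h3] <;> simp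

lemma edgeSet_sub (t p : ℕ) : (Windmill (LL t p)).edgeSet ⊆ ↑(edges t p) := by
  intro e
  induction e using Sym2.ind with
  | _ u v =>
    intro h
    rw [SimpleGraph.mem_edgeSet, Windmill, SimpleGraph.fromRel_adj] at h
    rcases h.2 with h | h
    · exact rel_mem_edges t p u v h
    · rw [Sym2.eq_swap]; exact rel_mem_edges t p v u h

lemma adj_end (t p : ℕ) (i : Fin (LL t p).length) (j : Fin ((LL t p).get i - 1))
    (h : j.val = 0 ∨ j.val + 2 = (LL t p).get i) :
    s(none, some ⟨i, j⟩) ∈ (Windmill (LL t p)).edgeSet := by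
  rw [SimpleGraph.mem_edgeSet, Windmill, SimpleGraph.fromRel_adj]
  exact ⟨by simp, Or.inl h⟩

lemma adj_mid (t p : ℕ) (i i' : Fin (LL t p).length) (j : Fin ((LL t p).get i - 1))
    (j' : Fin ((LL t p).get i' - 1)) (h1 : i.val = i'.val) (h : j'.val = j.val + 1) :
    s(some ⟨i, j⟩, some ⟨i', j'⟩) ∈ (Windmill (LL t p)).edgeSet := by
  rw [SimpleGraph.mem_edgeSet, Windmill, SimpleGraph.fromRel_adj]
  refine ⟨?_, Or.inl ⟨h1, h⟩⟩
  intro he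
  have h2 := vtx_eq t p i j
  simp only [Option.some.injEq, Sigma.mk.injEq] at he
  obtain ⟨rfl, he⟩ := he
  rw [eq_of_heq he] at h
  omega

lemma adj_tri_end (t p i j : ℕ) (hi : i < t) (hj : j < 2) :
    s(none, vtx t p i j) ∈ (Windmill (LL t p)).edgeSet := by
  obtain ⟨i', j', h1, h2, h3⟩ := vtx_tri t p i j hi hj
  rw [h3]
  apply adj_end
  have hg := LL_get t p i'
  rw [h1, if_pos hi] at hg
  omega

lemma adj_tri_mid (t p i : ℕ) (hi : i < t) :
    s(vtx t p i 0, vtx t p i 1) ∈ (Windmill (LL t p)).edgeSet := by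
  obtain ⟨i', j', h1, h2, h3⟩ := vtx_tri t p i 0 hi (by omega)
  obtain ⟨k', l', g1, g2, g3⟩ := vtx_tri t p i 1 hi (by omega)
  rw [h3, g3]
  apply adj_mid <;> omega

lemma adj_pent_end (t p i j : ℕ) (hi : i < p) (hj : j = 0 ∨ j = 3) :
    s(none, vtx t p (t + i) j) ∈ (Windmill (LL t p)).edgeSet := by
  obtain ⟨i', j', h1, h2, h3⟩ := vtx_pent t p i j hi (by omega)
  rw [h3]
  apply adj_end
  have hg := LL_get t p i'
  rw [h1, if_neg (by omega)] at hg
  omega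

lemma adj_pent_mid (t p i j : ℕ) (hi : i < p) (hj : j < 3) :
    s(vtx t p (t + i) j, vtx t p (t + i) (j + 1)) ∈ (Windmill (LL t p)).edgeSet := by
  obtain ⟨i', j', h1, h2, h3⟩ := vtx_pent t p i j hi (by omega)
  obtain ⟨k', l', g1, g2, g3⟩ := vtx_pent t p i (j + 1) hi (by omega)
  rw [h3, g3]
  apply adj_mid <;> omega

lemma vertex_cases (t p : ℕ) (v : WindmillVertex (LL t p)) :
    v = none ∨ (∃ i < t, v = vtx t p i 0) ∨ (∃ i < t, v = vtx t p i 1) ∨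
    (∃ i < p, v = vtx t p (t + i) 0) ∨ (∃ i < p, v = vtx t p (t + i) 3) ∨
    (∃ i < p, v = vtx t p (t + i) 1) ∨ (∃ i < p, v = vtx t p (t + i) 2) := by
  rcases v with _ | ⟨i, j⟩
  · left; rfl
  · right
    have hi : i.val < t + p := lt_of_lt_of_eq i.2 (LL_length t p)
    have hv := vtx_eq t p i j
    have hj : j.val < (if i.val < t then 3 else 5) - 1 := lt_of_lt_of_eq j.2 (by rw [LL_get])
    by_cases ht : i.val < t
    · rw [if_pos ht] at hj
      have : j.val = 0 ∨ j.val = 1 := by omega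
      rcases this with h | h <;> rw [h] at hv
      · left; exact ⟨_, ht, hv.symm⟩
      · right; left; exact ⟨_, ht, hv.symm⟩
    · right; right
      rw [if_neg ht] at hj
      have e : i.val = t + (i.val - t) := by omega
      have hp : i.val - t < p := by omega
      have : j.val = 0 ∨ j.val = 1 ∨ j.val = 2 ∨ j.val = 3 := by omega
      rcases this with h | h | h | h <;> rw [h, e] at hv
      · left; exact ⟨_, hp, hv.symm⟩
      · right; right; left; exact ⟨_, hp, hv.symm⟩
      · right; right; right; exact ⟨_, hp, hv.symm⟩
      · right; left; exact ⟨_, hp, hv.symm⟩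

lemma edgeLabel_none {t p : ℕ} (x y a b c d : ℕ → ℕ) (v : WindmillVertex (LL t p)) :
    edgeLabel (lab t p x y a b c d) s(none, v) = lab t p x y a b c d v := by
  simp [edgeLabel, lab]

lemma edgeLabel_mk {t p : ℕ} (f : WindmillVertex (LL t p) → ℕ) (u v : WindmillVertex (LL t p)) :
    edgeLabel f s(u, v) = ((f u : ℤ) - (f v : ℤ)).natAbs := by
  simp [edgeLabel]

/-- Criterion: labels given by functions on initial segments. -/
theorem criterion (t p : ℕ) (x y a b c d : ℕ → ℕ) (R : Finset ℕ) (M B : ℕ)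
    (hR : 3 * t + 5 * p ≤ R.card) (hRM : ∀ k ∈ R, k ≤ M)
    (surj : ∀ k ∈ R, (∃ i < t, x i = k ∨ y i = k ∨ ((x i : ℤ) - y i).natAbs = k) ∨
      (∃ i < p, a i = k ∨ d i = k ∨ ((a i : ℤ) - b i).natAbs = k ∨
        ((b i : ℤ) - c i).natAbs = k ∨ ((c i : ℤ) - d i).natAbs = k))
    (hBM : B ≤ M)
    (hx : ∀ i < t, B < x i) (hy : ∀ i < t, B < y i)
    (ha : ∀ i < p, B < a i) (hd : ∀ i < p, B < d i)
    (hb : ∀ i < p, 1 ≤ b i ∧ b i ≤ B) (hc : ∀ i < p, 1 ≤ c i ∧ c i ≤ B)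
    (hbb : ∀ i < p, ∀ j < p, b i = b j → i = j)
    (hcc : ∀ i < p, ∀ j < p, c i = c j → i = j)
    (hbc : ∀ i < p, ∀ j < p, b i ≠ c j) :
    ∃ f : WindmillVertex (LL t p) → ℕ, Function.Injective f ∧ (∀ v, f v ≤ M) ∧
      Set.BijOn (edgeLabel f) (Windmill (LL t p)).edgeSet (R : Set ℕ) := by
  classical
  set f := lab t p x y a b c d with hf
  have hsurj : Set.SurjOn (edgeLabel f) (Windmill (LL t p)).edgeSet (R : Set ℕ) := by
    intro k hk
    rcases surj k hk with ⟨i, hi, h⟩ | ⟨i, hi, h⟩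
    · rcases h with h | h | h
      · exact ⟨_, adj_tri_end t p i 0 hi (by omega), by rw [hf, edgeLabel_none, lab_x _ _ _ _ _ _ _ _ i hi, h]⟩
      · exact ⟨_, adj_tri_end t p i 1 hi (by omega), by rw [hf, edgeLabel_none, lab_y _ _ _ _ _ _ _ _ i hi, h]⟩
      · exact ⟨_, adj_tri_mid t p i hi, by
          rw [hf, edgeLabel_mk, lab_y _ _ _ _ _ _ _ _ i hi, lab_x _ _ _ _ _ _ _ _ i hi, h]⟩
    · rcases h with h | h | h | h | h
      · exact ⟨_, adj_pent_end t p i 0 hi (by omega), by rw [hf, edgeLabel_none, lab_a _ _ _ _ _ _ _ _ i hi, h]⟩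
      · exact ⟨_, adj_pent_end t p i 3 hi (by omega), by rw [hf, edgeLabel_none, lab_d _ _ _ _ _ _ _ _ i hi, h]⟩
      · exact ⟨_, adj_pent_mid t p i 0 hi (by omega), by
          rw [hf, edgeLabel_mk, lab_a _ _ _ _ _ _ _ _ i hi, lab_b _ _ _ _ _ _ _ _ i hi, h]⟩
      · exact ⟨_, adj_pent_mid t p i 1 hi (by omega), by
          rw [hf, edgeLabel_mk, lab_b _ _ _ _ _ _ _ _ i hi, lab_c _ _ _ _ _ _ _ _ i hi, h]⟩
      · exact ⟨_, adj_pent_mid t p i 2 hi (by omega), by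
          rw [hf, edgeLabel_mk, lab_c _ _ _ _ _ _ _ _ i hi, lab_d _ _ _ _ _ _ _ _ i hi, h]⟩
  -- counting
  obtain ⟨E, hE⟩ : ∃ E : Finset (Sym2 (WindmillVertex (LL t p))),
      (E : Set _) = (Windmill (LL t p)).edgeSet := by
    have hfin : (Windmill (LL t p)).edgeSet.Finite := (Finset.finite_toSet _).subset (edgeSet_sub t p)
    exact ⟨hfin.toFinset, by simp⟩
  have hEc : E.card ≤ R.card := by
    refine le_trans ?_ ((edges_card t p).trans hR)
    apply Finset.card_le_card
    intro e he
    have : e ∈ (E : Set _) := he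
    rw [hE] at this
    exact edgeSet_sub t p this
  have himg : R ⊆ E.image (edgeLabel f) := by
    intro k hk
    obtain ⟨e, he, hk'⟩ := hsurj hk
    rw [← hE] at he
    exact Finset.mem_image.2 ⟨e, he, hk'⟩
  have hcard1 : (E.image (edgeLabel f)).card ≤ E.card := Finset.card_image_le
  have hEq : R = E.image (edgeLabel f) :=
    Finset.eq_of_subset_of_card_le himg (hcard1.trans hEc)
  have hinj : Set.InjOn (edgeLabel f) (E : Set _) := by
    apply Finset.injOn_of_card_image_eq
    apply le_antisymm hcard1
    rw [← hEq]; exact hEc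
  have hmaps : Set.MapsTo (edgeLabel f) (Windmill (LL t p)).edgeSet (R : Set ℕ) := by
    intro e he
    rw [← hE] at he
    rw [Finset.mem_coe, hEq]
    exact Finset.mem_image_of_mem _ he
  rw [hE] at hinj
  -- classification
  have hcls : ∀ v, v = none ∨ (s(none, v) ∈ (Windmill (LL t p)).edgeSet ∧ B < f v) ∨
      (∃ i < p, v = vtx t p (t + i) 1 ∧ f v = b i) ∨
      (∃ i < p, v = vtx t p (t + i) 2 ∧ f v = c i) := by
    intro v
    rcases vertex_cases t p v with h | ⟨i, hi, h⟩ | ⟨i, hi, h⟩ | ⟨i, hi, h⟩ | ⟨i, hi, h⟩ |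
      ⟨i, hi, h⟩ | ⟨i, hi, h⟩
    · exact Or.inl h
    · right; left; subst h
      exact ⟨adj_tri_end t p i 0 hi (by omega), by rw [hf, lab_x _ _ _ _ _ _ _ _ i hi]; exact hx i hi⟩
    · right; left; subst h
      exact ⟨adj_tri_end t p i 1 hi (by omega), by rw [hf, lab_y _ _ _ _ _ _ _ _ i hi]; exact hy i hi⟩
    · right; left; subst h
      exact ⟨adj_pent_end t p i 0 hi (by omega), by rw [hf, lab_a _ _ _ _ _ _ _ _ i hi]; exact ha i hi⟩
    · right; left; subst h
      exact ⟨adj_pent_end t p i 3 hi (by omega), by rw [hf, lab_d _ _ _ _ _ _ _ _ i hi]; exact hd i hi⟩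
    · right; right; left
      exact ⟨i, hi, h, by rw [h, hf, lab_b _ _ _ _ _ _ _ _ i hi]⟩
    · right; right; right
      exact ⟨i, hi, h, by rw [h, hf, lab_c _ _ _ _ _ _ _ _ i hi]⟩
  have hf0 : f none = 0 := rfl
  have hlabel : ∀ v, edgeLabel f s(none, v) = f v := fun v => edgeLabel_none x y a b c d v
  refine ⟨f, ?_, ?_, hmaps, hinj, hsurj⟩
  · intro v w hvw
    rcases hcls v with h | ⟨h, h'⟩ | ⟨i, hi, h, h'⟩ | ⟨i, hi, h, h'⟩ <;>
      rcases hcls w with g | ⟨g, g'⟩ | ⟨j, hj, g, g'⟩ | ⟨j, hj, g, g'⟩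
    · rw [h, g]
    · rw [h, hf0] at hvw; omega
    · have := hb j hj; rw [h, hf0] at hvw; omega
    · have := hc j hj; rw [h, hf0] at hvw; omega
    · rw [g, hf0] at hvw; omega
    · have := hinj h g (by rw [hlabel, hlabel]; exact hvw)
      have h2 : v = w ∨ none = w ∧ v = none := by simpa using this
      rcases h2 with h2 | ⟨h2, h3⟩
      · exact h2
      · rw [h3, h2]
    · have := hb j hj; omega
    · have := hc j hj; omega
    · have := hb i hi; rw [g, hf0] at hvw; omega
    · have := hb i hi; omega
    · have := hbb i hi j hj (by omega); subst this; rw [h, g]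
    · exact absurd (by omega) (hbc i hi j hj)
    · have := hc i hi; rw [g, hf0] at hvw; omega
    · have := hc i hi; omega
    · exact absurd (by omega) (hbc j hj i hi)
    · have := hcc i hi j hj (by omega); subst this; rw [h, g]
  · intro v
    rcases hcls v with h | ⟨h, h'⟩ | ⟨i, hi, h, h'⟩ | ⟨i, hi, h, h'⟩
    · rw [h, hf0]; omega
    · have := hmaps h
      rw [hlabel] at this
      exact hRM _ this
    · have := hb i hi; omega
    · have := hc i hi; omega

/-- Criterion with triangles indexed by a finite set. -/
theorem criterion' (t p : ℕ) (I : Finset ℕ) (hI : I.card = t) (x y a b c d : ℕ → ℕ)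
    (R : Finset ℕ) (M B : ℕ)
    (hR : 3 * t + 5 * p ≤ R.card) (hRM : ∀ k ∈ R, k ≤ M)
    (surj : ∀ k ∈ R, (∃ i ∈ I, x i = k ∨ y i = k ∨ ((x i : ℤ) - y i).natAbs = k) ∨
      (∃ i < p, a i = k ∨ d i = k ∨ ((a i : ℤ) - b i).natAbs = k ∨
        ((b i : ℤ) - c i).natAbs = k ∨ ((c i : ℤ) - d i).natAbs = k))
    (hBM : B ≤ M)
    (hx : ∀ i ∈ I, B < x i) (hy : ∀ i ∈ I, B < y i)
    (ha : ∀ i < p, B < a i) (hd : ∀ i < p, B < d i)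
    (hb : ∀ i < p, 1 ≤ b i ∧ b i ≤ B) (hc : ∀ i < p, 1 ≤ c i ∧ c i ≤ B)
    (hbb : ∀ i < p, ∀ j < p, b i = b j → i = j)
    (hcc : ∀ i < p, ∀ j < p, c i = c j → i = j)
    (hbc : ∀ i < p, ∀ j < p, b i ≠ c j) :
    ∃ f : WindmillVertex (LL t p) → ℕ, Function.Injective f ∧ (∀ v, f v ≤ M) ∧
      Set.BijOn (edgeLabel f) (Windmill (LL t p)).edgeSet (R : Set ℕ) := by
  set e := Finset.equivFinOfCardEq hI with he
  set g : ℕ → ℕ := fun i => if h : i < t then (e.symm ⟨i, h⟩ : ℕ) else 0 with hg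
  have hgI : ∀ i < t, g i ∈ I := by
    intro i hi
    simp only [hg, dif_pos hi]
    exact (e.symm ⟨i, hi⟩).2
  have hgs : ∀ k ∈ I, ∃ i < t, g i = k := by
    intro k hk
    refine ⟨(e ⟨k, hk⟩).val, (e ⟨k, hk⟩).2, ?_⟩
    simp [hg]
  refine criterion t p (fun i => x (g i)) (fun i => y (g i)) a b c d R M B hR hRM ?_ hBM
    (fun i hi => hx _ (hgI i hi)) (fun i hi => hy _ (hgI i hi)) ha hd hb hc hbb hcc hbc
  intro k hk
  rcases surj k hk with ⟨i, hi, h⟩ | h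
  · obtain ⟨j, hj, rfl⟩ := hgs i hi
    exact Or.inl ⟨j, hj, h⟩
  · exact Or.inr h

/-- `ℓ` is a (hooked, if `h = 1`) Skolem sequence of order `n`. -/
def Skolem (n h : ℕ) (ℓ : ℕ → ℕ) : Prop :=
  (∀ z, 1 ≤ z → (z + h ≤ 2 * n ∨ (h = 1 ∧ z = 2 * n + 1)) →
    ∃ k, 1 ≤ k ∧ k ≤ n ∧ (ℓ k = z ∨ ℓ k + k = z)) ∧
  ∀ k, 1 ≤ k → k ≤ n → 1 ≤ ℓ k

/-- The target set of labels. -/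
def target (m e : ℕ) : Finset ℕ := insert (m + e) (Finset.Icc 1 (m - e))

lemma target_card (m e : ℕ) (he : e ≤ 1) (hm : 1 ≤ m) : m ≤ (target m e).card := by
  unfold target
  rcases Nat.le_one_iff_eq_zero_or_eq_one.1 he with rfl | rfl
  · rw [Finset.insert_eq_of_mem (by simp; omega)]; simp
  · rw [Finset.card_insert_of_notMem (by simp)]; simp; omega

lemma target_le (m e k : ℕ) (hk : k ∈ target m e) :
    (1 ≤ k ∧ k + e ≤ m) ∨ k = m + e ∨ (k = 0) := by
  simp only [target, Finset.mem_insert, Finset.mem_Icc] at hk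
  omega

/-- Assembly for `p = 1`. -/
theorem assemble_one (n h t e : ℕ) (ℓ : ℕ → ℕ) (hn : n = t + 1) (ht : 1 ≤ t)
    (hh : h + e = 1) (sk : Skolem n h ℓ) :
    ∃ f : WindmillVertex (LL t 1) → ℕ, Function.Injective f ∧ (∀ v, f v ≤ 3 * t + 5 + e) ∧
      Set.BijOn (edgeLabel f) (Windmill (LL t 1)).edgeSet (target (3 * t + 5) e : Set ℕ) := by
  obtain ⟨sk1, sk2⟩ := sk
  have hl1 := sk2 1 (by omega) (by omega)
  refine criterion' t 1 (Finset.Icc 2 n) (by simp; omega) (fun k => n + ℓ k) (fun k => n + ℓ k + k)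
    (fun _ => n + ℓ 1 + 1) (fun _ => 1) (fun _ => 2) (fun _ => 3 * n + 3 - h) _ _ n
    ?_ ?_ ?_ ?_ ?_ ?_ ?_ ?_ ?_ ?_ ?_ ?_ ?_
  · have := target_card (3 * t + 5) e (by omega) (by omega); omega
  · intro k hk
    have := target_le _ _ _ hk; omega
  · intro k hk
    have hk1 := target_le _ _ _ hk
    have hk0 : k ≠ 0 := by
      rintro rfl; simp [target] at hk; omega
    by_cases h1 : k ≤ n
    · by_cases h2 : k = 1
      · right; refine ⟨0, by omega, ?_⟩; omega
      · left; refine ⟨k, by simp; omega, ?_⟩; right; right; omega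
    · by_cases h3 : k = 3 * n + 3 - h ∨ k = 3 * n + 1 - h
      · right; refine ⟨0, by omega, ?_⟩; omega
      · obtain ⟨k', h4, h5, h6⟩ := sk1 (k - n) (by omega) (by omega)
        by_cases h7 : k' = 1
        · subst h7
          right; refine ⟨0, by omega, ?_⟩; omega
        · left; refine ⟨k', by simp; omega, ?_⟩; omega
  · omega
  · intro i hi; have := sk2 i (by simp at hi; omega) (by simp at hi; omega); omega
  · intro i hi; have := sk2 i (by simp at hi; omega) (by simp at hi; omega); omega
  · intro i hi; omega
  · intro i hi; omega
  · intro i hi; omega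
  · intro i hi; omega
  · intro i hi j hj; omega
  · intro i hi j hj; omega
  · intro i hi j hj; omega

/-- Piecewise choice over the types of vanes. -/
def pw (Q j : ℕ) (u v : ℕ → ℕ) (w1 w2 w3 : ℕ) : ℕ :=
  if j < Q then u j else if j < 2 * Q then v (j - Q) else if j = 2 * Q then w1
  else if j = 2 * Q + 1 then w2 else w3

lemma pw1 {Q j : ℕ} (u v : ℕ → ℕ) (w1 w2 w3 : ℕ) (h : j < Q) : pw Q j u v w1 w2 w3 = u j := by
  simp [pw, h]

lemma pw2 {Q j : ℕ} (u v : ℕ → ℕ) (w1 w2 w3 : ℕ) (h : j < Q) :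
    pw Q (Q + j) u v w1 w2 w3 = v j := by
  unfold pw
  rw [if_neg (by omega), if_pos (by omega)]
  congr 1; omega

lemma pw3 {Q : ℕ} (u v : ℕ → ℕ) (w1 w2 w3 : ℕ) : pw Q (2 * Q) u v w1 w2 w3 = w1 := by
  unfold pw
  rw [if_neg (by omega), if_neg (by omega), if_pos rfl]

lemma pw4 {Q : ℕ} (u v : ℕ → ℕ) (w1 w2 w3 : ℕ) : pw Q (2 * Q + 1) u v w1 w2 w3 = w2 := by
  unfold pw
  rw [if_neg (by omega), if_neg (by omega), if_neg (by omega), if_pos rfl]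

lemma pw5 {Q : ℕ} (u v : ℕ → ℕ) (w1 w2 w3 : ℕ) : pw Q (2 * Q + 2) u v w1 w2 w3 = w3 := by
  unfold pw
  rw [if_neg (by omega), if_neg (by omega), if_neg (by omega), if_neg (by omega)]

lemma idx_cases (Q o j : ℕ) (ho : o ≤ 1) (h : j < 2 * Q + 2 + o) :
    j < Q ∨ (∃ i < Q, j = Q + i) ∨ j = 2 * Q ∨ j = 2 * Q + 1 ∨ (o = 1 ∧ j = 2 * Q + 2) := by
  by_cases h1 : j < Q
  · exact Or.inl h1
  · by_cases h2 : j < 2 * Q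
    · exact Or.inr (Or.inl ⟨j - Q, by omega, by omega⟩)
    · omega

set_option maxHeartbeats 2000000 in
/-- Assembly for `p ≥ 2`. -/
theorem assemble (n h t e o Q α la : ℕ) (ℓ : ℕ → ℕ) (ho : o ≤ 1)
    (hn : n = t + (2 * Q + 2 + o)) (he : o + h = e ∨ (o = 1 ∧ h = 1 ∧ e = 0)) (hh : h ≤ 1) (he' : e ≤ 1)
    (sk : Skolem n h ℓ)
    (hF2 : ∀ j ≤ Q + 2, ℓ (la + 2 * j) + j = α)
    (hF3 : ∀ j < Q, ∀ k, k + 6 + 2 * j = la → ℓ k = α + 4 + j)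
    (hla : 2 * Q + 6 ≤ la) (hla2 : la + 2 * Q + 4 ≤ n)
    (hα : Q + 3 ≤ α) (hα2 : 3 + 2 * o ≤ α + Q) (hβ : α + la ≤ n + Q) :
    ∃ f : WindmillVertex (LL t (2 * Q + 2 + o)) → ℕ, Function.Injective f ∧
      (∀ v, f v ≤ 3 * t + 5 * (2 * Q + 2 + o) + e) ∧
      Set.BijOn (edgeLabel f) (Windmill (LL t (2 * Q + 2 + o))).edgeSet
        (target (3 * t + 5 * (2 * Q + 2 + o)) e : Set ℕ) := by
  obtain ⟨sk1, sk2⟩ := sk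
  have hl1 := sk2 1 (by omega) (by omega)
  have hle := sk2 (la + 2 * (Q + 2)) (by omega) (by omega)
  obtain ⟨S, hS⟩ : ∃ S, S = n + 4 * Q + 4 := ⟨_, rfl⟩
  obtain ⟨β, hβd⟩ : ∃ β, β = α + la := ⟨_, rfl⟩
  obtain ⟨a, had⟩ : ∃ a : ℕ → ℕ, a = fun i => pw Q i (fun j => S + α - j) (fun j => S + α + 4 + j)
    (S + α - Q - 1) (S + α - Q - 2) (S + ℓ 1 + 1) := ⟨_, rfl⟩
  obtain ⟨b, hbd⟩ : ∃ a : ℕ → ℕ, a = fun i => pw Q i (fun j => α + 2 * Q + 5 + j)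
    (fun j => α + 2 * Q + 2 - j) (α + Q + 2) (α + Q - 2) 1 := ⟨_, rfl⟩
  obtain ⟨c, hcd⟩ : ∃ a : ℕ → ℕ, a = fun i => pw Q i (fun j => β + 2 * Q - 1 - j)
    (fun j => β + 2 * Q + 2 + j) (β + 3 * Q + 4) (β + 3 * Q + 2) 2 := ⟨_, rfl⟩
  obtain ⟨d, hdd⟩ : ∃ a : ℕ → ℕ, a = fun i => pw Q i (fun j => S + β + j)
    (fun j => S + β - 2 - j) (S + β + Q + 2) (S + β + Q + 1) (S + 2 * n + 3 - h) := ⟨_, rfl⟩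
  obtain ⟨y, hyd⟩ : ∃ a : ℕ → ℕ, a = fun i => pw Q i (fun j => la + 2 * j)
    (fun j => la - 6 - 2 * j) (la + 2 * Q + 2) (la + 2 * Q + 4) 1 := ⟨_, rfl⟩
  have v1 : ∀ j < Q, a j + j = S + α ∧ b j = α + 2 * Q + 5 + j ∧ c j + 1 + j = β + 2 * Q ∧
      d j = S + β + j ∧ y j = la + 2 * j := by
    intro j hj
    have e1 : a j = S + α - j := by rw [had]; exact pw1 _ _ _ _ _ hj
    have e2 : c j = β + 2 * Q - 1 - j := by rw [hcd]; exact pw1 _ _ _ _ _ hj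
    refine ⟨by omega, ?_, by omega, ?_, ?_⟩
    · rw [hbd]; exact pw1 _ _ _ _ _ hj
    · rw [hdd]; exact pw1 _ _ _ _ _ hj
    · rw [hyd]; exact pw1 _ _ _ _ _ hj
  have v2 : ∀ j < Q, a (Q + j) = S + α + 4 + j ∧ b (Q + j) + j = α + 2 * Q + 2 ∧
      c (Q + j) = β + 2 * Q + 2 + j ∧
      d (Q + j) + 2 + j = S + β ∧ y (Q + j) + 6 + 2 * j = la := by
    intro j hj
    have e1 : b (Q + j) = α + 2 * Q + 2 - j := by rw [hbd]; exact pw2 _ _ _ _ _ hj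
    have e2 : d (Q + j) = S + β - 2 - j := by rw [hdd]; exact pw2 _ _ _ _ _ hj
    have e3 : y (Q + j) = la - 6 - 2 * j := by rw [hyd]; exact pw2 _ _ _ _ _ hj
    refine ⟨?_, by omega, ?_, by omega, by omega⟩
    · rw [had]; exact pw2 _ _ _ _ _ hj
    · rw [hcd]; exact pw2 _ _ _ _ _ hj
  have v3 : a (2 * Q) + Q + 1 = S + α ∧ b (2 * Q) = α + Q + 2 ∧ c (2 * Q) = β + 3 * Q + 4 ∧
      d (2 * Q) = S + β + Q + 2 ∧ y (2 * Q) = la + 2 * Q + 2 := by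
    have e1 : a (2 * Q) = S + α - Q - 1 := by rw [had]; exact pw3 _ _ _ _ _
    refine ⟨by omega, ?_, ?_, ?_, ?_⟩
    · rw [hbd]; exact pw3 _ _ _ _ _
    · rw [hcd]; exact pw3 _ _ _ _ _
    · rw [hdd]; exact pw3 _ _ _ _ _
    · rw [hyd]; exact pw3 _ _ _ _ _
  have v4 : a (2 * Q + 1) + Q + 2 = S + α ∧ b (2 * Q + 1) + 2 = α + Q ∧
      c (2 * Q + 1) = β + 3 * Q + 2 ∧
      d (2 * Q + 1) = S + β + Q + 1 ∧ y (2 * Q + 1) = la + 2 * Q + 4 := by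
    have e1 : a (2 * Q + 1) = S + α - Q - 2 := by rw [had]; exact pw4 _ _ _ _ _
    have e2 : b (2 * Q + 1) = α + Q - 2 := by rw [hbd]; exact pw4 _ _ _ _ _
    refine ⟨by omega, by omega, ?_, ?_, ?_⟩
    · rw [hcd]; exact pw4 _ _ _ _ _
    · rw [hdd]; exact pw4 _ _ _ _ _
    · rw [hyd]; exact pw4 _ _ _ _ _
  have v5 : a (2 * Q + 2) = S + ℓ 1 + 1 ∧ b (2 * Q + 2) = 1 ∧ c (2 * Q + 2) = 2 ∧
      d (2 * Q + 2) + h = S + 2 * n + 3 ∧ y (2 * Q + 2) = 1 := by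
    have e1 : d (2 * Q + 2) = S + 2 * n + 3 - h := by rw [hdd]; exact pw5 _ _ _ _ _
    refine ⟨?_, ?_, ?_, by omega, ?_⟩
    · rw [had]; exact pw5 _ _ _ _ _
    · rw [hbd]; exact pw5 _ _ _ _ _
    · rw [hcd]; exact pw5 _ _ _ _ _
    · rw [hyd]; exact pw5 _ _ _ _ _
  clear had hbd hcd hdd hyd
  -- uniform case analysis
  have cs : ∀ j < 2 * Q + 2 + o,
      (j < Q ∧ a j + j = S + α ∧ b j = α + 2 * Q + 5 + j ∧ c j + 1 + j = β + 2 * Q ∧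
        d j = S + β + j ∧ y j = la + 2 * j) ∨
      (∃ i < Q, j = Q + i ∧ a j = S + α + 4 + i ∧ b j + i = α + 2 * Q + 2 ∧
        c j = β + 2 * Q + 2 + i ∧ d j + 2 + i = S + β ∧ y j + 6 + 2 * i = la) ∨
      (j = 2 * Q ∧ a j + Q + 1 = S + α ∧ b j = α + Q + 2 ∧ c j = β + 3 * Q + 4 ∧
        d j = S + β + Q + 2 ∧ y j = la + 2 * Q + 2) ∨
      (j = 2 * Q + 1 ∧ a j + Q + 2 = S + α ∧ b j + 2 = α + Q ∧ c j = β + 3 * Q + 2 ∧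
        d j = S + β + Q + 1 ∧ y j = la + 2 * Q + 4) ∨
      (o = 1 ∧ j = 2 * Q + 2 ∧ a j = S + ℓ 1 + 1 ∧ b j = 1 ∧ c j = 2 ∧
        d j + h = S + 2 * n + 3 ∧ y j = 1) := by
    intro j hj
    rcases idx_cases Q o j ho hj with h | ⟨i, hi, h⟩ | h | h | ⟨h', h⟩
    · exact Or.inl ⟨h, v1 j h⟩
    · subst h; exact Or.inr (Or.inl ⟨i, hi, rfl, v2 i hi⟩)
    · subst h; exact Or.inr (Or.inr (Or.inl ⟨rfl, v3⟩))
    · subst h; exact Or.inr (Or.inr (Or.inr (Or.inl ⟨rfl, v4⟩)))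
    · subst h; exact Or.inr (Or.inr (Or.inr (Or.inr ⟨h', rfl, v5⟩)))
  replace v3 : True → _ := fun _ => v3
  replace v4 : True → _ := fun _ => v4
  replace v5 : True → _ := fun _ => v5
  have yinj : ∀ i < 2 * Q + 2 + o, ∀ j < 2 * Q + 2 + o, y i = y j → i = j := by
    intro i hi j hj hij
    clear v1 v2 v3 v4 v5 he
    rcases cs i hi with h | ⟨i', h⟩ | h | h | h <;> rcases cs j hj with g | ⟨j', g⟩ | g | g | g <;>
      omega
  have ymem : ∀ i < 2 * Q + 2 + o, 1 ≤ y i ∧ y i ≤ n := by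
    intro i hi
    clear v1 v2 v3 v4 v5 he
    rcases cs i hi with h | ⟨i', h⟩ | h | h | h <;> omega
  set Y := (Finset.range (2 * Q + 2 + o)).image y with hY
  have hYc : Y.card = 2 * Q + 2 + o := by
    rw [hY, Finset.card_image_of_injOn, Finset.card_range]
    intro i hi j hj hij
    simp only [Finset.coe_range, Set.mem_Iio] at hi hj
    exact yinj i hi j hj hij
  have hYs : Y ⊆ Finset.Icc 1 n := by
    intro k hk
    simp only [hY, Finset.mem_image, Finset.mem_range] at hk
    obtain ⟨i, hi, rfl⟩ := hk
    have := ymem i hi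
    simp; omega
  have hI : (Finset.Icc 1 n \ Y).card = t := by
    rw [Finset.card_sdiff_of_subset hYs, hYc]; simp; omega
  have hsplit : ∀ k, 1 ≤ k → k ≤ n → k ∈ Finset.Icc 1 n \ Y ∨ ∃ j < 2 * Q + 2 + o, y j = k := by
    intro k h1 h2
    by_cases hk : k ∈ Y
    · right
      simp only [hY, Finset.mem_image, Finset.mem_range] at hk
      exact hk
    · left; simp only [Finset.mem_sdiff, Finset.mem_Icc]; exact ⟨⟨h1, h2⟩, hk⟩
  have hIm : ∀ k ∈ Finset.Icc 1 n \ Y, 1 ≤ ℓ k := by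
    intro k hk
    simp only [Finset.mem_sdiff, Finset.mem_Icc] at hk
    exact sk2 k hk.1.1 hk.1.2
  clear hYs hYc hle yinj ymem
  clear_value Y
  refine criterion' t (2 * Q + 2 + o) (Finset.Icc 1 n \ Y) hI (fun k => S + ℓ k)
    (fun k => S + ℓ k + k) a b c d _ _ S ?_ ?_ ?_ ?_ ?_ ?_ ?_ ?_ ?_ ?_ ?_ ?_ ?_
  · exact target_card _ _ (by omega) (by omega)
  · intro k hk
    have := target_le _ _ _ hk; omega
  · intro k hk
    have hk1 := target_le _ _ _ hk
    have hk0 : k ≠ 0 := by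
      rintro rfl; simp [target] at hk; omega
    clear hk
    by_cases h1 : k ≤ n
    · clear hk1 he he' hI hα2
      rcases hsplit k (by omega) h1 with h2 | ⟨j, hj, h2⟩
      · left; refine ⟨k, h2, ?_⟩; right; right; omega
      · right
        rcases cs j hj with g | ⟨i, g⟩ | g | g | g
        · have := v2 j g.1
          exact ⟨Q + j, by omega, Or.inr (Or.inr (Or.inr (Or.inl (by omega))))⟩
        · have := v1 i g.1
          exact ⟨i, by omega, Or.inr (Or.inr (Or.inr (Or.inl (by omega))))⟩
        · exact ⟨j, hj, Or.inr (Or.inr (Or.inr (Or.inl (by omega))))⟩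
        · exact ⟨j, hj, Or.inr (Or.inr (Or.inr (Or.inl (by omega))))⟩
        · exact ⟨j, hj, Or.inr (Or.inr (Or.inr (Or.inl (by omega))))⟩
    · by_cases h2 : k ≤ S
      · right
        clear hk1 he he' hI hα2
        obtain ⟨r, hr⟩ : ∃ r, k = n + 1 + r := ⟨k - n - 1, by omega⟩
        by_cases g1 : r < 2 * Q
        · obtain ⟨u, hu⟩ : ∃ u, r = 2 * u ∨ r = 2 * u + 1 := ⟨r / 2, by omega⟩
          obtain ⟨w, hw⟩ : ∃ w, w + 1 + u = Q := ⟨Q - 1 - u, by omega⟩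
          rcases hu with hu | hu
          · have := v1 w (by omega)
            exact ⟨w, by omega, Or.inr (Or.inr (Or.inl (by omega)))⟩
          · have := v2 w (by omega)
            exact ⟨Q + w, by omega, Or.inr (Or.inr (Or.inr (Or.inr (by omega))))⟩
        · by_cases g2 : r < 2 * Q + 2
          · rcases (show r = 2 * Q ∨ r = 2 * Q + 1 by omega) with g | g
            · have := v3 trivial; exact ⟨2 * Q, by omega, Or.inr (Or.inr (Or.inl (by omega)))⟩
            · have := v3 trivial; exact ⟨2 * Q, by omega, Or.inr (Or.inr (Or.inr (Or.inr (by omega))))⟩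
          · by_cases g3 : r < 2 * Q + 4
            · rcases (show r = 2 * Q + 2 ∨ r = 2 * Q + 3 by omega) with g | g
              · have := v4 trivial; exact ⟨2 * Q + 1, by omega, Or.inr (Or.inr (Or.inr (Or.inr (by omega))))⟩
              · have := v4 trivial; exact ⟨2 * Q + 1, by omega, Or.inr (Or.inr (Or.inl (by omega)))⟩
            · obtain ⟨u, hu⟩ : ∃ u, r = 2 * Q + 4 + 2 * u ∨ r = 2 * Q + 4 + 2 * u + 1 :=
                ⟨(r - 2 * Q - 4) / 2, by omega⟩
              rcases hu with hu | hu
              · have := v1 u (by omega)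
                exact ⟨u, by omega, Or.inr (Or.inr (Or.inr (Or.inr (by omega))))⟩
              · have := v2 u (by omega)
                exact ⟨Q + u, by omega, Or.inr (Or.inr (Or.inl (by omega)))⟩
      · by_cases h3 : o = 1 ∧ k + h = S + 2 * n + 3
        · right; have := v5 trivial; exact ⟨2 * Q + 2, by omega, Or.inr (Or.inl (by omega))⟩
        by_cases h3' : o = 1 ∧ k + h = S + 2 * n + 1
        · right; have := v5 trivial; exact ⟨2 * Q + 2, by omega, Or.inr (Or.inr (Or.inr (Or.inr (by omega))))⟩
        obtain ⟨z, hz⟩ : ∃ z, k = S + z := ⟨k - S, by omega⟩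
        obtain ⟨k', h4, h5, h6⟩ := sk1 z (by omega) (by omega)
        clear hk1 he he' hI hα2 h3 h3'
        rcases hsplit k' h4 h5 with h7 | ⟨j, hj, h7⟩
        · left
          rcases h6 with h6 | h6
          · exact ⟨k', h7, Or.inl (by omega)⟩
          · exact ⟨k', h7, Or.inr (Or.inl (by omega))⟩
        · right
          rcases cs j hj with g | ⟨i, g⟩ | g | g | g
          · have h8 := hF2 j (by omega)
            rw [show la + 2 * j = k' by omega] at h8
            rcases h6 with h6 | h6
            · exact ⟨j, hj, Or.inl (by omega)⟩
            · exact ⟨j, hj, Or.inr (Or.inl (by omega))⟩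
          · have h8 := hF3 i g.1 k' (by omega)
            rcases h6 with h6 | h6
            · exact ⟨j, hj, Or.inl (by omega)⟩
            · exact ⟨j, hj, Or.inr (Or.inl (by omega))⟩
          · have h8 := hF2 (Q + 1) (by omega)
            rw [show la + 2 * (Q + 1) = k' by omega] at h8
            rcases h6 with h6 | h6
            · have := v3 trivial; exact ⟨2 * Q, by omega, Or.inl (by omega)⟩
            · have := v4 trivial; exact ⟨2 * Q + 1, by omega, Or.inr (Or.inl (by omega))⟩
          · have h8 := hF2 (Q + 2) (by omega)
            rw [show la + 2 * (Q + 2) = k' by omega] at h8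
            rcases h6 with h6 | h6
            · have := v4 trivial; exact ⟨2 * Q + 1, by omega, Or.inl (by omega)⟩
            · have := v3 trivial; exact ⟨2 * Q, by omega, Or.inr (Or.inl (by omega))⟩
          · have h8 : k' = 1 := by omega
            subst h8
            rcases h6 with h6 | h6
            · exact ⟨j, hj, Or.inr (Or.inr (Or.inl (by omega)))⟩
            · exact ⟨j, hj, Or.inl (by omega)⟩
  · omega
  · intro i hi; have := hIm i hi; omega
  · intro i hi; have := hIm i hi; omega
  · intro i hi
    clear v1 v2 v3 v4 v5 he hI
    rcases cs i hi with h | ⟨i', h⟩ | h | h | h <;> omega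
  · intro i hi
    clear v1 v2 v3 v4 v5 he hI
    rcases cs i hi with h | ⟨i', h⟩ | h | h | h <;> omega
  · intro i hi
    clear v1 v2 v3 v4 v5 he hI
    rcases cs i hi with h | ⟨i', h⟩ | h | h | h <;> omega
  · intro i hi
    clear v1 v2 v3 v4 v5 he hI
    rcases cs i hi with h | ⟨i', h⟩ | h | h | h <;> omega
  · intro i hi j hj hij
    clear v1 v2 v3 v4 v5 he hI
    rcases cs i hi with h | ⟨i', h⟩ | h | h | h <;> rcases cs j hj with g | ⟨j', g⟩ | g | g | g <;>
      omega
  · intro i hi j hj hij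
    clear v1 v2 v3 v4 v5 he hI
    rcases cs i hi with h | ⟨i', h⟩ | h | h | h <;> rcases cs j hj with g | ⟨j', g⟩ | g | g | g <;>
      omega
  · intro i hi j hj hij
    clear v1 v2 v3 v4 v5 he hI
    rcases cs i hi with h | ⟨i', h⟩ | h | h | h <;> rcases cs j hj with g | ⟨j', g⟩ | g | g | g <;>
      omega

theorem skolem0 (s : ℕ) (hs : 3 ≤ s) : ∃ ℓ : ℕ → ℕ, Skolem (4 * s) 0 ℓ ∧
    (∀ j, 2 * s + 1 + 2 * j ≤ 4 * s → ℓ (2 * s + 1 + 2 * j) + j = s) ∧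
    (∀ j k, 2 ≤ k → k + 6 + 2 * j = 2 * s + 1 → ℓ k = s + 4 + j) := by
  obtain ⟨ℓ, hℓ⟩ : ∃ ℓ : ℕ → ℕ, ∀ k, ℓ k =
      if k = 1 then s + 1 else
      if k = 2 * s - 3 then s + 3 else
      if k = 2 * s - 1 then 2 * s + 2 else
      if k = 4 * s then 2 * s + 1 else
      if k % 2 = 0 then (12 * s + 2 - k) / 2 else
      if 2 * s + 1 ≤ k then (4 * s + 1 - k) / 2 else (4 * s + 3 - k) / 2 := ⟨_, fun _ => rfl⟩
  have f1 : ∀ k, 2 ≤ k → k ≤ 4 * s - 2 → k % 2 = 0 → 2 * ℓ k + k = 12 * s + 2 := by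
    intro k h1 h2 h3; rw [hℓ]; split_ifs <;> omega
  have f2 : ∀ k, 2 * s + 1 ≤ k → k ≤ 4 * s - 1 → k % 2 = 1 → 2 * ℓ k + k = 4 * s + 1 := by
    intro k h1 h2 h3; rw [hℓ]; split_ifs <;> omega
  have f3 : ∀ k, 3 ≤ k → k ≤ 2 * s - 5 → k % 2 = 1 → 2 * ℓ k + k = 4 * s + 3 := by
    intro k h1 h2 h3; rw [hℓ]; split_ifs <;> omega
  have g1 : ℓ (1) = s + 1 := by rw [hℓ]; split_ifs <;> omega
  have g2 : ℓ (2 * s - 3) = s + 3 := by rw [hℓ]; split_ifs <;> omega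
  have g3 : ℓ (2 * s - 1) = 2 * s + 2 := by rw [hℓ]; split_ifs <;> omega
  have g4 : ℓ (4 * s) = 2 * s + 1 := by rw [hℓ]; split_ifs <;> omega
  clear hℓ
  refine ⟨ℓ, ⟨?_, ?_⟩, ?_, ?_⟩
  · intro z hz1 hz2
    by_cases c1 : 12 * s + 2 ≤ 2 * z + (4 * s - 2) ∧ 2 * z + 2 ≤ 12 * s + 2 ∧ 2 ≤ 4 * s - 2
    · have := f1 (12 * s + 2 - 2 * z) (by omega) (by omega) (by omega)
      exact ⟨_, by omega, by omega, Or.inl (by omega : ℓ (12 * s + 2 - 2 * z) = z)⟩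
    by_cases d1 : 12 * s + 2 + 2 ≤ 2 * z ∧ 2 * z ≤ 12 * s + 2 + (4 * s - 2) ∧ 2 ≤ 4 * s - 2
    · have := f1 (2 * z - (12 * s + 2)) (by omega) (by omega) (by omega)
      exact ⟨2 * z - (12 * s + 2), by omega, by omega, Or.inr (by omega)⟩
    by_cases c2 : 4 * s + 1 ≤ 2 * z + (4 * s - 1) ∧ 2 * z + 2 * s + 1 ≤ 4 * s + 1 ∧ 2 * s + 1 ≤ 4 * s - 1
    · have := f2 (4 * s + 1 - 2 * z) (by omega) (by omega) (by omega)
      exact ⟨_, by omega, by omega, Or.inl (by omega : ℓ (4 * s + 1 - 2 * z) = z)⟩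
    by_cases d2 : 4 * s + 1 + 2 * s + 1 ≤ 2 * z ∧ 2 * z ≤ 4 * s + 1 + (4 * s - 1) ∧ 2 * s + 1 ≤ 4 * s - 1
    · have := f2 (2 * z - (4 * s + 1)) (by omega) (by omega) (by omega)
      exact ⟨2 * z - (4 * s + 1), by omega, by omega, Or.inr (by omega)⟩
    by_cases c3 : 4 * s + 3 ≤ 2 * z + (2 * s - 5) ∧ 2 * z + 3 ≤ 4 * s + 3 ∧ 3 ≤ 2 * s - 5
    · have := f3 (4 * s + 3 - 2 * z) (by omega) (by omega) (by omega)
      exact ⟨_, by omega, by omega, Or.inl (by omega : ℓ (4 * s + 3 - 2 * z) = z)⟩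
    by_cases d3 : 4 * s + 3 + 3 ≤ 2 * z ∧ 2 * z ≤ 4 * s + 3 + (2 * s - 5) ∧ 3 ≤ 2 * s - 5
    · have := f3 (2 * z - (4 * s + 3)) (by omega) (by omega) (by omega)
      exact ⟨2 * z - (4 * s + 3), by omega, by omega, Or.inr (by omega)⟩
    by_cases a1 : z = s + 1 ∨ z = s + 1 + (1)
    · exact ⟨1, by omega, by omega, by omega⟩
    by_cases a2 : z = s + 3 ∨ z = s + 3 + (2 * s - 3)
    · exact ⟨2 * s - 3, by omega, by omega, by omega⟩
    by_cases a3 : z = 2 * s + 2 ∨ z = 2 * s + 2 + (2 * s - 1)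
    · exact ⟨2 * s - 1, by omega, by omega, by omega⟩
    by_cases a4 : z = 2 * s + 1 ∨ z = 2 * s + 1 + (4 * s)
    · exact ⟨4 * s, by omega, by omega, by omega⟩
    exfalso; omega
  · intro k hk1 hk2
    by_cases a1 : k = 1
    · rw [a1, g1]; omega
    by_cases a2 : k = 2 * s - 3
    · rw [a2, g2]; omega
    by_cases a3 : k = 2 * s - 1
    · rw [a3, g3]; omega
    by_cases a4 : k = 4 * s
    · rw [a4, g4]; omega
    by_cases b : k % 2 = 0
    · have := f1 k (by omega) (by omega) b; omega
    by_cases b' : 2 * s + 1 ≤ k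
    · have := f2 k b' (by omega) (by omega); omega
    · have := f3 k (by omega) (by omega) (by omega); omega
  · intro j hj
    have := f2 (2 * s + 1 + 2 * j) (by omega) (by omega) (by omega); omega
  · intro j k hk hj
    have := f3 k (by omega) (by omega) (by omega); omega

theorem skolem1 (s : ℕ) (hs : 2 ≤ s) : ∃ ℓ : ℕ → ℕ, Skolem (4 * s + 1) 0 ℓ ∧
    (∀ j, 2 * s + 3 + 2 * j ≤ 4 * s + 1 → ℓ (2 * s + 3 + 2 * j) + j = s) ∧
    (∀ j k, 2 ≤ k → k + 6 + 2 * j = 2 * s + 3 → ℓ k = s + 4 + j) := by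
  obtain ⟨ℓ, hℓ⟩ : ∃ ℓ : ℕ → ℕ, ∀ k, ℓ k =
      if k = 1 then s + 1 else
      if k = 2 * s - 1 then s + 3 else
      if k = 2 * s + 1 then 2 * s + 2 else
      if k = 4 * s then 2 * s + 3 else
      if k % 2 = 0 then (12 * s + 6 - k) / 2 else
      if 2 * s + 3 ≤ k then (4 * s + 3 - k) / 2 else (4 * s + 5 - k) / 2 := ⟨_, fun _ => rfl⟩
  have f1 : ∀ k, 2 ≤ k → k ≤ 4 * s - 2 → k % 2 = 0 → 2 * ℓ k + k = 12 * s + 6 := by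
    intro k h1 h2 h3; rw [hℓ]; split_ifs <;> omega
  have f2 : ∀ k, 2 * s + 3 ≤ k → k ≤ 4 * s + 1 → k % 2 = 1 → 2 * ℓ k + k = 4 * s + 3 := by
    intro k h1 h2 h3; rw [hℓ]; split_ifs <;> omega
  have f3 : ∀ k, 3 ≤ k → k ≤ 2 * s - 3 → k % 2 = 1 → 2 * ℓ k + k = 4 * s + 5 := by
    intro k h1 h2 h3; rw [hℓ]; split_ifs <;> omega
  have g1 : ℓ (1) = s + 1 := by rw [hℓ]; split_ifs <;> omega
  have g2 : ℓ (2 * s - 1) = s + 3 := by rw [hℓ]; split_ifs <;> omega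
  have g3 : ℓ (2 * s + 1) = 2 * s + 2 := by rw [hℓ]; split_ifs <;> omega
  have g4 : ℓ (4 * s) = 2 * s + 3 := by rw [hℓ]; split_ifs <;> omega
  clear hℓ
  refine ⟨ℓ, ⟨?_, ?_⟩, ?_, ?_⟩
  · intro z hz1 hz2
    by_cases c1 : 12 * s + 6 ≤ 2 * z + (4 * s - 2) ∧ 2 * z + 2 ≤ 12 * s + 6 ∧ 2 ≤ 4 * s - 2
    · have := f1 (12 * s + 6 - 2 * z) (by omega) (by omega) (by omega)
      exact ⟨_, by omega, by omega, Or.inl (by omega : ℓ (12 * s + 6 - 2 * z) = z)⟩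
    by_cases d1 : 12 * s + 6 + 2 ≤ 2 * z ∧ 2 * z ≤ 12 * s + 6 + (4 * s - 2) ∧ 2 ≤ 4 * s - 2
    · have := f1 (2 * z - (12 * s + 6)) (by omega) (by omega) (by omega)
      exact ⟨2 * z - (12 * s + 6), by omega, by omega, Or.inr (by omega)⟩
    by_cases c2 : 4 * s + 3 ≤ 2 * z + (4 * s + 1) ∧ 2 * z + 2 * s + 3 ≤ 4 * s + 3 ∧ 2 * s + 3 ≤ 4 * s + 1
    · have := f2 (4 * s + 3 - 2 * z) (by omega) (by omega) (by omega)
      exact ⟨_, by omega, by omega, Or.inl (by omega : ℓ (4 * s + 3 - 2 * z) = z)⟩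
    by_cases d2 : 4 * s + 3 + 2 * s + 3 ≤ 2 * z ∧ 2 * z ≤ 4 * s + 3 + (4 * s + 1) ∧ 2 * s + 3 ≤ 4 * s + 1
    · have := f2 (2 * z - (4 * s + 3)) (by omega) (by omega) (by omega)
      exact ⟨2 * z - (4 * s + 3), by omega, by omega, Or.inr (by omega)⟩
    by_cases c3 : 4 * s + 5 ≤ 2 * z + (2 * s - 3) ∧ 2 * z + 3 ≤ 4 * s + 5 ∧ 3 ≤ 2 * s - 3
    · have := f3 (4 * s + 5 - 2 * z) (by omega) (by omega) (by omega)
      exact ⟨_, by omega, by omega, Or.inl (by omega : ℓ (4 * s + 5 - 2 * z) = z)⟩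
    by_cases d3 : 4 * s + 5 + 3 ≤ 2 * z ∧ 2 * z ≤ 4 * s + 5 + (2 * s - 3) ∧ 3 ≤ 2 * s - 3
    · have := f3 (2 * z - (4 * s + 5)) (by omega) (by omega) (by omega)
      exact ⟨2 * z - (4 * s + 5), by omega, by omega, Or.inr (by omega)⟩
    by_cases a1 : z = s + 1 ∨ z = s + 1 + (1)
    · exact ⟨1, by omega, by omega, by omega⟩
    by_cases a2 : z = s + 3 ∨ z = s + 3 + (2 * s - 1)
    · exact ⟨2 * s - 1, by omega, by omega, by omega⟩
    by_cases a3 : z = 2 * s + 2 ∨ z = 2 * s + 2 + (2 * s + 1)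
    · exact ⟨2 * s + 1, by omega, by omega, by omega⟩
    by_cases a4 : z = 2 * s + 3 ∨ z = 2 * s + 3 + (4 * s)
    · exact ⟨4 * s, by omega, by omega, by omega⟩
    exfalso; omega
  · intro k hk1 hk2
    by_cases a1 : k = 1
    · rw [a1, g1]; omega
    by_cases a2 : k = 2 * s - 1
    · rw [a2, g2]; omega
    by_cases a3 : k = 2 * s + 1
    · rw [a3, g3]; omega
    by_cases a4 : k = 4 * s
    · rw [a4, g4]; omega
    by_cases b : k % 2 = 0
    · have := f1 k (by omega) (by omega) b; omega
    by_cases b' : 2 * s + 3 ≤ k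
    · have := f2 k b' (by omega) (by omega); omega
    · have := f3 k (by omega) (by omega) (by omega); omega
  · intro j hj
    have := f2 (2 * s + 3 + 2 * j) (by omega) (by omega) (by omega); omega
  · intro j k hk hj
    have := f3 k (by omega) (by omega) (by omega); omega

theorem skolem2 (s : ℕ) (hs : 2 ≤ s) : ∃ ℓ : ℕ → ℕ, Skolem (4 * s + 2) 1 ℓ ∧
    (∀ j, 2 * s + 4 + 2 * j ≤ 4 * s + 2 → ℓ (2 * s + 4 + 2 * j) + j = s) ∧
    (∀ j k, 2 ≤ k → k + 6 + 2 * j = 2 * s + 4 → ℓ k = s + 4 + j) := by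
  obtain ⟨ℓ, hℓ⟩ : ∃ ℓ : ℕ → ℕ, ∀ k, ℓ k =
      if k = 1 then s + 1 else
      if k = 2 * s then s + 3 else
      if k = 2 * s + 2 then 6 * s + 3 else
      if k = 4 * s + 1 then 2 * s + 3 else
      if k % 2 = 1 then (12 * s + 7 - k) / 2 else
      if 2 * s + 4 ≤ k then (4 * s + 4 - k) / 2 else (4 * s + 6 - k) / 2 := ⟨_, fun _ => rfl⟩
  have f1 : ∀ k, 3 ≤ k → k ≤ 4 * s - 1 → k % 2 = 1 → 2 * ℓ k + k = 12 * s + 7 := by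
    intro k h1 h2 h3; rw [hℓ]; split_ifs <;> omega
  have f2 : ∀ k, 2 * s + 4 ≤ k → k ≤ 4 * s + 2 → k % 2 = 0 → 2 * ℓ k + k = 4 * s + 4 := by
    intro k h1 h2 h3; rw [hℓ]; split_ifs <;> omega
  have f3 : ∀ k, 2 ≤ k → k ≤ 2 * s - 2 → k % 2 = 0 → 2 * ℓ k + k = 4 * s + 6 := by
    intro k h1 h2 h3; rw [hℓ]; split_ifs <;> omega
  have g1 : ℓ (1) = s + 1 := by rw [hℓ]; split_ifs <;> omega
  have g2 : ℓ (2 * s) = s + 3 := by rw [hℓ]; split_ifs <;> omega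
  have g3 : ℓ (2 * s + 2) = 6 * s + 3 := by rw [hℓ]; split_ifs <;> omega
  have g4 : ℓ (4 * s + 1) = 2 * s + 3 := by rw [hℓ]; split_ifs <;> omega
  clear hℓ
  refine ⟨ℓ, ⟨?_, ?_⟩, ?_, ?_⟩
  · intro z hz1 hz2
    by_cases c1 : 12 * s + 7 ≤ 2 * z + (4 * s - 1) ∧ 2 * z + 3 ≤ 12 * s + 7 ∧ 3 ≤ 4 * s - 1
    · have := f1 (12 * s + 7 - 2 * z) (by omega) (by omega) (by omega)
      exact ⟨_, by omega, by omega, Or.inl (by omega : ℓ (12 * s + 7 - 2 * z) = z)⟩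
    by_cases d1 : 12 * s + 7 + 3 ≤ 2 * z ∧ 2 * z ≤ 12 * s + 7 + (4 * s - 1) ∧ 3 ≤ 4 * s - 1
    · have := f1 (2 * z - (12 * s + 7)) (by omega) (by omega) (by omega)
      exact ⟨2 * z - (12 * s + 7), by omega, by omega, Or.inr (by omega)⟩
    by_cases c2 : 4 * s + 4 ≤ 2 * z + (4 * s + 2) ∧ 2 * z + 2 * s + 4 ≤ 4 * s + 4 ∧ 2 * s + 4 ≤ 4 * s + 2
    · have := f2 (4 * s + 4 - 2 * z) (by omega) (by omega) (by omega)
      exact ⟨_, by omega, by omega, Or.inl (by omega : ℓ (4 * s + 4 - 2 * z) = z)⟩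
    by_cases d2 : 4 * s + 4 + 2 * s + 4 ≤ 2 * z ∧ 2 * z ≤ 4 * s + 4 + (4 * s + 2) ∧ 2 * s + 4 ≤ 4 * s + 2
    · have := f2 (2 * z - (4 * s + 4)) (by omega) (by omega) (by omega)
      exact ⟨2 * z - (4 * s + 4), by omega, by omega, Or.inr (by omega)⟩
    by_cases c3 : 4 * s + 6 ≤ 2 * z + (2 * s - 2) ∧ 2 * z + 2 ≤ 4 * s + 6 ∧ 2 ≤ 2 * s - 2
    · have := f3 (4 * s + 6 - 2 * z) (by omega) (by omega) (by omega)
      exact ⟨_, by omega, by omega, Or.inl (by omega : ℓ (4 * s + 6 - 2 * z) = z)⟩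
    by_cases d3 : 4 * s + 6 + 2 ≤ 2 * z ∧ 2 * z ≤ 4 * s + 6 + (2 * s - 2) ∧ 2 ≤ 2 * s - 2
    · have := f3 (2 * z - (4 * s + 6)) (by omega) (by omega) (by omega)
      exact ⟨2 * z - (4 * s + 6), by omega, by omega, Or.inr (by omega)⟩
    by_cases a1 : z = s + 1 ∨ z = s + 1 + (1)
    · exact ⟨1, by omega, by omega, by omega⟩
    by_cases a2 : z = s + 3 ∨ z = s + 3 + (2 * s)
    · exact ⟨2 * s, by omega, by omega, by omega⟩
    by_cases a3 : z = 6 * s + 3 ∨ z = 6 * s + 3 + (2 * s + 2)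
    · exact ⟨2 * s + 2, by omega, by omega, by omega⟩
    by_cases a4 : z = 2 * s + 3 ∨ z = 2 * s + 3 + (4 * s + 1)
    · exact ⟨4 * s + 1, by omega, by omega, by omega⟩
    exfalso; omega
  · intro k hk1 hk2
    by_cases a1 : k = 1
    · rw [a1, g1]; omega
    by_cases a2 : k = 2 * s
    · rw [a2, g2]; omega
    by_cases a3 : k = 2 * s + 2
    · rw [a3, g3]; omega
    by_cases a4 : k = 4 * s + 1
    · rw [a4, g4]; omega
    by_cases b : k % 2 = 1
    · have := f1 k (by omega) (by omega) b; omega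
    by_cases b' : 2 * s + 4 ≤ k
    · have := f2 k b' (by omega) (by omega); omega
    · have := f3 k (by omega) (by omega) (by omega); omega
  · intro j hj
    have := f2 (2 * s + 4 + 2 * j) (by omega) (by omega) (by omega); omega
  · intro j k hk hj
    have := f3 k (by omega) (by omega) (by omega); omega

theorem skolem3 (s : ℕ) (hs : 2 ≤ s) : ∃ ℓ : ℕ → ℕ, Skolem (4 * s + 3) 1 ℓ ∧
    (∀ j, 2 * s + 2 + 2 * j ≤ 4 * s + 3 → ℓ (2 * s + 2 + 2 * j) + j = s + 1) ∧
    (∀ j k, 2 ≤ k → k + 6 + 2 * j = 2 * s + 2 → ℓ k = s + 1 + 4 + j) := by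
  obtain ⟨ℓ, hℓ⟩ : ∃ ℓ : ℕ → ℕ, ∀ k, ℓ k =
      if k = 1 then s + 2 else
      if k = 2 * s - 2 then s + 4 else
      if k = 2 * s then 6 * s + 5 else
      if k = 4 * s + 1 then 2 * s + 3 else
      if k = 4 * s + 3 then 4 * s + 4 else
      if k % 2 = 1 then (12 * s + 9 - k) / 2 else
      if 2 * s + 2 ≤ k then (4 * s + 4 - k) / 2 else (4 * s + 6 - k) / 2 := ⟨_, fun _ => rfl⟩
  have f1 : ∀ k, 3 ≤ k → k ≤ 4 * s - 1 → k % 2 = 1 → 2 * ℓ k + k = 12 * s + 9 := by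
    intro k h1 h2 h3; rw [hℓ]; split_ifs <;> omega
  have f2 : ∀ k, 2 * s + 2 ≤ k → k ≤ 4 * s + 2 → k % 2 = 0 → 2 * ℓ k + k = 4 * s + 4 := by
    intro k h1 h2 h3; rw [hℓ]; split_ifs <;> omega
  have f3 : ∀ k, 2 ≤ k → k ≤ 2 * s - 4 → k % 2 = 0 → 2 * ℓ k + k = 4 * s + 6 := by
    intro k h1 h2 h3; rw [hℓ]; split_ifs <;> omega
  have g1 : ℓ (1) = s + 2 := by rw [hℓ]; split_ifs <;> omega
  have g2 : ℓ (2 * s - 2) = s + 4 := by rw [hℓ]; split_ifs <;> omega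
  have g3 : ℓ (2 * s) = 6 * s + 5 := by rw [hℓ]; split_ifs <;> omega
  have g4 : ℓ (4 * s + 1) = 2 * s + 3 := by rw [hℓ]; split_ifs <;> omega
  have g5 : ℓ (4 * s + 3) = 4 * s + 4 := by rw [hℓ]; split_ifs <;> omega
  clear hℓ
  refine ⟨ℓ, ⟨?_, ?_⟩, ?_, ?_⟩
  · intro z hz1 hz2
    by_cases c1 : 12 * s + 9 ≤ 2 * z + (4 * s - 1) ∧ 2 * z + 3 ≤ 12 * s + 9 ∧ 3 ≤ 4 * s - 1
    · have := f1 (12 * s + 9 - 2 * z) (by omega) (by omega) (by omega)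
      exact ⟨_, by omega, by omega, Or.inl (by omega : ℓ (12 * s + 9 - 2 * z) = z)⟩
    by_cases d1 : 12 * s + 9 + 3 ≤ 2 * z ∧ 2 * z ≤ 12 * s + 9 + (4 * s - 1) ∧ 3 ≤ 4 * s - 1
    · have := f1 (2 * z - (12 * s + 9)) (by omega) (by omega) (by omega)
      exact ⟨2 * z - (12 * s + 9), by omega, by omega, Or.inr (by omega)⟩
    by_cases c2 : 4 * s + 4 ≤ 2 * z + (4 * s + 2) ∧ 2 * z + 2 * s + 2 ≤ 4 * s + 4 ∧ 2 * s + 2 ≤ 4 * s + 2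
    · have := f2 (4 * s + 4 - 2 * z) (by omega) (by omega) (by omega)
      exact ⟨_, by omega, by omega, Or.inl (by omega : ℓ (4 * s + 4 - 2 * z) = z)⟩
    by_cases d2 : 4 * s + 4 + 2 * s + 2 ≤ 2 * z ∧ 2 * z ≤ 4 * s + 4 + (4 * s + 2) ∧ 2 * s + 2 ≤ 4 * s + 2
    · have := f2 (2 * z - (4 * s + 4)) (by omega) (by omega) (by omega)
      exact ⟨2 * z - (4 * s + 4), by omega, by omega, Or.inr (by omega)⟩
    by_cases c3 : 4 * s + 6 ≤ 2 * z + (2 * s - 4) ∧ 2 * z + 2 ≤ 4 * s + 6 ∧ 2 ≤ 2 * s - 4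
    · have := f3 (4 * s + 6 - 2 * z) (by omega) (by omega) (by omega)
      exact ⟨_, by omega, by omega, Or.inl (by omega : ℓ (4 * s + 6 - 2 * z) = z)⟩
    by_cases d3 : 4 * s + 6 + 2 ≤ 2 * z ∧ 2 * z ≤ 4 * s + 6 + (2 * s - 4) ∧ 2 ≤ 2 * s - 4
    · have := f3 (2 * z - (4 * s + 6)) (by omega) (by omega) (by omega)
      exact ⟨2 * z - (4 * s + 6), by omega, by omega, Or.inr (by omega)⟩
    by_cases a1 : z = s + 2 ∨ z = s + 2 + (1)
    · exact ⟨1, by omega, by omega, by omega⟩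
    by_cases a2 : z = s + 4 ∨ z = s + 4 + (2 * s - 2)
    · exact ⟨2 * s - 2, by omega, by omega, by omega⟩
    by_cases a3 : z = 6 * s + 5 ∨ z = 6 * s + 5 + (2 * s)
    · exact ⟨2 * s, by omega, by omega, by omega⟩
    by_cases a4 : z = 2 * s + 3 ∨ z = 2 * s + 3 + (4 * s + 1)
    · exact ⟨4 * s + 1, by omega, by omega, by omega⟩
    by_cases a5 : z = 4 * s + 4 ∨ z = 4 * s + 4 + (4 * s + 3)
    · exact ⟨4 * s + 3, by omega, by omega, by omega⟩
    exfalso; omega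
  · intro k hk1 hk2
    by_cases a1 : k = 1
    · rw [a1, g1]; omega
    by_cases a2 : k = 2 * s - 2
    · rw [a2, g2]; omega
    by_cases a3 : k = 2 * s
    · rw [a3, g3]; omega
    by_cases a4 : k = 4 * s + 1
    · rw [a4, g4]; omega
    by_cases a5 : k = 4 * s + 3
    · rw [a5, g5]; omega
    by_cases b : k % 2 = 1
    · have := f1 k (by omega) (by omega) b; omega
    by_cases b' : 2 * s + 2 ≤ k
    · have := f2 k b' (by omega) (by omega); omega
    · have := f3 k (by omega) (by omega) (by omega); omega
  · intro j hj
    have := f2 (2 * s + 2 + 2 * j) (by omega) (by omega) (by omega); omega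
  · intro j k hk hj
    have := f3 k (by omega) (by omega) (by omega); omega

/-- The desired labelling exists (`e = 0`: graceful, `e = 1`: near graceful). -/
def Good (t p e : ℕ) : Prop :=
  ∃ f : WindmillVertex (LL t p) → ℕ, Function.Injective f ∧ (∀ v, f v ≤ 3 * t + 5 * p + e) ∧
    Set.BijOn (edgeLabel f) (Windmill (LL t p)).edgeSet (target (3 * t + 5 * p) e : Set ℕ)

/-- Explicit solutions for small parameters. -/
theorem small (t p e B : ℕ) (x y a b c d : List ℕ) (he : e ≤ 1) (hm : 1 ≤ 3 * t + 5 * p)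
    (surj : ∀ k ∈ target (3 * t + 5 * p) e,
      (∃ i < t, x.getD i 0 = k ∨ y.getD i 0 = k ∨ ((x.getD i 0 : ℤ) - y.getD i 0).natAbs = k) ∨
      (∃ i < p, a.getD i 0 = k ∨ d.getD i 0 = k ∨ ((a.getD i 0 : ℤ) - b.getD i 0).natAbs = k ∨
        ((b.getD i 0 : ℤ) - c.getD i 0).natAbs = k ∨
        ((c.getD i 0 : ℤ) - d.getD i 0).natAbs = k))
    (hxy : ∀ i < t, B < x.getD i 0 ∧ B < y.getD i 0)
    (hp : ∀ i < p, B < a.getD i 0 ∧ B < d.getD i 0 ∧ (1 ≤ b.getD i 0 ∧ b.getD i 0 ≤ B) ∧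
      (1 ≤ c.getD i 0 ∧ c.getD i 0 ≤ B))
    (hpp : ∀ i < p, ∀ j < p, (b.getD i 0 = b.getD j 0 → i = j) ∧
      (c.getD i 0 = c.getD j 0 → i = j) ∧ b.getD i 0 ≠ c.getD j 0)
    (hB : B ≤ 3 * t + 5 * p) : Good t p e :=
  criterion t p (fun i => x.getD i 0) (fun i => y.getD i 0) (fun i => a.getD i 0)
    (fun i => b.getD i 0) (fun i => c.getD i 0) (fun i => d.getD i 0) _ _ B
    (target_card _ _ he hm) (fun k hk => by have := target_le _ _ _ hk; omega) surj (by omega)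
    (fun i hi => (hxy i hi).1) (fun i hi => (hxy i hi).2)
    (fun i hi => (hp i hi).1) (fun i hi => (hp i hi).2.1)
    (fun i hi => (hp i hi).2.2.1) (fun i hi => (hp i hi).2.2.2)
    (fun i hi j hj => (hpp i hi j hj).1) (fun i hi j hj => (hpp i hi j hj).2.1)
    (fun i hi j hj => (hpp i hi j hj).2.2)

lemma small_3_1 : Good 3 1 1 :=
  small 3 1 1 4 [7, 5, 6]
    [9, 8, 10]
    [12] [1] [2] [15]
    (by norm_num) (by norm_num) (by decide +kernel) (by decide +kernel) (by decide +kernel)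
    (by decide +kernel) (by norm_num)

lemma small_4_1 : Good 4 1 1 :=
  small 4 1 1 5 [13, 11, 6, 7]
    [15, 14, 10, 12]
    [9] [1] [2] [18]
    (by norm_num) (by norm_num) (by decide +kernel) (by decide +kernel) (by decide +kernel)
    (by decide +kernel) (by norm_num)

lemma small_5_2 : Good 5 2 1 :=
  small 5 2 1 11 [23, 14, 21, 16, 12]
    [24, 18, 26, 22, 19]
    [13, 15] [5, 6] [7, 9] [17, 20]
    (by norm_num) (by norm_num) (by decide +kernel) (by decide +kernel) (by decide +kernel)
    (by decide +kernel) (by norm_num)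

lemma small_7_1 : Good 7 1 1 :=
  small 7 1 1 8 [22, 9, 19, 16, 11, 13, 10]
    [24, 12, 23, 21, 17, 20, 18]
    [15] [1] [2] [27]
    (by norm_num) (by norm_num) (by decide +kernel) (by decide +kernel) (by decide +kernel)
    (by decide +kernel) (by norm_num)

lemma small_8_2 : Good 8 2 1 :=
  small 8 2 1 14 [33, 28, 25, 23, 20, 18, 15, 21]
    [35, 32, 30, 29, 27, 26, 24, 31]
    [16, 17] [4, 6] [5, 9] [19, 22]
    (by norm_num) (by norm_num) (by decide +kernel) (by decide +kernel) (by decide +kernel)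
    (by decide +kernel) (by norm_num)

lemma small_7_3 : Good 7 3 0 :=
  small 7 3 0 14 [29, 28, 21, 19, 22, 24, 25]
    [31, 32, 27, 26, 30, 33, 35]
    [16, 17, 18] [1, 6, 4] [2, 11, 7] [36, 23, 20]
    (by norm_num) (by norm_num) (by decide +kernel) (by decide +kernel) (by decide +kernel)
    (by decide +kernel) (by norm_num)

lemma small_8_3 : Good 8 3 0 :=
  small 8 3 0 15 [34, 21, 24, 22, 23, 27, 25, 17]
    [38, 26, 30, 29, 31, 36, 35, 28]
    [33, 18, 16] [1, 4, 3] [2, 7, 5] [39, 19, 20]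
    (by norm_num) (by norm_num) (by decide +kernel) (by decide +kernel) (by decide +kernel)
    (by decide +kernel) (by norm_num)

lemma small_9_4 : Good 9 4 0 :=
  small 9 4 0 21 [46, 41, 37, 32, 30, 24, 27, 31, 22]
    [47, 45, 44, 40, 39, 34, 38, 43, 35]
    [23, 26, 28, 36] [8, 10, 9, 16] [11, 12, 15, 21] [25, 29, 33, 42]
    (by norm_num) (by norm_num) (by decide +kernel) (by decide +kernel) (by decide +kernel)
    (by decide +kernel) (by norm_num)

lemma small_11_3 : Good 11 3 0 :=
  small 11 3 0 18 [43, 37, 38, 32, 28, 35, 20, 22, 19, 34, 27]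
    [45, 40, 42, 39, 36, 44, 30, 33, 31, 47, 41]
    [25, 21, 23] [1, 6, 5] [2, 12, 10] [48, 29, 26]
    (by norm_num) (by norm_num) (by decide +kernel) (by decide +kernel) (by decide +kernel)
    (by decide +kernel) (by norm_num)

lemma small_12_3 : Good 12 3 0 :=
  small 12 3 0 19 [33, 41, 42, 38, 23, 25, 40, 36, 32, 22, 29, 24]
    [37, 46, 48, 45, 31, 34, 50, 47, 44, 35, 43, 39]
    [21, 26, 27] [1, 10, 8] [2, 12, 11] [51, 30, 28]
    (by norm_num) (by norm_num) (by decide +kernel) (by decide +kernel) (by decide +kernel)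
    (by decide +kernel) (by norm_num)

lemma small_15_3 : Good 15 3 0 :=
  small 15 3 0 22 [54, 47, 25, 44, 45, 27, 49, 46, 23, 29, 38, 24, 32, 26, 37]
    [56, 50, 31, 51, 53, 36, 59, 57, 35, 42, 52, 39, 48, 43, 55]
    [41, 30, 28] [1, 10, 7] [2, 15, 11] [60, 34, 33]
    (by norm_num) (by norm_num) (by decide +kernel) (by decide +kernel) (by decide +kernel)
    (by decide +kernel) (by norm_num)

lemma good_one (t : ℕ) (ht : 3 ≤ t) (h : t % 4 = 0 ∨ t % 4 = 3) : Good t 1 1 := by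
  by_cases h3 : t = 3
  · subst h3; exact small_3_1
  by_cases h4 : t = 4
  · subst h4; exact small_4_1
  by_cases h7 : t = 7
  · subst h7; exact small_7_1
  rcases h with h | h
  · obtain ⟨s, hs⟩ : ∃ s, t = 4 * s := ⟨t / 4, by omega⟩
    obtain ⟨ℓ, sk, -, -⟩ := skolem1 s (by omega)
    exact assemble_one _ 0 t 1 ℓ (by omega) (by omega) rfl sk
  · obtain ⟨s, hs⟩ : ∃ s, t + 1 = 4 * s := ⟨(t + 1) / 4, by omega⟩
    obtain ⟨ℓ, sk, -, -⟩ := skolem0 s (by omega)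
    exact assemble_one _ 0 t 1 ℓ (by omega) (by omega) rfl sk

lemma good_gen0 (t o Q e s : ℕ) (ho : o ≤ 1) (hs : 3 ≤ s) (hn : 4 * s = t + (2 * Q + 2 + o))
    (he : o + 0 = e ∨ (o = 1 ∧ 0 = 1 ∧ e = 0)) (he' : e ≤ 1)
    (hα : Q + 3 ≤ s) (hα2 : 3 + 2 * o ≤ s + Q) : Good t (2 * Q + 2 + o) e := by
  obtain ⟨ℓ, sk, h2, h3⟩ := skolem0 s hs
  refine assemble (4 * s) 0 t e o Q (s) (2 * s + 1) ℓ ho hn (by omega) (by omega) he' sk ?_ ?_ ?_ ?_ hα hα2 ?_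
  · intro j hj; exact h2 j (by omega)
  · intro j hj k hk; exact h3 j k (by omega) hk
  · omega
  · omega
  · omega

lemma good_gen1 (t o Q e s : ℕ) (ho : o ≤ 1) (hs : 2 ≤ s) (hn : 4 * s + 1 = t + (2 * Q + 2 + o))
    (he : o + 0 = e ∨ (o = 1 ∧ 0 = 1 ∧ e = 0)) (he' : e ≤ 1)
    (hα : Q + 3 ≤ s) (hα2 : 3 + 2 * o ≤ s + Q) : Good t (2 * Q + 2 + o) e := by
  obtain ⟨ℓ, sk, h2, h3⟩ := skolem1 s hs
  refine assemble (4 * s + 1) 0 t e o Q (s) (2 * s + 3) ℓ ho hn (by omega) (by omega) he' sk ?_ ?_ ?_ ?_ hα hα2 ?_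
  · intro j hj; exact h2 j (by omega)
  · intro j hj k hk; exact h3 j k (by omega) hk
  · omega
  · omega
  · omega

lemma good_gen2 (t o Q e s : ℕ) (ho : o ≤ 1) (hs : 2 ≤ s) (hn : 4 * s + 2 = t + (2 * Q + 2 + o))
    (he : o + 1 = e ∨ (o = 1 ∧ 1 = 1 ∧ e = 0)) (he' : e ≤ 1)
    (hα : Q + 3 ≤ s) (hα2 : 3 + 2 * o ≤ s + Q) : Good t (2 * Q + 2 + o) e := by
  obtain ⟨ℓ, sk, h2, h3⟩ := skolem2 s hs
  refine assemble (4 * s + 2) 1 t e o Q (s) (2 * s + 4) ℓ ho hn (by omega) (by omega) he' sk ?_ ?_ ?_ ?_ hα hα2 ?_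
  · intro j hj; exact h2 j (by omega)
  · intro j hj k hk; exact h3 j k (by omega) hk
  · omega
  · omega
  · omega

lemma good_gen3 (t o Q e s : ℕ) (ho : o ≤ 1) (hs : 2 ≤ s) (hn : 4 * s + 3 = t + (2 * Q + 2 + o))
    (he : o + 1 = e ∨ (o = 1 ∧ 1 = 1 ∧ e = 0)) (he' : e ≤ 1)
    (hα : Q + 3 ≤ s + 1) (hα2 : 3 + 2 * o ≤ s + 1 + Q) : Good t (2 * Q + 2 + o) e := by
  obtain ⟨ℓ, sk, h2, h3⟩ := skolem3 s hs
  refine assemble (4 * s + 3) 1 t e o Q (s + 1) (2 * s + 2) ℓ ho hn (by omega) (by omega) he' sk ?_ ?_ ?_ ?_ hα hα2 ?_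
  · intro j hj; exact h2 j (by omega)
  · intro j hj k hk; exact h3 j k (by omega) hk
  · omega
  · omega
  · omega

lemma good_red (t e Q o s : ℕ) (ho : o ≤ 1) (ht : 2 * (2 * Q + 2 + o) + 1 ≤ t)
    (h2 : Q = 0 → o = 0 → 9 ≤ t) (h3 : Q = 0 → o = 1 → 16 ≤ t) (h4 : Q = 1 → o = 0 → 12 ≤ t)
    (h : (t + (2 * Q + 2 + o) = 4 * s ∧ e = o) ∨ (t + (2 * Q + 2 + o) = 4 * s + 1 ∧ e = o) ∨
      (t + (2 * Q + 2 + o) = 4 * s + 2 ∧ e + o = 1) ∨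
      (t + (2 * Q + 2 + o) = 4 * s + 3 ∧ e + o = 1))
    (hQ : Q % 2 = 0 → 4 * s + 2 ≤ t + (2 * Q + 2 + o)) :
    Good t (2 * Q + 2 + o) e := by
  have hb : (Q = 0 ∧ o = 0) ∨ (Q = 0 ∧ o = 1) ∨ (Q = 1 ∧ o = 0) ∨ (Q = 1 ∧ o = 1) ∨
    (Q = 2 ∧ o = 0) ∨ (Q = 2 ∧ o = 1) ∨ 3 ≤ Q := by omega
  rcases h with ⟨hs, he⟩ | ⟨hs, he⟩ | ⟨hs, he⟩ | ⟨hs, he⟩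
  · have : Q % 2 = 1 := by omega
    have h5 : Q + 3 ≤ s ∧ 3 + 2 * o ≤ s + Q := by
      rcases hb with hb | hb | hb | hb | hb | hb | hb <;> omega
    exact good_gen0 t o Q e s ho (by omega) hs.symm (by omega) (by omega) h5.1 h5.2
  · have : Q % 2 = 1 := by omega
    have h5 : Q + 3 ≤ s ∧ 3 + 2 * o ≤ s + Q := by
      rcases hb with hb | hb | hb | hb | hb | hb | hb <;> omega
    exact good_gen1 t o Q e s ho (by omega) hs.symm (by omega) (by omega) h5.1 h5.2
  · have h5 : Q + 3 ≤ s ∧ 3 + 2 * o ≤ s + Q := by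
      rcases hb with hb | hb | hb | hb | hb | hb | hb <;> omega
    exact good_gen2 t o Q e s ho (by omega) hs.symm (by omega) (by omega) h5.1 h5.2
  · have h5 : Q + 3 ≤ s + 1 ∧ 3 + 2 * o ≤ s + 1 + Q := by
      rcases hb with hb | hb | hb | hb | hb | hb | hb <;> omega
    exact good_gen3 t o Q e s ho (by omega) hs.symm (by omega) (by omega) h5.1 h5.2

lemma good_main (t p e : ℕ) (hp : 2 ≤ p) (ht : 2 * p + 1 ≤ t)
    (h : (p % 4 = 0 ∧ (t % 4 = 0 ∨ t % 4 = 1) ∧ e = 0) ∨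
      (p % 4 = 3 ∧ (t % 4 = 0 ∨ t % 4 = 3) ∧ e = 0) ∨
      (p % 4 = 1 ∧ (t % 4 = 0 ∨ t % 4 = 3) ∧ e = 1) ∨
      (p % 4 = 2 ∧ (t % 4 = 0 ∨ t % 4 = 1) ∧ e = 1)) : Good t p e := by
  rcases h with ⟨hp4, ht4, he⟩ | ⟨hp4, ht4, he⟩ | ⟨hp4, ht4, he⟩ | ⟨hp4, ht4, he⟩
  · by_cases hx : t = 9 ∧ p = 4
    · obtain ⟨rfl, rfl⟩ := hx; subst he; exact small_9_4
    obtain ⟨Q, rfl⟩ : ∃ Q, p = 2 * Q + 2 + 0 := ⟨(p - 2) / 2, by omega⟩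
    refine good_red t e Q 0 ((t + (2 * Q + 2 + 0)) / 4) (by omega) ht (by omega) (by omega)
      (by omega) (by omega) (by omega)
  · by_cases hp3 : p = 3
    · subst hp3; subst he
      by_cases h7 : t = 7
      · subst h7; exact small_7_3
      by_cases h8 : t = 8
      · subst h8; exact small_8_3
      by_cases h11 : t = 11
      · subst h11; exact small_11_3
      by_cases h12 : t = 12
      · subst h12; exact small_12_3
      by_cases h15 : t = 15
      · subst h15; exact small_15_3
      exact good_red t 0 0 1 ((t + 3) / 4) (by omega) ht (by omega) (by omega)
        (by omega) (by omega) (by omega)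
    obtain ⟨Q, rfl⟩ : ∃ Q, p = 2 * Q + 2 + 1 := ⟨(p - 2) / 2, by omega⟩
    refine good_red t e Q 1 ((t + (2 * Q + 2 + 1)) / 4) (by omega) ht (by omega) (by omega)
      (by omega) (by omega) (by omega)
  · obtain ⟨Q, rfl⟩ : ∃ Q, p = 2 * Q + 2 + 1 := ⟨(p - 2) / 2, by omega⟩
    refine good_red t e Q 1 ((t + (2 * Q + 2 + 1)) / 4) (by omega) ht (by omega) (by omega)
      (by omega) (by omega) (by omega)
  · by_cases hx : t = 5 ∧ p = 2
    · obtain ⟨rfl, rfl⟩ := hx; subst he; exact small_5_2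
    by_cases hx' : t = 8 ∧ p = 2
    · obtain ⟨rfl, rfl⟩ := hx'; subst he; exact small_8_2
    obtain ⟨Q, rfl⟩ : ∃ Q, p = 2 * Q + 2 + 0 := ⟨(p - 2) / 2, by omega⟩
    refine good_red t e Q 0 ((t + (2 * Q + 2 + 0)) / 4) (by omega) ht (by omega) (by omega)
      (by omega) (by omega) (by omega)

lemma target_zero (m : ℕ) (hm : 1 ≤ m) : (target m 0 : Set ℕ) = Set.Icc 1 m := by
  ext k; simp [target]; omega

lemma target_one (m : ℕ) : (target m 1 : Set ℕ) = Set.Icc 1 (m - 1) ∪ {m + 1} := by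
  ext k; simp [target]

lemma good_graceful (t p : ℕ) (hp : 1 ≤ p) (h : Good t p 0) :
    IsGraceful (Windmill (LL t p)) (3 * t + 5 * p) := by
  obtain ⟨f, h1, h2, h3⟩ := h
  rw [target_zero _ (by omega)] at h3
  exact ⟨f, h1, h2, h3⟩

lemma good_near (t p : ℕ) (h : Good t p 1) :
    IsNearGraceful (Windmill (LL t p)) (3 * t + 5 * p) := by
  obtain ⟨f, h1, h2, h3⟩ := h
  rw [target_one] at h3
  exact ⟨f, h1, h2, Or.inr h3⟩

end WM

/-- Let `p ≥ 1` and `t ≥ 2p + 1`.  The variable windmill `C₃ᵗC₅ᵖ` (which has `3t + 5p`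
edges) is graceful when `p ≡ 0 (mod 4)` and `t ≡ 0, 1 (mod 4)`; graceful when
`p ≡ 3 (mod 4)` and `t ≡ 0, 3 (mod 4)`; near graceful when `p ≡ 1 (mod 4)` and
`t ≡ 0, 3 (mod 4)`; and near graceful when `p ≡ 2 (mod 4)` and `t ≡ 0, 1 (mod 4)`. -/
theorem C3C5_windmill_graceful (p t : ℕ) (hp : 1 ≤ p) (ht : 2 * p + 1 ≤ t) :
    (p % 4 = 0 ∧ (t % 4 = 0 ∨ t % 4 = 1) →
      IsGraceful (Windmill (List.replicate t 3 ++ List.replicate p 5)) (3 * t + 5 * p)) ∧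
    (p % 4 = 3 ∧ (t % 4 = 0 ∨ t % 4 = 3) →
      IsGraceful (Windmill (List.replicate t 3 ++ List.replicate p 5)) (3 * t + 5 * p)) ∧
    (p % 4 = 1 ∧ (t % 4 = 0 ∨ t % 4 = 3) →
      IsNearGraceful (Windmill (List.replicate t 3 ++ List.replicate p 5)) (3 * t + 5 * p)) ∧
    (p % 4 = 2 ∧ (t % 4 = 0 ∨ t % 4 = 1) →
      IsNearGraceful (Windmill (List.replicate t 3 ++ List.replicate p 5)) (3 * t + 5 * p)) := by
  refine ⟨fun h => ?_, fun h => ?_, fun h => ?_, fun h => ?_⟩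
  · exact WM.good_graceful t p hp (WM.good_main t p 0 (by omega) ht (by omega))
  · exact WM.good_graceful t p hp (WM.good_main t p 0 (by omega) ht (by omega))
  · by_cases h1 : p = 1
    · subst h1
      exact WM.good_near t 1 (WM.good_one t (by omega) h.2)
    · exact WM.good_near t p (WM.good_main t p 1 (by omega) ht (by omega))
  · exact WM.good_near t p (WM.good_main t p 1 (by omega) ht (by omega))
end

section
/- Let t ≥ 1 and h ≥ 1 be integers with h ≤ 2t+1. Then the variable windmill C_3^t C_6^h is graceful when t + 2h ≡ 0 or 1 (mod 4), and near graceful when t + 2h ≡ 2 or 3 (mod 4). -/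
/-- The `k`-th vertex on vane `i`, counted from the centre (`k = 0` and `k` = length are central). -/
def vaneVertex (L : List ℕ) (i : Fin L.length) (k : ℕ) : WindmillVertex L :=
  if hk : 1 ≤ k ∧ k - 1 < L.get i - 1 then some ⟨i, ⟨k - 1, hk.2⟩⟩ else none

theorem vaneVertex_some (L : List ℕ) (i : Fin L.length) (j : Fin (L.get i - 1)) :
    vaneVertex L i (j.val + 1) = some ⟨i, j⟩ := by
  have hj := j.isLt
  rw [vaneVertex, dif_pos ⟨by omega, by omega⟩]
  simp

theorem vaneVertex_none (L : List ℕ) (i : Fin L.length) (k : ℕ) (hk : k = 0 ∨ L.get i ≤ k) :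
    vaneVertex L i k = none := by
  rw [vaneVertex, dif_neg (by omega)]

theorem rel_edge_s7 (L : List ℕ) (hL : ∀ i : Fin L.length, 3 ≤ L.get i) (a b : WindmillVertex L)
    (hr : windmillRel L a b) :
    ∃ i : Fin L.length, ∃ k, k < L.get i ∧
      s(a, b) = s(vaneVertex L i k, vaneVertex L i (k + 1)) := by
  rcases a with _ | ⟨i, j⟩ <;> rcases b with _ | ⟨i', j'⟩
  · exact hr.elim
  · have h3 := hL i'
    rcases hr with h0 | h0
    · refine ⟨i', 0, by omega, ?_⟩
      have := vaneVertex_some L i' j'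
      rw [h0] at this
      rw [this, vaneVertex_none _ _ _ (Or.inl rfl)]
    · refine ⟨i', j'.val + 1, by omega, ?_⟩
      rw [vaneVertex_some, vaneVertex_none _ _ _ (Or.inr (by omega)), Sym2.eq_swap]
  · exact hr.elim
  · obtain ⟨h1, h2⟩ := hr
    have h1 : i = i' := Fin.ext h1
    subst h1
    refine ⟨i, j.val + 1, by have := j.isLt; omega, ?_⟩
    have := vaneVertex_some L i j'
    rw [h2] at this
    rw [vaneVertex_some, this]

theorem vane_edge_mem (L : List ℕ) (hL : ∀ i : Fin L.length, 3 ≤ L.get i) (i : Fin L.length)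
    (k : ℕ) (hk : k < L.get i) :
    s(vaneVertex L i k, vaneVertex L i (k + 1)) ∈ (Windmill L).edgeSet := by
  have h3 := hL i
  rw [SimpleGraph.mem_edgeSet, Windmill, SimpleGraph.fromRel_adj]
  rcases Nat.eq_zero_or_pos k with rfl | hpos
  · have h1 := vaneVertex_some L i ⟨0, by omega⟩
    rw [vaneVertex_none _ _ 0 (Or.inl rfl), h1]
    exact ⟨by simp, Or.inl (Or.inl rfl)⟩
  · obtain ⟨j, rfl⟩ : ∃ j, k = j + 1 := ⟨k - 1, by omega⟩
    have h1 := vaneVertex_some L i ⟨j, by omega⟩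
    dsimp only at h1
    rw [h1]
    by_cases hlast : j + 2 = L.get i
    · rw [vaneVertex_none _ _ _ (Or.inr (by omega))]
      exact ⟨by simp, Or.inr (Or.inr hlast)⟩
    · have h2 := vaneVertex_some L i ⟨j + 1, by omega⟩
      dsimp only at h2
      rw [h2]
      refine ⟨by simp, Or.inl ⟨rfl, rfl⟩⟩

/-- Reduction of the labelling problem for windmills to arithmetic: `g i k` is the label of the
`k`-th vertex of vane `i`. -/
theorem windmill_of_arith (L : List ℕ) (len : ℕ → ℕ) (N : ℕ) (S : Finset ℕ) (g : ℕ → ℕ → ℕ)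
    (hlen : ∀ i : Fin L.length, L.get i = len i) (h3 : ∀ i, 3 ≤ len i)
    (hcard : S.card = ∑ i ∈ Finset.range L.length, len i)
    (g0 : ∀ i < L.length, g i 0 = 0) (g1 : ∀ i < L.length, g i (len i) = 0)
    (hpos : ∀ i < L.length, ∀ k < len i, 1 ≤ k → 0 < g i k ∧ g i k ≤ N)
    (hinj : ∀ i < L.length, ∀ i' < L.length, ∀ k < len i, ∀ k' < len i', 1 ≤ k → 1 ≤ k' →
      g i k = g i' k' → i = i' ∧ k = k')
    (emem : ∀ i < L.length, ∀ k < len i, ((g i k : ℤ) - (g i (k + 1) : ℤ)).natAbs ∈ S)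
    (einj : ∀ i < L.length, ∀ i' < L.length, ∀ k < len i, ∀ k' < len i',
      ((g i k : ℤ) - (g i (k + 1) : ℤ)).natAbs = ((g i' k' : ℤ) - (g i' (k' + 1) : ℤ)).natAbs →
      i = i' ∧ k = k') :
    ∃ f : WindmillVertex L → ℕ, Function.Injective f ∧ (∀ v, f v ≤ N) ∧
      Set.BijOn (edgeLabel f) (Windmill L).edgeSet (S : Set ℕ) := by
  have hL : ∀ i : Fin L.length, 3 ≤ L.get i := fun i => by rw [hlen]; exact h3 _
  let f : WindmillVertex L → ℕ := fun v => match v with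
    | none => 0
    | some ⟨i, j⟩ => g i.val (j.val + 1)
  have fs : ∀ i j, f (some ⟨i, j⟩) = g i.val (j.val + 1) := fun _ _ => rfl
  have f0 : f none = 0 := rfl
  have fw : ∀ (i : Fin L.length) (k : ℕ), k ≤ L.get i → f (vaneVertex L i k) = g i.val k := by
    intro i k hk
    have h3' := hL i
    have hl := hlen i
    by_cases hk0 : k = 0
    · subst hk0
      rw [vaneVertex_none _ _ _ (Or.inl rfl), f0, g0 _ i.isLt]
    by_cases hk1 : k = L.get i
    · rw [vaneVertex_none _ _ _ (Or.inr (by omega)), f0, hk1, hl, g1 _ i.isLt]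
    obtain ⟨j, rfl⟩ : ∃ j, k = j + 1 := ⟨k - 1, by omega⟩
    have h1 := vaneVertex_some L i ⟨j, by omega⟩
    dsimp only at h1
    rw [h1, fs]
  have lab_eq : ∀ (i : Fin L.length) (k : ℕ), k < L.get i →
      edgeLabel f s(vaneVertex L i k, vaneVertex L i (k + 1)) =
        ((g i k : ℤ) - (g i (k + 1) : ℤ)).natAbs := by
    intro i k hk
    have : edgeLabel f s(vaneVertex L i k, vaneVertex L i (k + 1)) =
      ((f (vaneVertex L i k) : ℤ) - (f (vaneVertex L i (k + 1)) : ℤ)).natAbs := rfl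
    rw [this, fw _ _ (by omega), fw _ _ (by omega)]
  have edge : ∀ e ∈ (Windmill L).edgeSet, ∃ i : Fin L.length, ∃ k, k < L.get i ∧
      e = s(vaneVertex L i k, vaneVertex L i (k + 1)) := by
    intro e
    induction e using Sym2.ind with
    | _ a b =>
      intro he
      rw [SimpleGraph.mem_edgeSet, Windmill, SimpleGraph.fromRel_adj] at he
      rcases he.2 with h | h
      · exact rel_edge_s7 L hL a b h
      · rw [Sym2.eq_swap]
        exact rel_edge_s7 L hL b a h
  refine ⟨f, ?_, ?_, ?_, ?_, ?_⟩
  · intro a b hab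
    rcases a with _ | ⟨i, j⟩ <;> rcases b with _ | ⟨i', j'⟩
    · rfl
    · rw [f0, fs] at hab
      have := hlen i'
      have := hpos i' i'.isLt (j'.val + 1) (by have := j'.isLt; omega) (by omega)
      omega
    · rw [f0, fs] at hab
      have := hlen i
      have := hpos i i.isLt (j.val + 1) (by have := j.isLt; omega) (by omega)
      omega
    · rw [fs, fs] at hab
      have h1 := hlen i
      have h2 := hlen i'
      obtain ⟨e1, e2⟩ := hinj i i.isLt i' i'.isLt (j.val + 1) (by have := j.isLt; omega)
        (j'.val + 1) (by have := j'.isLt; omega) (by omega) (by omega) hab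
      have e1 : i = i' := Fin.ext e1
      subst e1
      have e2 : j = j' := Fin.ext (by omega)
      rw [e2]
  · intro v
    rcases v with _ | ⟨i, j⟩
    · rw [f0]; exact Nat.zero_le _
    · rw [fs]
      have := hlen i
      exact (hpos i i.isLt (j.val + 1) (by have := j.isLt; omega) (by omega)).2
  · intro e he
    obtain ⟨i, k, hk, rfl⟩ := edge e he
    rw [lab_eq i k hk]
    have := hlen i
    exact emem i i.isLt k (by omega)
  · intro e he e' he' h
    obtain ⟨i, k, hk, rfl⟩ := edge e he
    obtain ⟨i', k', hk', rfl⟩ := edge e' he'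
    rw [lab_eq i k hk, lab_eq i' k' hk'] at h
    have h1 := hlen i
    have h2 := hlen i'
    obtain ⟨e1, e2⟩ := einj i i.isLt i' i'.isLt k (by omega) k' (by omega) h
    have e1 : i = i' := Fin.ext e1
    subst e1
    rw [e2]
  · intro y hy
    let D : Finset (Σ _ : ℕ, ℕ) := (Finset.range L.length).sigma (fun i => Finset.range (len i))
    have hD : D.card = S.card := by
      rw [hcard, Finset.card_sigma]; simp
    obtain ⟨⟨i, k⟩, hx, hxy⟩ := Finset.surj_on_of_inj_on_of_card_le (s := D) (t := S)
      (fun x _ => ((g x.1 x.2 : ℤ) - (g x.1 (x.2 + 1) : ℤ)).natAbs)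
      (by
        intro x hx
        simp only [D, Finset.mem_sigma, Finset.mem_range] at hx
        exact emem _ hx.1 _ hx.2)
      (by
        rintro ⟨i, k⟩ ⟨i', k'⟩ hx hx' h
        simp only [D, Finset.mem_sigma, Finset.mem_range] at hx hx'
        obtain ⟨e1, e2⟩ := einj _ hx.1 _ hx'.1 _ hx.2 _ hx'.2 h
        subst e1; subst e2; rfl)
      (le_of_eq hD.symm) y hy
    simp only [D, Finset.mem_sigma, Finset.mem_range] at hx
    have hl := hlen ⟨i, hx.1⟩
    refine ⟨_, vane_edge_mem L hL ⟨i, hx.1⟩ k (by rw [hl]; exact hx.2), ?_⟩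
    rw [lab_eq _ _ (by rw [hl]; exact hx.2)]
    exact hxy.symm

/-- Specialisation to `C₃ᵗC₆ʰ`. -/
theorem c3c6_of_arith (t h N : ℕ) (S : Finset ℕ) (g : ℕ → ℕ → ℕ)
    (hcard : S.card = 3 * t + 6 * h)
    (g0 : ∀ i < t + h, g i 0 = 0) (g1 : ∀ i < t + h, g i (if i < t then 3 else 6) = 0)
    (hpos : ∀ i < t + h, ∀ k < (if i < t then 3 else 6), 1 ≤ k → 0 < g i k ∧ g i k ≤ N)
    (hinj : ∀ i < t + h, ∀ i' < t + h, ∀ k < (if i < t then 3 else 6),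
      ∀ k' < (if i' < t then 3 else 6), 1 ≤ k → 1 ≤ k' → g i k = g i' k' → i = i' ∧ k = k')
    (emem : ∀ i < t + h, ∀ k < (if i < t then 3 else 6),
      ((g i k : ℤ) - (g i (k + 1) : ℤ)).natAbs ∈ S)
    (einj : ∀ i < t + h, ∀ i' < t + h, ∀ k < (if i < t then 3 else 6),
      ∀ k' < (if i' < t then 3 else 6),
      ((g i k : ℤ) - (g i (k + 1) : ℤ)).natAbs = ((g i' k' : ℤ) - (g i' (k' + 1) : ℤ)).natAbs →
      i = i' ∧ k = k') :
    ∃ f : WindmillVertex (List.replicate t 3 ++ List.replicate h 6) → ℕ,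
      Function.Injective f ∧ (∀ v, f v ≤ N) ∧
      Set.BijOn (edgeLabel f) (Windmill (List.replicate t 3 ++ List.replicate h 6)).edgeSet
        (S : Set ℕ) := by
  have hlength : (List.replicate t 3 ++ List.replicate h 6).length = t + h := by simp
  apply windmill_of_arith _ (fun i => if i < t then 3 else 6) N S g
  · intro i
    simp [List.getElem_append]
  · intro i
    split_ifs <;> omega
  · rw [hcard, hlength, Finset.sum_range_add]
    rw [Finset.sum_congr rfl (g := fun _ => 3)]
    · simp; ring
    · intro i hi
      simp at hi
      simp [hi]
  all_goals rw [hlength]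
  all_goals assumption

/-- The three edge labels coming from the difference `d` of a Skolem-type sequence whose pairs
are `(P d, P d + d)`. -/
def tokenVal (P : ℕ → ℕ) (x : ℕ × ℕ) : ℕ :=
  if x.2 = 0 then x.1 else if x.2 = 1 then P x.1 else P x.1 + x.1

/-- Token of the `k`-th vertex of a vane (`k ≥ 1`). -/
def vertexToken (t h : ℕ) (r x b : ℕ → ℕ) (i k : ℕ) : ℕ × ℕ :=
  if i < t then (r i, k) else
    if k = 1 then (x (i - t + 1), 3 - b (i - t + 1)) else
    if k = 2 then (x (i - t + 1), b (i - t + 1)) else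
    if k = 3 then (2 * (h - (i - t)), 1) else
    if k = 4 then (2 * (i - t + 1), 0) else (2 * (i - t + 1), 2)

/-- Token of the `k`-th edge of a vane. -/
def edgeToken (t : ℕ) (r x b : ℕ → ℕ) (i k : ℕ) : ℕ × ℕ :=
  if i < t then (if k = 0 then (r i, 1) else if k = 1 then (r i, 0) else (r i, 2)) else
    if k = 0 then (x (i - t + 1), 3 - b (i - t + 1)) else
    if k = 1 then (x (i - t + 1), 0) else
    if k = 2 then (2 * (i - t + 1), 0) else
    if k = 3 then (x (i - t + 1), b (i - t + 1)) else
    if k = 4 then (2 * (i - t + 1), 1) else (2 * (i - t + 1), 2)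

theorem vertexToken_inj (t h : ℕ) (r x b : ℕ → ℕ)
    (hr : ∀ i < t, ∀ j < t, r i = r j → i = j)
    (hx : ∀ u v, 1 ≤ u → u ≤ h → 1 ≤ v → v ≤ h → x u = x v → u = v)
    (hb : ∀ u, 1 ≤ u → u ≤ h → b u = 1 ∨ b u = 2)
    (hrx : ∀ i < t, ∀ u, 1 ≤ u → u ≤ h → r i ≠ x u)
    (hr2 : ∀ i < t, ∀ u, 1 ≤ u → u ≤ h → r i ≠ 2 * u)
    (hx2 : ∀ u v, 1 ≤ u → u ≤ h → 1 ≤ v → v ≤ h → x u ≠ 2 * v)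
    (i : ℕ) (hi : i < t + h) (i' : ℕ) (hi' : i' < t + h)
    (k : ℕ) (hk : k < if i < t then 3 else 6) (k' : ℕ) (hk' : k' < if i' < t then 3 else 6)
    (h1 : 1 ≤ k) (h1' : 1 ≤ k')
    (he : vertexToken t h r x b i k = vertexToken t h r x b i' k') : i = i' ∧ k = k' := by
  unfold vertexToken at he
  by_cases hit : i < t <;> by_cases hit' : i' < t
  · simp only [hit, hit', if_true, Prod.mk.injEq] at he
    exact ⟨hr i hit i' hit' he.1, he.2⟩
  · have q1 := hrx i hit (i' - t + 1) (by omega) (by omega)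
    have q2 := hr2 i hit (i' - t + 1) (by omega) (by omega)
    have q3 := hr2 i hit (h - (i' - t)) (by omega) (by omega)
    simp only [hit, hit', if_true, if_false] at he
    split_ifs at he <;> rw [Prod.mk.injEq] at he <;> omega
  · have q1 := hrx i' hit' (i - t + 1) (by omega) (by omega)
    have q2 := hr2 i' hit' (i - t + 1) (by omega) (by omega)
    have q3 := hr2 i' hit' (h - (i - t)) (by omega) (by omega)
    simp only [hit, hit', if_true, if_false] at he
    split_ifs at he <;> rw [Prod.mk.injEq] at he <;> omega
  · have q1 := hx2 (i - t + 1) (i' - t + 1) (by omega) (by omega) (by omega) (by omega)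
    have q2 := hx2 (i' - t + 1) (i - t + 1) (by omega) (by omega) (by omega) (by omega)
    have q3 := hx2 (i - t + 1) (h - (i' - t)) (by omega) (by omega) (by omega) (by omega)
    have q4 := hx2 (i' - t + 1) (h - (i - t)) (by omega) (by omega) (by omega) (by omega)
    have q5 := hx (i - t + 1) (i' - t + 1) (by omega) (by omega) (by omega) (by omega)
    have q6 := hb (i - t + 1) (by omega) (by omega)
    have q7 := hb (i' - t + 1) (by omega) (by omega)
    have q8 : i = i' → b (i - t + 1) = b (i' - t + 1) := fun h => by rw [h]
    simp only [hit, hit', if_false] at he hk hk'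
    split_ifs at he <;> rw [Prod.mk.injEq] at he <;> omega

theorem edgeToken_inj (t h : ℕ) (r x b : ℕ → ℕ)
    (hr : ∀ i < t, ∀ j < t, r i = r j → i = j)
    (hx : ∀ u v, 1 ≤ u → u ≤ h → 1 ≤ v → v ≤ h → x u = x v → u = v)
    (hb : ∀ u, 1 ≤ u → u ≤ h → b u = 1 ∨ b u = 2)
    (hrx : ∀ i < t, ∀ u, 1 ≤ u → u ≤ h → r i ≠ x u)
    (hr2 : ∀ i < t, ∀ u, 1 ≤ u → u ≤ h → r i ≠ 2 * u)
    (hx2 : ∀ u v, 1 ≤ u → u ≤ h → 1 ≤ v → v ≤ h → x u ≠ 2 * v)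
    (i : ℕ) (hi : i < t + h) (i' : ℕ) (hi' : i' < t + h)
    (k : ℕ) (hk : k < if i < t then 3 else 6) (k' : ℕ) (hk' : k' < if i' < t then 3 else 6)
    (he : edgeToken t r x b i k = edgeToken t r x b i' k') : i = i' ∧ k = k' := by
  unfold edgeToken at he
  by_cases hit : i < t <;> by_cases hit' : i' < t
  · have q := hr i hit i' hit'
    simp only [hit, hit', if_true] at he hk hk'
    split_ifs at he <;> rw [Prod.mk.injEq] at he <;> omega
  · have q1 := hrx i hit (i' - t + 1) (by omega) (by omega)
    have q2 := hr2 i hit (i' - t + 1) (by omega) (by omega)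
    simp only [hit, hit', if_true, if_false] at he
    split_ifs at he <;> rw [Prod.mk.injEq] at he <;> omega
  · have q1 := hrx i' hit' (i - t + 1) (by omega) (by omega)
    have q2 := hr2 i' hit' (i - t + 1) (by omega) (by omega)
    simp only [hit, hit', if_true, if_false] at he
    split_ifs at he <;> rw [Prod.mk.injEq] at he <;> omega
  · have q1 := hx2 (i - t + 1) (i' - t + 1) (by omega) (by omega) (by omega) (by omega)
    have q2 := hx2 (i' - t + 1) (i - t + 1) (by omega) (by omega) (by omega) (by omega)
    have q5 := hx (i - t + 1) (i' - t + 1) (by omega) (by omega) (by omega) (by omega)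
    have q6 := hb (i - t + 1) (by omega) (by omega)
    have q7 := hb (i' - t + 1) (by omega) (by omega)
    have q8 : i = i' → b (i - t + 1) = b (i' - t + 1) := fun h => by rw [h]
    simp only [hit, hit', if_false] at he hk hk'
    split_ifs at he <;> rw [Prod.mk.injEq] at he <;> omega

/-- Construction of a labelling of `C₃ᵗC₆ʰ` from a Skolem-type sequence of order `n = t + 2h`
with label set `S`, in which the pairs of differences `2, 4, …, 2h` are nested around `M`. -/
theorem labelling_of_skolem (t h n N M : ℕ) (hn : n = t + 2 * h) (S : Finset ℕ) (P : ℕ → ℕ)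
    (hS : S.card = 3 * n) (hSN : ∀ y ∈ S, 1 ≤ y ∧ y ≤ N) (hSn : ∀ y, 1 ≤ y → y ≤ n → y ∈ S)
    (p1 : ∀ d, 1 ≤ d → d ≤ n → n < P d ∧ P d ∈ S ∧ P d + d ∈ S)
    (p2 : ∀ d d', 1 ≤ d → d ≤ n → 1 ≤ d' → d' ≤ n →
      (P d = P d' → d = d') ∧ (P d + d = P d' + d' → d = d') ∧ P d ≠ P d' + d')
    (p3 : ∀ u, 1 ≤ u → u ≤ h → P (2 * u) + u = M)
    (p4 : n + 2 * h + 1 < M) (p5 : ∀ u, 1 ≤ u → u ≤ h → M - (1 + h + u) ∈ S)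
    (p6 : ∀ d, 1 ≤ d → d ≤ n → M ≤ P d + 2 * h + 1 → M < P d + d + h + 2) :
    ∃ f : WindmillVertex (List.replicate t 3 ++ List.replicate h 6) → ℕ,
      Function.Injective f ∧ (∀ v, f v ≤ N) ∧
      Set.BijOn (edgeLabel f) (Windmill (List.replicate t 3 ++ List.replicate h 6)).edgeSet
        (S : Set ℕ) := by
  classical
  -- tokens are in bijection with `S`
  have Tmem : ∀ d c, 1 ≤ d → d ≤ n → tokenVal P (d, c) ∈ S := by
    intro d c h1 h2
    have := p1 d h1 h2
    unfold tokenVal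
    dsimp only
    split_ifs
    · exact hSn d h1 h2
    · exact this.2.1
    · exact this.2.2
  have Tinj : ∀ d c d' c', 1 ≤ d → d ≤ n → 1 ≤ d' → d' ≤ n → c < 3 → c' < 3 →
      tokenVal P (d, c) = tokenVal P (d', c') → d = d' ∧ c = c' := by
    intro d c d' c' h1 h2 h1' h2' hc hc' he
    have a1 := p1 d h1 h2
    have a2 := p1 d' h1' h2'
    have a3 := p2 d d' h1 h2 h1' h2'
    have a4 := p2 d' d h1' h2' h1 h2
    unfold tokenVal at he
    dsimp only at he
    split_ifs at he <;> omega
  have Tsurj : ∀ y ∈ S, ∃ d c, 1 ≤ d ∧ d ≤ n ∧ c < 3 ∧ y = tokenVal P (d, c) := by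
    intro y hy
    obtain ⟨⟨d, c⟩, hx, hxy⟩ := Finset.surj_on_of_inj_on_of_card_le
      (s := Finset.Icc 1 n ×ˢ Finset.range 3) (t := S)
      (fun x _ => tokenVal P x)
      (by
        rintro ⟨d, c⟩ hx
        simp only [Finset.mem_product, Finset.mem_Icc, Finset.mem_range] at hx
        exact Tmem d c hx.1.1 hx.1.2)
      (by
        rintro ⟨d, c⟩ ⟨d', c'⟩ hx hx' he
        simp only [Finset.mem_product, Finset.mem_Icc, Finset.mem_range] at hx hx'
        obtain ⟨e1, e2⟩ := Tinj d c d' c' hx.1.1 hx.1.2 hx'.1.1 hx'.1.2 hx.2 hx'.2 he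
        rw [e1, e2])
      (by rw [hS]; simp; omega) y hy
    simp only [Finset.mem_product, Finset.mem_Icc, Finset.mem_range] at hx
    exact ⟨d, c, hx.1.1, hx.1.2, hx.2, hxy⟩
  -- the partners of the hexagons
  have xb : ∀ u, ∃ d c, 1 ≤ u → u ≤ h → (1 ≤ d ∧ d ≤ n ∧ (c = 1 ∨ c = 2) ∧
      M = tokenVal P (d, c) + (1 + h + u)) := by
    intro u
    by_cases hu : 1 ≤ u ∧ u ≤ h
    · obtain ⟨d, c, h1, h2, h3, h4⟩ := Tsurj _ (p5 u hu.1 hu.2)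
      refine ⟨d, c, fun _ _ => ⟨h1, h2, ?_, by omega⟩⟩
      by_contra hc
      have : c = 0 := by omega
      subst this
      simp [tokenVal] at h4
      omega
    · exact ⟨0, 0, fun a b => absurd ⟨a, b⟩ hu⟩
  choose x b hxb using xb
  have hxval : ∀ u, 1 ≤ u → u ≤ h → (b u = 1 ∧ M = P (x u) + (1 + h + u)) ∨
      (b u = 2 ∧ M = P (x u) + x u + (1 + h + u)) := by
    intro u h1 h2
    obtain ⟨_, _, hc, he⟩ := hxb u h1 h2
    rcases hc with hc | hc
    · left; refine ⟨hc, ?_⟩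
      rw [hc] at he; simpa [tokenVal] using he
    · right; refine ⟨hc, ?_⟩
      rw [hc] at he; simpa [tokenVal] using he
  have hx : ∀ u v, 1 ≤ u → u ≤ h → 1 ≤ v → v ≤ h → x u = x v → u = v := by
    intro u v h1 h2 h1' h2' he
    have a := hxval u h1 h2
    have a' := hxval v h1' h2'
    have c := hxb u h1 h2
    have q := p6 (x u) c.1 c.2.1
    rw [← he] at a'
    omega
  have hx2 : ∀ u v, 1 ≤ u → u ≤ h → 1 ≤ v → v ≤ h → x u ≠ 2 * v := by
    intro u v h1 h2 h1' h2' he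
    have a := hxval u h1 h2
    have c := p3 v h1' h2'
    rw [he] at a
    omega
  have hb : ∀ u, 1 ≤ u → u ≤ h → b u = 1 ∨ b u = 2 := fun u h1 h2 => (hxb u h1 h2).2.2.1
  -- enumeration of the triangles
  let I := Finset.Icc 1 h
  let R := (Finset.Icc 1 n) \ (I.image x ∪ I.image (fun u => 2 * u))
  have hR : R.card = t := by
    have c1 : (I.image x).card = h := by
      rw [Finset.card_image_of_injOn]
      · simp [I]
      · intro u hu v hv he
        simp only [I, Finset.coe_Icc, Set.mem_Icc] at hu hv
        exact hx u v hu.1 hu.2 hv.1 hv.2 he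
    have c2 : (I.image (fun u => 2 * u)).card = h := by
      rw [Finset.card_image_of_injOn]
      · simp [I]
      · intro u hu v hv he
        dsimp only at he
        omega
    have c3 : Disjoint (I.image x) (I.image (fun u => 2 * u)) := by
      rw [Finset.disjoint_left]
      intro a ha hb
      simp only [Finset.mem_image, I, Finset.mem_Icc] at ha hb
      obtain ⟨u, hu, rfl⟩ := ha
      obtain ⟨v, hv, he⟩ := hb
      exact hx2 u v hu.1 hu.2 hv.1 hv.2 he.symm
    have c4 : I.image x ∪ I.image (fun u => 2 * u) ⊆ Finset.Icc 1 n := by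
      intro a ha
      simp only [Finset.mem_union, Finset.mem_image, I, Finset.mem_Icc] at ha ⊢
      rcases ha with ⟨u, hu, rfl⟩ | ⟨u, hu, rfl⟩
      · have := hxb u hu.1 hu.2
        exact ⟨this.1, this.2.1⟩
      · omega
    rw [Finset.card_sdiff_of_subset c4, Finset.card_union_of_disjoint c3, c1, c2]
    simp; omega
  let re := (Finset.equivFinOfCardEq hR).symm
  let r : ℕ → ℕ := fun i => if hi : i < t then (re ⟨i, hi⟩ : ℕ) else 0
  have rR : ∀ i < t, r i ∈ R := by
    intro i hi
    simp only [r, dif_pos hi]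
    exact (re ⟨i, hi⟩).2
  have hr : ∀ i < t, ∀ j < t, r i = r j → i = j := by
    intro i hi j hj he
    simp only [r, dif_pos hi, dif_pos hj] at he
    have := re.injective (Subtype.ext he)
    simpa using this
  have r1 : ∀ i < t, 1 ≤ r i ∧ r i ≤ n := by
    intro i hi
    have := rR i hi
    simp only [R, Finset.mem_sdiff, Finset.mem_Icc] at this
    exact this.1
  have hrx : ∀ i < t, ∀ u, 1 ≤ u → u ≤ h → r i ≠ x u := by
    intro i hi u h1 h2 he
    have := rR i hi
    simp only [R, Finset.mem_sdiff, Finset.mem_union, Finset.mem_image, I, Finset.mem_Icc] at this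
    exact this.2 (Or.inl ⟨u, ⟨h1, h2⟩, he.symm⟩)
  have hr2 : ∀ i < t, ∀ u, 1 ≤ u → u ≤ h → r i ≠ 2 * u := by
    intro i hi u h1 h2 he
    have := rR i hi
    simp only [R, Finset.mem_sdiff, Finset.mem_union, Finset.mem_image, I, Finset.mem_Icc] at this
    exact this.2 (Or.inr ⟨u, ⟨h1, h2⟩, he.symm⟩)
  let g : ℕ → ℕ → ℕ := fun i k =>
    if k = 0 ∨ k = (if i < t then 3 else 6) then 0 else tokenVal P (vertexToken t h r x b i k)
  have vrange : ∀ i < t + h, ∀ k < (if i < t then 3 else 6), 1 ≤ k →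
      ∃ d c, vertexToken t h r x b i k = (d, c) ∧ 1 ≤ d ∧ d ≤ n ∧ c < 3 := by
    intro i hi k hk h1
    refine ⟨(vertexToken t h r x b i k).1, (vertexToken t h r x b i k).2, rfl, ?_⟩
    unfold vertexToken
    by_cases hit : i < t
    · have := r1 i hit
      simp only [hit, if_true] at hk ⊢
      omega
    · have q1 := hb (i - t + 1) (by omega) (by omega)
      have q2 := hxb (i - t + 1) (by omega) (by omega)
      simp only [hit, if_false] at hk ⊢
      split_ifs <;> dsimp only <;> omega
  have erange : ∀ i < t + h, ∀ k < (if i < t then 3 else 6),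
      ∃ d c, edgeToken t r x b i k = (d, c) ∧ 1 ≤ d ∧ d ≤ n ∧ c < 3 := by
    intro i hi k hk
    refine ⟨(edgeToken t r x b i k).1, (edgeToken t r x b i k).2, rfl, ?_⟩
    unfold edgeToken
    by_cases hit : i < t
    · have := r1 i hit
      simp only [hit, if_true] at hk ⊢
      split_ifs <;> dsimp only <;> omega
    · have q1 := hb (i - t + 1) (by omega) (by omega)
      have q2 := hxb (i - t + 1) (by omega) (by omega)
      simp only [hit, if_false] at hk ⊢
      split_ifs <;> dsimp only <;> omega
  have gv : ∀ i, ∀ k < (if i < t then 3 else 6), 1 ≤ k →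
      g i k = tokenVal P (vertexToken t h r x b i k) := by
    intro i k hk h1
    simp only [g]
    rw [if_neg (by omega)]
  have ev : ∀ i < t + h, ∀ k < (if i < t then 3 else 6),
      ((g i k : ℤ) - (g i (k + 1) : ℤ)).natAbs = tokenVal P (edgeToken t r x b i k) := by
    intro i hi k hk
    by_cases hit : i < t
    · have := r1 i hit
      simp only [hit, if_true] at hk
      interval_cases k <;> (simp [g, hit, vertexToken, edgeToken, tokenVal]; try omega)
    · have q1 := hb (i - t + 1) (by omega) (by omega)
      have q2 := hxb (i - t + 1) (by omega) (by omega)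
      have q3 := hxval (i - t + 1) (by omega) (by omega)
      have q4 := p3 (i - t + 1) (by omega) (by omega)
      have q5 := p3 (h - (i - t)) (by omega) (by omega)
      simp only [hit, if_false] at hk
      rcases q3 with ⟨e1, e2⟩ | ⟨e1, e2⟩ <;>
      interval_cases k <;> simp [g, hit, vertexToken, edgeToken, tokenVal, e1] <;> omega
  refine c3c6_of_arith t h N S g ?_ ?_ ?_ ?_ ?_ ?_ ?_
  · omega
  · intro i _; simp [g]
  · intro i _; simp [g]
  · intro i hi k hk h1
    rw [gv i k hk h1]
    obtain ⟨d, c, e, a1, a2, a3⟩ := vrange i hi k hk h1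
    rw [e]
    exact hSN _ (Tmem d c a1 a2)
  · intro i hi i' hi' k hk k' hk' h1 h1' he
    rw [gv i k hk h1, gv i' k' hk' h1'] at he
    obtain ⟨d, c, e, a1, a2, a3⟩ := vrange i hi k hk h1
    obtain ⟨d', c', e', a1', a2', a3'⟩ := vrange i' hi' k' hk' h1'
    rw [e, e'] at he
    obtain ⟨f1, f2⟩ := Tinj d c d' c' a1 a2 a1' a2' a3 a3' he
    exact vertexToken_inj t h r x b hr hx hb hrx hr2 hx2 i hi i' hi' k hk k' hk' h1 h1'
      (by rw [e, e', f1, f2])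
  · intro i hi k hk
    rw [ev i hi k hk]
    obtain ⟨d, c, e, a1, a2, a3⟩ := erange i hi k hk
    rw [e]
    exact Tmem d c a1 a2
  · intro i hi i' hi' k hk k' hk' he
    rw [ev i hi k hk, ev i' hi' k' hk'] at he
    obtain ⟨d, c, e, a1, a2, a3⟩ := erange i hi k hk
    obtain ⟨d', c', e', a1', a2', a3'⟩ := erange i' hi' k' hk'
    rw [e, e'] at he
    obtain ⟨f1, f2⟩ := Tinj d c d' c' a1 a2 a1' a2' a3 a3' he
    exact edgeToken_inj t h r x b hr hx hb hrx hr2 hx2 i hi i' hi' k hk k' hk'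
      (by rw [e, e', f1, f2])

/-- Left ends of a (hooked) Skolem sequence of order `4 * s`, indexed by the difference. -/
def skolemPos0 (s d : ℕ) : ℕ :=
  if d = 1 then s else
  if d = 2 * s - 1 then 2 * s else
  if d = 4 * s - 1 then 2 * s + 1 else
  if d % 2 = 0 then 6 * s - d / 2 else
  if 2 * s + 1 ≤ d then (4 * s - 1 - d) / 2 else (4 * s + 1 - d) / 2

theorem skolemPos0_spec (s : ℕ) (hs : 2 ≤ s) : ∀ d, 1 ≤ d → d ≤ 4 * s →
      (d % 2 = 0 ∧ d ≤ 4 * s ∧ 2 * skolemPos0 s d + d = 2 * (6 * s)) ∨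
      (d = 1 ∧ skolemPos0 s d = s) ∨
      (d = 2 * s - 1 ∧ skolemPos0 s d = 2 * s) ∨
      (d = 4 * s - 1 ∧ skolemPos0 s d = 2 * s + 1) ∨
      (d % 2 = 1 ∧ 2 * s + 1 ≤ d ∧ d ≤ 4 * s - 3 ∧ 2 * skolemPos0 s d + d = 4 * s - 1) ∨
      (d % 2 = 1 ∧ 3 ≤ d ∧ d ≤ 2 * s - 3 ∧ 2 * skolemPos0 s d + d = 4 * s + 1) := by
  intro d h1 h2
  unfold skolemPos0
  split_ifs
  · right; left; refine ⟨?_, ?_⟩ <;> omega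
  · right; right; left; refine ⟨?_, ?_⟩ <;> omega
  · right; right; right; left; refine ⟨?_, ?_⟩ <;> omega
  · left; refine ⟨?_, ?_, ?_⟩ <;> omega
  · right; right; right; right; left; refine ⟨?_, ?_, ?_, ?_⟩ <;> omega
  · right; right; right; right; right; refine ⟨?_, ?_, ?_, ?_⟩ <;> omega

set_option maxHeartbeats 1000000 in
theorem skolem_case0 (t h s : ℕ) (hs : 2 ≤ s) (hn : t + 2 * h = 4 * s) (hh : h ≤ 2 * s - 1) :
    ∃ f : WindmillVertex (List.replicate t 3 ++ List.replicate h 6) → ℕ,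
      Function.Injective f ∧ (∀ v, f v ≤ 12 * s) ∧
      Set.BijOn (edgeLabel f) (Windmill (List.replicate t 3 ++ List.replicate h 6)).edgeSet
        ((Finset.Icc 1 (12 * s) : Finset ℕ) : Set ℕ) := by
  have spec := skolemPos0_spec s hs
  have even : ∀ u, 1 ≤ u → u ≤ h → skolemPos0 s (2 * u) + u = 6 * s := by
    intro u h1 h2
    have := spec (2 * u) (by omega) (by omega)
    omega
  refine labelling_of_skolem t h (4 * s) _ (4 * s + 6 * s) hn.symm _
    (fun d => 4 * s + skolemPos0 s d) ?_ ?_ ?_ ?_ ?_ ?_ ?_ ?_ ?_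
  · simp; omega
  · intro y hy
    simp only [Finset.mem_Icc] at hy
    omega
  · intro y h1 h2
    simp only [Finset.mem_Icc]
    omega
  · intro d h1 h2
    have := spec d h1 h2
    simp only [Finset.mem_Icc]
    omega
  · intro d d' h1 h2 h1' h2'
    have a := spec d h1 h2
    have b := spec d' h1' h2'
    generalize skolemPos0 s d = p at *
    generalize skolemPos0 s d' = p' at *
    clear spec even
    refine ⟨?_, ?_, ?_⟩ <;> rcases a with h | h | h | h | h | h <;> rcases b with h | h | h | h | h | h <;> omega
  · intro u h1 h2
    have := even u h1 h2
    omega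
  · omega
  · intro u h1 h2
    simp only [Finset.mem_Icc]
    omega
  · intro d h1 h2
    have := spec d h1 h2
    omega

/-- Left ends of a (hooked) Skolem sequence of order `4 * s + 1`, indexed by the difference. -/
def skolemPos1 (s d : ℕ) : ℕ :=
  if d = 1 then s + 1 else
  if d = 2 * s - 1 then 2 * s + 2 else
  if d = 4 * s + 1 then 2 * s + 1 else
  if d % 2 = 0 then 6 * s + 2 - d / 2 else
  if 2 * s + 1 ≤ d then (4 * s + 1 - d) / 2 else (4 * s + 3 - d) / 2

theorem skolemPos1_spec (s : ℕ) (hs : 2 ≤ s) : ∀ d, 1 ≤ d → d ≤ 4 * s + 1 →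
      (d % 2 = 0 ∧ d ≤ 4 * s ∧ 2 * skolemPos1 s d + d = 2 * (6 * s + 2)) ∨
      (d = 1 ∧ skolemPos1 s d = s + 1) ∨
      (d = 2 * s - 1 ∧ skolemPos1 s d = 2 * s + 2) ∨
      (d = 4 * s + 1 ∧ skolemPos1 s d = 2 * s + 1) ∨
      (d % 2 = 1 ∧ 2 * s + 1 ≤ d ∧ d ≤ 4 * s - 1 ∧ 2 * skolemPos1 s d + d = 4 * s + 1) ∨
      (d % 2 = 1 ∧ 3 ≤ d ∧ d ≤ 2 * s - 3 ∧ 2 * skolemPos1 s d + d = 4 * s + 3) := by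
  intro d h1 h2
  unfold skolemPos1
  split_ifs
  · right; left; refine ⟨?_, ?_⟩ <;> omega
  · right; right; left; refine ⟨?_, ?_⟩ <;> omega
  · right; right; right; left; refine ⟨?_, ?_⟩ <;> omega
  · left; refine ⟨?_, ?_, ?_⟩ <;> omega
  · right; right; right; right; left; refine ⟨?_, ?_, ?_, ?_⟩ <;> omega
  · right; right; right; right; right; refine ⟨?_, ?_, ?_, ?_⟩ <;> omega

set_option maxHeartbeats 1000000 in
theorem skolem_case1 (t h s : ℕ) (hs : 2 ≤ s) (hn : t + 2 * h = 4 * s + 1) (hh : h ≤ 2 * s - 1) :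
    ∃ f : WindmillVertex (List.replicate t 3 ++ List.replicate h 6) → ℕ,
      Function.Injective f ∧ (∀ v, f v ≤ 12 * s + 3) ∧
      Set.BijOn (edgeLabel f) (Windmill (List.replicate t 3 ++ List.replicate h 6)).edgeSet
        ((Finset.Icc 1 (12 * s + 3) : Finset ℕ) : Set ℕ) := by
  have spec := skolemPos1_spec s hs
  have even : ∀ u, 1 ≤ u → u ≤ h → skolemPos1 s (2 * u) + u = 6 * s + 2 := by
    intro u h1 h2
    have := spec (2 * u) (by omega) (by omega)
    omega
  refine labelling_of_skolem t h (4 * s + 1) _ (4 * s + 1 + 6 * s + 2) hn.symm _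
    (fun d => 4 * s + 1 + skolemPos1 s d) ?_ ?_ ?_ ?_ ?_ ?_ ?_ ?_ ?_
  · simp; omega
  · intro y hy
    simp only [Finset.mem_Icc] at hy
    omega
  · intro y h1 h2
    simp only [Finset.mem_Icc]
    omega
  · intro d h1 h2
    have := spec d h1 h2
    simp only [Finset.mem_Icc]
    omega
  · intro d d' h1 h2 h1' h2'
    have a := spec d h1 h2
    have b := spec d' h1' h2'
    generalize skolemPos1 s d = p at *
    generalize skolemPos1 s d' = p' at *
    clear spec even
    refine ⟨?_, ?_, ?_⟩ <;> rcases a with h | h | h | h | h | h <;> rcases b with h | h | h | h | h | h <;> omega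
  · intro u h1 h2
    have := even u h1 h2
    omega
  · omega
  · intro u h1 h2
    simp only [Finset.mem_Icc]
    omega
  · intro d h1 h2
    have := spec d h1 h2
    omega

/-- Left ends of a (hooked) Skolem sequence of order `4 * s + 2`, indexed by the difference. -/
def skolemPos2 (s d : ℕ) : ℕ :=
  if d = 4 * s + 2 then 1 else
  if d = 4 * s + 1 then 4 * s + 4 else
  if d = 4 * s then 2 * s + 4 else
  if d = 2 * s + 1 then 2 else
  if d = 1 then s + 2 else
  if d % 2 = 0 then 6 * s + 4 - d / 2 else
  if 2 * s + 3 ≤ d then (4 * s + 5 - d) / 2 else (4 * s + 7 - d) / 2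

theorem skolemPos2_spec (s : ℕ) (hs : 1 ≤ s) : ∀ d, 1 ≤ d → d ≤ 4 * s + 2 →
      (d % 2 = 0 ∧ d ≤ 4 * s - 2 ∧ 2 * skolemPos2 s d + d = 2 * (6 * s + 4)) ∨
      (d = 4 * s + 2 ∧ skolemPos2 s d = 1) ∨
      (d = 4 * s + 1 ∧ skolemPos2 s d = 4 * s + 4) ∨
      (d = 4 * s ∧ skolemPos2 s d = 2 * s + 4) ∨
      (d = 2 * s + 1 ∧ skolemPos2 s d = 2) ∨
      (d = 1 ∧ skolemPos2 s d = s + 2) ∨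
      (d % 2 = 1 ∧ 2 * s + 3 ≤ d ∧ d ≤ 4 * s - 1 ∧ 2 * skolemPos2 s d + d = 4 * s + 5) ∨
      (d % 2 = 1 ∧ 3 ≤ d ∧ d ≤ 2 * s - 1 ∧ 2 * skolemPos2 s d + d = 4 * s + 7) := by
  intro d h1 h2
  unfold skolemPos2
  split_ifs
  · right; left; refine ⟨?_, ?_⟩ <;> omega
  · right; right; left; refine ⟨?_, ?_⟩ <;> omega
  · right; right; right; left; refine ⟨?_, ?_⟩ <;> omega
  · right; right; right; right; left; refine ⟨?_, ?_⟩ <;> omega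
  · right; right; right; right; right; left; refine ⟨?_, ?_⟩ <;> omega
  · left; refine ⟨?_, ?_, ?_⟩ <;> omega
  · right; right; right; right; right; right; left; refine ⟨?_, ?_, ?_, ?_⟩ <;> omega
  · right; right; right; right; right; right; right; refine ⟨?_, ?_, ?_, ?_⟩ <;> omega

set_option maxHeartbeats 1000000 in
theorem skolem_case2 (t h s : ℕ) (hs : 1 ≤ s) (hn : t + 2 * h = 4 * s + 2) (hh : h ≤ 2 * s - 1) :
    ∃ f : WindmillVertex (List.replicate t 3 ++ List.replicate h 6) → ℕ,
      Function.Injective f ∧ (∀ v, f v ≤ 12 * s + 7) ∧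
      Set.BijOn (edgeLabel f) (Windmill (List.replicate t 3 ++ List.replicate h 6)).edgeSet
        ((Finset.Icc 1 (12 * s + 5) ∪ {12 * s + 7} : Finset ℕ) : Set ℕ) := by
  have spec := skolemPos2_spec s hs
  have even : ∀ u, 1 ≤ u → u ≤ h → skolemPos2 s (2 * u) + u = 6 * s + 4 := by
    intro u h1 h2
    have := spec (2 * u) (by omega) (by omega)
    omega
  refine labelling_of_skolem t h (4 * s + 2) _ (4 * s + 2 + 6 * s + 4) hn.symm _
    (fun d => 4 * s + 2 + skolemPos2 s d) ?_ ?_ ?_ ?_ ?_ ?_ ?_ ?_ ?_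
  · rw [Finset.card_union_of_disjoint (by rw [Finset.disjoint_singleton_right, Finset.mem_Icc]; omega), Nat.card_Icc, Finset.card_singleton]; omega
  · intro y hy
    simp only [Finset.mem_union, Finset.mem_Icc, Finset.mem_singleton] at hy
    omega
  · intro y h1 h2
    simp only [Finset.mem_union, Finset.mem_Icc, Finset.mem_singleton]
    omega
  · intro d h1 h2
    have := spec d h1 h2
    simp only [Finset.mem_union, Finset.mem_Icc, Finset.mem_singleton]
    omega
  · intro d d' h1 h2 h1' h2'
    have a := spec d h1 h2
    have b := spec d' h1' h2'
    generalize skolemPos2 s d = p at *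
    generalize skolemPos2 s d' = p' at *
    clear spec even
    refine ⟨?_, ?_, ?_⟩ <;> rcases a with h | h | h | h | h | h | h | h <;> rcases b with h | h | h | h | h | h | h | h <;> omega
  · intro u h1 h2
    have := even u h1 h2
    omega
  · omega
  · intro u h1 h2
    simp only [Finset.mem_union, Finset.mem_Icc, Finset.mem_singleton]
    omega
  · intro d h1 h2
    have := spec d h1 h2
    omega

/-- Left ends of a (hooked) Skolem sequence of order `4 * s - 1`, indexed by the difference. -/
def skolemPos3 (s d : ℕ) : ℕ :=
  if d = 4 * s - 2 then 2 * s + 1 else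
  if d = 1 then s else
  if d = 2 * s - 1 then 2 * s else
  if d = 4 * s - 1 then 4 * s else
  if d % 2 = 0 then 6 * s - 1 - d / 2 else
  if 2 * s + 1 ≤ d then (4 * s - 1 - d) / 2 else (4 * s + 1 - d) / 2

theorem skolemPos3_spec (s : ℕ) (hs : 2 ≤ s) : ∀ d, 1 ≤ d → d ≤ 4 * s - 1 →
      (d % 2 = 0 ∧ d ≤ 4 * s - 4 ∧ 2 * skolemPos3 s d + d = 2 * (6 * s - 1)) ∨
      (d = 4 * s - 2 ∧ skolemPos3 s d = 2 * s + 1) ∨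
      (d = 1 ∧ skolemPos3 s d = s) ∨
      (d = 2 * s - 1 ∧ skolemPos3 s d = 2 * s) ∨
      (d = 4 * s - 1 ∧ skolemPos3 s d = 4 * s) ∨
      (d % 2 = 1 ∧ 2 * s + 1 ≤ d ∧ d ≤ 4 * s - 3 ∧ 2 * skolemPos3 s d + d = 4 * s - 1) ∨
      (d % 2 = 1 ∧ 3 ≤ d ∧ d ≤ 2 * s - 3 ∧ 2 * skolemPos3 s d + d = 4 * s + 1) := by
  intro d h1 h2
  unfold skolemPos3
  split_ifs
  · right; left; refine ⟨?_, ?_⟩ <;> omega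
  · right; right; left; refine ⟨?_, ?_⟩ <;> omega
  · right; right; right; left; refine ⟨?_, ?_⟩ <;> omega
  · right; right; right; right; left; refine ⟨?_, ?_⟩ <;> omega
  · left; refine ⟨?_, ?_, ?_⟩ <;> omega
  · right; right; right; right; right; left; refine ⟨?_, ?_, ?_, ?_⟩ <;> omega
  · right; right; right; right; right; right; refine ⟨?_, ?_, ?_, ?_⟩ <;> omega

set_option maxHeartbeats 1000000 in
theorem skolem_case3 (t h s : ℕ) (hs : 2 ≤ s) (hn : t + 2 * h = 4 * s - 1) (hh : h ≤ 2 * s - 2) :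
    ∃ f : WindmillVertex (List.replicate t 3 ++ List.replicate h 6) → ℕ,
      Function.Injective f ∧ (∀ v, f v ≤ 12 * s - 2) ∧
      Set.BijOn (edgeLabel f) (Windmill (List.replicate t 3 ++ List.replicate h 6)).edgeSet
        ((Finset.Icc 1 (12 * s - 4) ∪ {12 * s - 2} : Finset ℕ) : Set ℕ) := by
  have spec := skolemPos3_spec s hs
  have even : ∀ u, 1 ≤ u → u ≤ h → skolemPos3 s (2 * u) + u = 6 * s - 1 := by
    intro u h1 h2
    have := spec (2 * u) (by omega) (by omega)
    omega
  refine labelling_of_skolem t h (4 * s - 1) _ (4 * s - 1 + 6 * s - 1) hn.symm _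
    (fun d => 4 * s - 1 + skolemPos3 s d) ?_ ?_ ?_ ?_ ?_ ?_ ?_ ?_ ?_
  · rw [Finset.card_union_of_disjoint (by rw [Finset.disjoint_singleton_right, Finset.mem_Icc]; omega), Nat.card_Icc, Finset.card_singleton]; omega
  · intro y hy
    simp only [Finset.mem_union, Finset.mem_Icc, Finset.mem_singleton] at hy
    omega
  · intro y h1 h2
    simp only [Finset.mem_union, Finset.mem_Icc, Finset.mem_singleton]
    omega
  · intro d h1 h2
    have := spec d h1 h2
    simp only [Finset.mem_union, Finset.mem_Icc, Finset.mem_singleton]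
    omega
  · intro d d' h1 h2 h1' h2'
    have a := spec d h1 h2
    have b := spec d' h1' h2'
    generalize skolemPos3 s d = p at *
    generalize skolemPos3 s d' = p' at *
    clear spec even
    refine ⟨?_, ?_, ?_⟩ <;> rcases a with h | h | h | h | h | h | h <;> rcases b with h | h | h | h | h | h | h <;> omega
  · intro u h1 h2
    have := even u h1 h2
    omega
  · omega
  · intro u h1 h2
    simp only [Finset.mem_union, Finset.mem_Icc, Finset.mem_singleton]
    omega
  · intro d h1 h2
    have := spec d h1 h2
    omega

/-- Vertex labels read off a table of vanes. -/
def tableLabel (T : List (List ℕ)) (i k : ℕ) : ℕ := (T.getD i []).getD k 0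

theorem graceful_of_bijOn (t h : ℕ) (S : Finset ℕ) (N : ℕ) (hN : N = 3 * t + 6 * h)
    (hS : S = Finset.Icc 1 N)
    (H : ∃ f : WindmillVertex (List.replicate t 3 ++ List.replicate h 6) → ℕ,
      Function.Injective f ∧ (∀ v, f v ≤ N) ∧
      Set.BijOn (edgeLabel f) (Windmill (List.replicate t 3 ++ List.replicate h 6)).edgeSet
        (S : Set ℕ)) :
    IsGraceful (Windmill (List.replicate t 3 ++ List.replicate h 6)) (3 * t + 6 * h) := by
  subst hN hS
  obtain ⟨f, h1, h2, h3⟩ := H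
  exact ⟨f, h1, h2, by simpa using h3⟩

theorem nearGraceful_of_bijOn (t h : ℕ) (S : Finset ℕ) (N : ℕ) (hN : N = 3 * t + 6 * h + 1)
    (hS : S = Finset.Icc 1 (3 * t + 6 * h - 1) ∪ {3 * t + 6 * h + 1})
    (H : ∃ f : WindmillVertex (List.replicate t 3 ++ List.replicate h 6) → ℕ,
      Function.Injective f ∧ (∀ v, f v ≤ N) ∧
      Set.BijOn (edgeLabel f) (Windmill (List.replicate t 3 ++ List.replicate h 6)).edgeSet
        (S : Set ℕ)) :
    IsNearGraceful (Windmill (List.replicate t 3 ++ List.replicate h 6)) (3 * t + 6 * h) := by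
  subst hN hS
  obtain ⟨f, h1, h2, h3⟩ := H
  refine ⟨f, h1, h2, Or.inr ?_⟩
  rw [Finset.coe_union, Finset.coe_Icc, Finset.coe_singleton] at h3
  exact h3

set_option synthInstance.maxHeartbeats 400000 in
set_option synthInstance.maxSize 4096 in
theorem small_1_1 :
    IsNearGraceful (Windmill (List.replicate 1 3 ++ List.replicate 1 6)) (3 * 1 + 6 * 1) := by
  refine nearGraceful_of_bijOn 1 1 (Finset.Icc 1 8 ∪ {10}) 10 (by norm_num) rfl ?_
  refine c3c6_of_arith 1 1 _ _ (tableLabel [[0, 8, 10], [0, 6, 1, 5, 4, 7]]) ?_ ?_ ?_ ?_ ?_ ?_ ?_ <;>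
    decide +kernel

set_option synthInstance.maxHeartbeats 400000 in
set_option synthInstance.maxSize 4096 in
theorem small_2_1 :
    IsGraceful (Windmill (List.replicate 2 3 ++ List.replicate 1 6)) (3 * 2 + 6 * 1) := by
  refine graceful_of_bijOn 2 1 (Finset.Icc 1 12) 12 (by norm_num) rfl ?_
  refine c3c6_of_arith 2 1 _ _ (tableLabel [[0, 11, 12], [0, 8, 10], [0, 7, 2, 6, 3, 9]]) ?_ ?_ ?_ ?_ ?_ ?_ ?_ <;>
    decide +kernel

set_option synthInstance.maxHeartbeats 400000 in
set_option synthInstance.maxSize 4096 in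
theorem small_1_2 :
    IsGraceful (Windmill (List.replicate 1 3 ++ List.replicate 2 6)) (3 * 1 + 6 * 2) := by
  refine graceful_of_bijOn 1 2 (Finset.Icc 1 15) 15 (by norm_num) rfl ?_
  refine c3c6_of_arith 1 2 _ _ (tableLabel [[0, 14, 15], [0, 12, 1, 11, 4, 13], [0, 6, 2, 7, 10, 8]]) ?_ ?_ ?_ ?_ ?_ ?_ ?_ <;>
    decide +kernel

set_option synthInstance.maxHeartbeats 400000 in
set_option synthInstance.maxSize 4096 in
theorem small_3_1 :
    IsGraceful (Windmill (List.replicate 3 3 ++ List.replicate 1 6)) (3 * 3 + 6 * 1) := by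
  refine graceful_of_bijOn 3 1 (Finset.Icc 1 15) 15 (by norm_num) rfl ?_
  refine c3c6_of_arith 3 1 _ _ (tableLabel [[0, 14, 15], [0, 11, 13], [0, 9, 12], [0, 8, 2, 7, 3, 10]]) ?_ ?_ ?_ ?_ ?_ ?_ ?_ <;>
    decide +kernel

set_option synthInstance.maxHeartbeats 400000 in
set_option synthInstance.maxSize 4096 in
theorem small_2_2 :
    IsNearGraceful (Windmill (List.replicate 2 3 ++ List.replicate 2 6)) (3 * 2 + 6 * 2) := by
  refine nearGraceful_of_bijOn 2 2 (Finset.Icc 1 17 ∪ {19}) 19 (by norm_num) rfl ?_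
  refine c3c6_of_arith 2 2 _ _ (tableLabel [[0, 17, 19], [0, 15, 16], [0, 13, 1, 12, 4, 14], [0, 7, 2, 8, 5, 9]]) ?_ ?_ ?_ ?_ ?_ ?_ ?_ <;>
    decide +kernel

set_option synthInstance.maxHeartbeats 400000 in
set_option synthInstance.maxSize 4096 in
theorem small_1_3 :
    IsNearGraceful (Windmill (List.replicate 1 3 ++ List.replicate 3 6)) (3 * 1 + 6 * 3) := by
  refine nearGraceful_of_bijOn 1 3 (Finset.Icc 1 20 ∪ {22}) 22 (by norm_num) rfl ?_
  refine c3c6_of_arith 1 3 _ _ (tableLabel [[0, 20, 22], [0, 18, 1, 17, 4, 19], [0, 12, 2, 13, 5, 14], [0, 6, 9, 8, 3, 7]]) ?_ ?_ ?_ ?_ ?_ ?_ ?_ <;>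
    decide +kernel

set_option synthInstance.maxHeartbeats 400000 in
set_option synthInstance.maxSize 4096 in
theorem small_2_4 :
    IsNearGraceful (Windmill (List.replicate 2 3 ++ List.replicate 4 6)) (3 * 2 + 6 * 4) := by
  refine nearGraceful_of_bijOn 2 4 (Finset.Icc 1 29 ∪ {31}) 31 (by norm_num) rfl ?_
  refine c3c6_of_arith 2 4 _ _ (tableLabel [[0, 29, 31], [0, 27, 28], [0, 25, 1, 24, 4, 26], [0, 19, 2, 20, 5, 21], [0, 13, 3, 15, 7, 14], [0, 9, 6, 12, 16, 11]]) ?_ ?_ ?_ ?_ ?_ ?_ ?_ <;>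
    decide +kernel

/-- Let `t ≥ 1` and `h ≥ 1` with `h ≤ 2t + 1`.  The variable windmill `C₃ᵗC₆ʰ` (which has
`3t + 6h` edges) is graceful when `t + 2h ≡ 0, 1 (mod 4)` and near graceful when
`t + 2h ≡ 2, 3 (mod 4)`. -/
theorem C3C6_windmill_graceful (t h : ℕ) (ht : 1 ≤ t) (hh : 1 ≤ h)
    (hbound : h ≤ 2 * t + 1) :
    (((t + 2 * h) % 4 = 0 ∨ (t + 2 * h) % 4 = 1) →
      IsGraceful (Windmill (List.replicate t 3 ++ List.replicate h 6)) (3 * t + 6 * h)) ∧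
    (((t + 2 * h) % 4 = 2 ∨ (t + 2 * h) % 4 = 3) →
      IsNearGraceful (Windmill (List.replicate t 3 ++ List.replicate h 6)) (3 * t + 6 * h)) := by
  constructor
  · intro hmod
    rcases hmod with h0 | h0
    · obtain ⟨s, hs⟩ : ∃ s, t + 2 * h = 4 * s := ⟨(t + 2 * h) / 4, by omega⟩
      by_cases hsmall : 2 ≤ s
      · exact graceful_of_bijOn t h _ _ (by omega) rfl (skolem_case0 t h s hsmall hs (by omega))
      · obtain ⟨rfl, rfl⟩ : t = 2 ∧ h = 1 := by omega
        exact small_2_1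
    · obtain ⟨s, hs⟩ : ∃ s, t + 2 * h = 4 * s + 1 := ⟨(t + 2 * h) / 4, by omega⟩
      by_cases hsmall : 2 ≤ s
      · exact graceful_of_bijOn t h _ _ (by omega) rfl (skolem_case1 t h s hsmall hs (by omega))
      · obtain ⟨rfl, rfl⟩ | ⟨rfl, rfl⟩ : (t = 1 ∧ h = 2) ∨ (t = 3 ∧ h = 1) := by omega
        · exact small_1_2
        · exact small_3_1
  · intro hmod
    rcases hmod with h0 | h0
    · obtain ⟨s, hs⟩ : ∃ s, t + 2 * h = 4 * s + 2 := ⟨(t + 2 * h) / 4, by omega⟩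
      by_cases hsmall : h ≤ 2 * s - 1
      · refine nearGraceful_of_bijOn t h _ _ (by omega) ?_
          (skolem_case2 t h s (by omega) hs hsmall)
        rw [show 3 * t + 6 * h - 1 = 12 * s + 5 by omega,
          show 3 * t + 6 * h + 1 = 12 * s + 7 by omega]
      · obtain ⟨rfl, rfl⟩ | ⟨rfl, rfl⟩ : (t = 2 ∧ h = 2) ∨ (t = 2 ∧ h = 4) := by omega
        · exact small_2_2
        · exact small_2_4
    · obtain ⟨s, hs⟩ : ∃ s, t + 2 * h = 4 * s - 1 := ⟨(t + 2 * h) / 4 + 1, by omega⟩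
      by_cases hsmall : 2 ≤ s ∧ h ≤ 2 * s - 2
      · refine nearGraceful_of_bijOn t h _ _ (by omega) ?_
          (skolem_case3 t h s hsmall.1 hs hsmall.2)
        rw [show 3 * t + 6 * h - 1 = 12 * s - 4 by omega,
          show 3 * t + 6 * h + 1 = 12 * s - 2 by omega]
      · obtain ⟨rfl, rfl⟩ | ⟨rfl, rfl⟩ : (t = 1 ∧ h = 1) ∨ (t = 1 ∧ h = 3) := by omega
        · exact small_1_1
        · exact small_1_3
end

section
/- Let n = 2k+1 with k ≥ 5 an integer. If n ≡ 3 (mod 4), there exists an (n−1)-near-Skolem sequence of order n none of whose right endpoints lies in a position in {1,2,...,k+2}; if n ≡ 1 (mod 4), there exists a hooked (n−1)-near-Skolem sequence of order n none of whose right endpoints lies in a position in {1,2,...,k+2}. -/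
/-- A Skolem-type collection of pairs indexed by `S`: for each `k ∈ S` there is a pair
`(a k, b k)` with `b k − a k = k`, and the entries of all the pairs partition the
finite set of positions `T` (the map sending each "pair slot" to its entry is a
bijection onto `T`). -/
def IsSkolemTypeOn (S T : Finset ℕ) (a b : ℕ → ℕ) : Prop :=
  (∀ k ∈ S, b k = a k + k) ∧
    Set.BijOn (fun p : ℕ × Bool => if p.2 then b p.1 else a p.1)
      ↑(S ×ˢ (Finset.univ : Finset Bool)) ↑T

/-- A surjection between finite sets of equal size is a bijection; so it is enough to cover `T`. -/
lemma isSkolemTypeOn_of_cover (S T : Finset ℕ) (a : ℕ → ℕ)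
    (hcard : S.card * 2 = T.card)
    (h : ∀ p ∈ T, ∃ d ∈ S, p = a d ∨ p = a d + d) :
    IsSkolemTypeOn S T a (fun d => a d + d) := by
  refine ⟨fun _ _ => rfl, ?_⟩
  set f : ℕ × Bool → ℕ := fun p => if p.2 then a p.1 + p.1 else a p.1 with hf
  have hsub : T ⊆ (S ×ˢ (Finset.univ : Finset Bool)).image f := by
    intro p hp
    obtain ⟨d, hd, h1 | h1⟩ := h p hp
    · exact Finset.mem_image.2 ⟨(d, false), by simp [hd], by simp [hf, h1]⟩
    · exact Finset.mem_image.2 ⟨(d, true), by simp [hd], by simp [hf, h1]⟩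
  have hc : (S ×ˢ (Finset.univ : Finset Bool)).card = T.card := by
    rw [Finset.card_product, ← hcard]; simp
  have heq : T = (S ×ˢ (Finset.univ : Finset Bool)).image f :=
    Finset.eq_of_subset_of_card_le hsub (hc ▸ Finset.card_image_le)
  have hinj : Set.InjOn f ↑(S ×ˢ (Finset.univ : Finset Bool)) := by
    apply Finset.card_image_iff.1
    rw [← heq, hc]
  have hb := hinj.bijOn_image
  rw [← Finset.coe_image, ← heq] at hb
  exact hb

lemma card_diffs (k : ℕ) (hk : 1 ≤ k) :
    ((Finset.Icc 1 (2 * k + 1)).erase (2 * k)).card = 2 * k := by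
  rw [Finset.card_erase_of_mem (by simp; omega)]; simp

/-- Left endpoints, case `k = 2 s + 1`. -/
def leftA (s d : ℕ) : ℕ :=
  if d ≤ 7 then
    if d = 1 then 3 * s + 1 else if d = 2 then 6 * s - 1 else if d = 3 then 8 * s - 1
    else if d = 4 then 8 * s - 3 else if d = 5 then 8 * s - 5 else if d = 6 then 8 * s - 2
    else 8 * s - 4
  else if d % 2 = 0 then
    if d ≤ 2 * s then (4 * s - d) / 2 else if d = 2 * s + 2 then 2 * s
    else (4 * s + 2 - d) / 2
  else if d + 9 ≤ 4 * s then (12 * s - 3 - d) / 2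
  else if d + 7 = 4 * s then 2 * s + 2 else if d + 5 = 4 * s then 2 * s + 3
  else if d + 3 = 4 * s then 2 * s - 1 else if d + 1 = 4 * s then 2 * s - 2
  else if d = 4 * s + 1 then 2 * s + 1 else 2 * s - 3

/-- Left endpoints, case `k = 2 s`. -/
def leftB (s d : ℕ) : ℕ :=
  if d ≤ 6 then
    if d = 1 then 3 * s + 1 else if d = 2 then 8 * s - 3 else if d = 3 then 8 * s - 9
    else if d = 4 then 8 * s - 8 else if d = 5 then 8 * s - 7 else 8 * s - 5
  else if d % 2 = 0 then
    if d ≤ 2 * s + 2 then (4 * s - 2 - d) / 2 else if d = 2 * s + 4 then 2 * s - 4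
    else (4 * s - d) / 2
  else if d + 11 ≤ 4 * s then (12 * s - 9 - d) / 2
  else (8 * s - 5 - d) / 2

set_option maxHeartbeats 4000000 in
lemma coverA (s p : ℕ) (hs : 4 ≤ s) (hp : 1 ≤ p) (hp1 : p ≤ 8 * s + 4) :
    ∃ d, (1 ≤ d ∧ d ≤ 2 * (2 * s + 1) + 1 ∧ d ≠ 2 * (2 * s + 1)) ∧ (p = leftA s d ∨ p = leftA s d + d) := by
  have key : (p = 3 * s + 1 ∨ p = 3 * s + 1 + (1)) ∨
      (p = 6 * s - 1 ∨ p = 6 * s - 1 + (2)) ∨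
      (p = 8 * s - 1 ∨ p = 8 * s - 1 + (3)) ∨
      (p = 8 * s - 3 ∨ p = 8 * s - 3 + (4)) ∨
      (p = 8 * s - 5 ∨ p = 8 * s - 5 + (5)) ∨
      (p = 8 * s - 2 ∨ p = 8 * s - 2 + (6)) ∨
      (p = 8 * s - 4 ∨ p = 8 * s - 4 + (7)) ∨
      (p = 2 * s ∨ p = 2 * s + (2 * s + 2)) ∨
      (p = 2 * s + 2 ∨ p = 2 * s + 2 + (4 * s - 7)) ∨
      (p = 2 * s + 3 ∨ p = 2 * s + 3 + (4 * s - 5)) ∨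
      (p = 2 * s - 1 ∨ p = 2 * s - 1 + (4 * s - 3)) ∨
      (p = 2 * s - 2 ∨ p = 2 * s - 2 + (4 * s - 1)) ∨
      (p = 2 * s + 1 ∨ p = 2 * s + 1 + (4 * s + 1)) ∨
      (p = 2 * s - 3 ∨ p = 2 * s - 3 + (4 * s + 3)) ∨
      (1 ≤ p ∧ p ≤ s - 1) ∨
      (3 * s + 3 ≤ p ∧ p ≤ 4 * s + 1) ∨
      (s ≤ p ∧ p ≤ 2 * s - 4) ∨
      (2 * s + 4 ≤ p ∧ p ≤ 3 * s) ∨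
      (4 * s + 3 ≤ p ∧ p ≤ 6 * s - 6) ∨
      (6 * s + 3 ≤ p ∧ p ≤ 8 * s - 6) := by omega
  clear hp hp1
  rcases key with h | h | h | h | h | h | h | h | h | h | h | h | h | h | h | h | h | h | h | h
  · have e : leftA s (1) = 3 * s + 1 := by clear h; unfold leftA; split_ifs <;> omega
    exact ⟨1, by omega, by rw [e]; exact h⟩
  · have e : leftA s (2) = 6 * s - 1 := by clear h; unfold leftA; split_ifs <;> omega
    exact ⟨2, by omega, by rw [e]; exact h⟩
  · have e : leftA s (3) = 8 * s - 1 := by clear h; unfold leftA; split_ifs <;> omega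
    exact ⟨3, by omega, by rw [e]; exact h⟩
  · have e : leftA s (4) = 8 * s - 3 := by clear h; unfold leftA; split_ifs <;> omega
    exact ⟨4, by omega, by rw [e]; exact h⟩
  · have e : leftA s (5) = 8 * s - 5 := by clear h; unfold leftA; split_ifs <;> omega
    exact ⟨5, by omega, by rw [e]; exact h⟩
  · have e : leftA s (6) = 8 * s - 2 := by clear h; unfold leftA; split_ifs <;> omega
    exact ⟨6, by omega, by rw [e]; exact h⟩
  · have e : leftA s (7) = 8 * s - 4 := by clear h; unfold leftA; split_ifs <;> omega
    exact ⟨7, by omega, by rw [e]; exact h⟩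
  · have e : leftA s (2 * s + 2) = 2 * s := by clear h; unfold leftA; split_ifs <;> omega
    exact ⟨2 * s + 2, by omega, by rw [e]; exact h⟩
  · have e : leftA s (4 * s - 7) = 2 * s + 2 := by clear h; unfold leftA; split_ifs <;> omega
    exact ⟨4 * s - 7, by omega, by rw [e]; exact h⟩
  · have e : leftA s (4 * s - 5) = 2 * s + 3 := by clear h; unfold leftA; split_ifs <;> omega
    exact ⟨4 * s - 5, by omega, by rw [e]; exact h⟩
  · have e : leftA s (4 * s - 3) = 2 * s - 1 := by clear h; unfold leftA; split_ifs <;> omega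
    exact ⟨4 * s - 3, by omega, by rw [e]; exact h⟩
  · have e : leftA s (4 * s - 1) = 2 * s - 2 := by clear h; unfold leftA; split_ifs <;> omega
    exact ⟨4 * s - 1, by omega, by rw [e]; exact h⟩
  · have e : leftA s (4 * s + 1) = 2 * s + 1 := by clear h; unfold leftA; split_ifs <;> omega
    exact ⟨4 * s + 1, by omega, by rw [e]; exact h⟩
  · have e : leftA s (4 * s + 3) = 2 * s - 3 := by clear h; unfold leftA; split_ifs <;> omega
    exact ⟨4 * s + 3, by omega, by rw [e]; exact h⟩
  · have e : leftA s (4 * s + 2 - 2 * p) = p := by unfold leftA; split_ifs <;> omega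
    exact ⟨4 * s + 2 - 2 * p, by omega, by rw [e]; omega⟩
  · have e : leftA s (2 * p - 4 * s - 2) = p - (2 * p - 4 * s - 2) := by unfold leftA; split_ifs <;> omega
    exact ⟨2 * p - 4 * s - 2, by omega, by rw [e]; omega⟩
  · have e : leftA s (4 * s - 2 * p) = p := by unfold leftA; split_ifs <;> omega
    exact ⟨4 * s - 2 * p, by omega, by rw [e]; omega⟩
  · have e : leftA s (2 * p - 4 * s) = p - (2 * p - 4 * s) := by unfold leftA; split_ifs <;> omega
    exact ⟨2 * p - 4 * s, by omega, by rw [e]; omega⟩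
  · have e : leftA s (12 * s - 3 - 2 * p) = p := by unfold leftA; split_ifs <;> omega
    exact ⟨12 * s - 3 - 2 * p, by omega, by rw [e]; omega⟩
  · have e : leftA s (2 * p + 3 - 12 * s) = p - (2 * p + 3 - 12 * s) := by unfold leftA; split_ifs <;> omega
    exact ⟨2 * p + 3 - 12 * s, by omega, by rw [e]; omega⟩

lemma rightA (s d : ℕ) (hs : 4 ≤ s) (h1 : 1 ≤ d) (h2 : d ≤ 2 * (2 * s + 1) + 1) (_h3 : d ≠ 2 * (2 * s + 1)) :
    2 * s + 1 + 2 < leftA s d + d := by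
  unfold leftA; split_ifs <;> omega

set_option maxHeartbeats 4000000 in
lemma coverB (s p : ℕ) (hs : 4 ≤ s) (hp : 1 ≤ p) (hp1 : p ≤ 8 * s + 1) (hp2 : p ≠ 8 * s) :
    ∃ d, (1 ≤ d ∧ d ≤ 2 * (2 * s) + 1 ∧ d ≠ 2 * (2 * s)) ∧ (p = leftB s d ∨ p = leftB s d + d) := by
  have key : (p = 3 * s + 1 ∨ p = 3 * s + 1 + (1)) ∨
      (p = 8 * s - 3 ∨ p = 8 * s - 3 + (2)) ∨
      (p = 8 * s - 9 ∨ p = 8 * s - 9 + (3)) ∨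
      (p = 8 * s - 8 ∨ p = 8 * s - 8 + (4)) ∨
      (p = 8 * s - 7 ∨ p = 8 * s - 7 + (5)) ∨
      (p = 8 * s - 5 ∨ p = 8 * s - 5 + (6)) ∨
      (p = 2 * s - 4 ∨ p = 2 * s - 4 + (2 * s + 4)) ∨
      (1 ≤ p ∧ p ≤ s - 3) ∨
      (3 * s + 3 ≤ p ∧ p ≤ 4 * s - 1) ∨
      (s - 2 ≤ p ∧ p ≤ 2 * s - 5) ∨
      (2 * s + 3 ≤ p ∧ p ≤ 3 * s) ∨
      (2 * s - 3 ≤ p ∧ p ≤ 2 * s + 2) ∨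
      (6 * s - 7 ≤ p ∧ p ≤ 6 * s - 2) ∨
      (4 * s + 1 ≤ p ∧ p ≤ 6 * s - 8) ∨
      (6 * s - 1 ≤ p ∧ p ≤ 8 * s - 10) := by omega
  clear hp hp1 hp2
  rcases key with h | h | h | h | h | h | h | h | h | h | h | h | h | h | h
  · have e : leftB s (1) = 3 * s + 1 := by clear h; unfold leftB; split_ifs <;> omega
    exact ⟨1, by omega, by rw [e]; exact h⟩
  · have e : leftB s (2) = 8 * s - 3 := by clear h; unfold leftB; split_ifs <;> omega
    exact ⟨2, by omega, by rw [e]; exact h⟩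
  · have e : leftB s (3) = 8 * s - 9 := by clear h; unfold leftB; split_ifs <;> omega
    exact ⟨3, by omega, by rw [e]; exact h⟩
  · have e : leftB s (4) = 8 * s - 8 := by clear h; unfold leftB; split_ifs <;> omega
    exact ⟨4, by omega, by rw [e]; exact h⟩
  · have e : leftB s (5) = 8 * s - 7 := by clear h; unfold leftB; split_ifs <;> omega
    exact ⟨5, by omega, by rw [e]; exact h⟩
  · have e : leftB s (6) = 8 * s - 5 := by clear h; unfold leftB; split_ifs <;> omega
    exact ⟨6, by omega, by rw [e]; exact h⟩
  · have e : leftB s (2 * s + 4) = 2 * s - 4 := by clear h; unfold leftB; split_ifs <;> omega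
    exact ⟨2 * s + 4, by omega, by rw [e]; exact h⟩
  · have e : leftB s (4 * s - 2 * p) = p := by unfold leftB; split_ifs <;> omega
    exact ⟨4 * s - 2 * p, by omega, by rw [e]; omega⟩
  · have e : leftB s (2 * p - 4 * s) = p - (2 * p - 4 * s) := by unfold leftB; split_ifs <;> omega
    exact ⟨2 * p - 4 * s, by omega, by rw [e]; omega⟩
  · have e : leftB s (4 * s - 2 - 2 * p) = p := by unfold leftB; split_ifs <;> omega
    exact ⟨4 * s - 2 - 2 * p, by omega, by rw [e]; omega⟩
  · have e : leftB s (2 * p + 2 - 4 * s) = p - (2 * p + 2 - 4 * s) := by unfold leftB; split_ifs <;> omega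
    exact ⟨2 * p + 2 - 4 * s, by omega, by rw [e]; omega⟩
  · have e : leftB s (8 * s - 5 - 2 * p) = p := by unfold leftB; split_ifs <;> omega
    exact ⟨8 * s - 5 - 2 * p, by omega, by rw [e]; omega⟩
  · have e : leftB s (2 * p + 5 - 8 * s) = p - (2 * p + 5 - 8 * s) := by unfold leftB; split_ifs <;> omega
    exact ⟨2 * p + 5 - 8 * s, by omega, by rw [e]; omega⟩
  · have e : leftB s (12 * s - 9 - 2 * p) = p := by unfold leftB; split_ifs <;> omega
    exact ⟨12 * s - 9 - 2 * p, by omega, by rw [e]; omega⟩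
  · have e : leftB s (2 * p + 9 - 12 * s) = p - (2 * p + 9 - 12 * s) := by unfold leftB; split_ifs <;> omega
    exact ⟨2 * p + 9 - 12 * s, by omega, by rw [e]; omega⟩

lemma rightB (s d : ℕ) (hs : 4 ≤ s) (h1 : 1 ≤ d) (h2 : d ≤ 2 * (2 * s) + 1) (_h3 : d ≠ 2 * (2 * s)) :
    2 * s + 2 < leftB s d + d := by
  unfold leftB; split_ifs <;> omega

set_option maxRecDepth 100000 in
/-- Let `n = 2k + 1` with `k ≥ 5`.  If `n ≡ 3 (mod 4)`, there exists an `(n−1)`-near-Skolem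
sequence of order `n` (pairs `(aᵢ, bᵢ)`, `i ∈ {1,…,n} \ {n−1}`, with `bᵢ − aᵢ = i`,
partitioning `{1,…,2n−2}`) none of whose right endpoints lies in `{1,…,k+2}`; if
`n ≡ 1 (mod 4)`, there exists a hooked `(n−1)`-near-Skolem sequence of order `n` (the
entries partitioning `{1,…,2n−1} \ {2n−2}`) none of whose right endpoints lies in
`{1,…,k+2}`. -/
theorem near_skolem_defect_large_right_endpoints (k : ℕ) (hk : 5 ≤ k) :
    ((2 * k + 1) % 4 = 3 →
      ∃ a b : ℕ → ℕ,
        IsSkolemTypeOn ((Finset.Icc 1 (2 * k + 1)).erase (2 * k))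
          (Finset.Icc 1 (2 * (2 * k + 1) - 2)) a b ∧
        ∀ i ∈ (Finset.Icc 1 (2 * k + 1)).erase (2 * k), b i ∉ Finset.Icc 1 (k + 2)) ∧
    ((2 * k + 1) % 4 = 1 →
      ∃ a b : ℕ → ℕ,
        IsSkolemTypeOn ((Finset.Icc 1 (2 * k + 1)).erase (2 * k))
          ((Finset.Icc 1 (2 * (2 * k + 1) - 1)).erase (2 * (2 * k + 1) - 2)) a b ∧
        ∀ i ∈ (Finset.Icc 1 (2 * k + 1)).erase (2 * k), b i ∉ Finset.Icc 1 (k + 2)) := by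
  
  have hS : ∀ i, i ∈ (Finset.Icc 1 (2 * k + 1)).erase (2 * k) ↔
      (1 ≤ i ∧ i ≤ 2 * k + 1 ∧ i ≠ 2 * k) := by
    intro i; simp only [Finset.mem_erase, Finset.mem_Icc]; tauto
  have hcS := card_diffs k (by omega)
  have hcT : ((Finset.Icc 1 (2 * (2 * k + 1) - 1)).erase (2 * (2 * k + 1) - 2)).card = 4 * k := by
    rw [Finset.card_erase_of_mem (by simp; omega)]; simp; omega
  constructor
  · intro hmod
    by_cases h5 : k = 5
    · subst h5
      refine ⟨fun d => (([0, 18, 14, 17, 5, 6, 7, 1, 2, 3, 0, 4] : List ℕ)).getD d 0, fun d => (([0, 18, 14, 17, 5, 6, 7, 1, 2, 3, 0, 4] : List ℕ)).getD d 0 + d,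
        isSkolemTypeOn_of_cover _ _ (fun d => (([0, 18, 14, 17, 5, 6, 7, 1, 2, 3, 0, 4] : List ℕ)).getD d 0) ?_ ?_, ?_⟩ <;> decide
    by_cases h7 : k = 7
    · subst h7
      refine ⟨fun d => (([0, 20, 23, 24, 22, 8, 5, 7, 9, 1, 2, 4, 16, 6, 0, 3] : List ℕ)).getD d 0, fun d => (([0, 20, 23, 24, 22, 8, 5, 7, 9, 1, 2, 4, 16, 6, 0, 3] : List ℕ)).getD d 0 + d,
        isSkolemTypeOn_of_cover _ _ (fun d => (([0, 20, 23, 24, 22, 8, 5, 7, 9, 1, 2, 4, 16, 6, 0, 3] : List ℕ)).getD d 0) ?_ ?_, ?_⟩ <;> decide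
    obtain ⟨s, rfl⟩ : ∃ s, k = 2 * s + 1 := ⟨k / 2, by omega⟩
    refine ⟨leftA s, fun d => leftA s d + d, isSkolemTypeOn_of_cover _ _ _ ?_ ?_, ?_⟩
    · rw [hcS]; simp; omega
    · intro p hp
      rw [Finset.mem_Icc] at hp
      obtain ⟨d, hd, h⟩ := coverA s p (by omega) (by omega) (by omega)
      exact ⟨d, (hS d).2 hd, h⟩
    · intro i hi
      obtain ⟨h1, h2, h3⟩ := (hS i).1 hi
      have := rightA s i (by omega) h1 h2 h3
      simp only [Finset.mem_Icc]; omega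
  · intro hmod
    by_cases h6 : k = 6
    · subst h6
      refine ⟨fun d => (([0, 15, 21, 19, 5, 20, 7, 3, 6, 2, 8, 1, 0, 4] : List ℕ)).getD d 0, fun d => (([0, 15, 21, 19, 5, 20, 7, 3, 6, 2, 8, 1, 0, 4] : List ℕ)).getD d 0 + d,
        isSkolemTypeOn_of_cover _ _ (fun d => (([0, 15, 21, 19, 5, 20, 7, 3, 6, 2, 8, 1, 0, 4] : List ℕ)).getD d 0) ?_ ?_, ?_⟩ <;> decide
    obtain ⟨s, rfl⟩ : ∃ s, k = 2 * s := ⟨k / 2, by omega⟩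
    refine ⟨leftB s, fun d => leftB s d + d, isSkolemTypeOn_of_cover _ _ _ ?_ ?_, ?_⟩
    · rw [hcS, hcT]; omega
    · intro p hp
      rw [Finset.mem_erase, Finset.mem_Icc] at hp
      obtain ⟨d, hd, h⟩ := coverB s p (by omega) (by omega) (by omega) (by omega)
      exact ⟨d, (hS d).2 hd, h⟩
    · intro i hi
      obtain ⟨h1, h2, h3⟩ := (hS i).1 hi
      have := rightB s i (by omega) h1 h2 h3
      simp only [Finset.mem_Icc]; omega
end
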